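/- Let X be a Borel subset of the Cantor space 2^ω such that the subspace X is homogeneous and X ∉ Δ. Then X is homeomorphic to a semifilter on ω. -/

import Mathlib

open Set

abbrev Cantor := ℕ → Bool

def UpwardClosed (S : Set Cantor) : Prop :=
  ∀ x ∈ S, ∀ y : Cantor, (∀ n, x n = true → y n = true) → y ∈ S

def DownwardClosed (R : Set Cantor) : Prop :=
  ∀ y ∈ R, ∀ x : Cantor, (∀ n, x n = true → y n = true) → x ∈ R

def ClosedUnderFinMod (S : Set Cantor) : Prop :=
  ∀ x ∈ S, ∀ y : Cantor, {n | x n ≠ y n}.Finite → y ∈ S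

def IsSemifilter (S : Set Cantor) : Prop :=
  (fun _ => false) ∉ S ∧ (fun _ => true) ∈ S ∧ UpwardClosed S ∧ ClosedUnderFinMod S

def IsSemiideal (R : Set Cantor) : Prop :=
  (fun _ => false) ∈ R ∧ (fun _ => true) ∉ R ∧ DownwardClosed R ∧ ClosedUnderFinMod R

def ClosedUnderInter (S : Set Cantor) : Prop :=
  ∀ x ∈ S, ∀ y ∈ S, (fun n => x n && y n) ∈ S

def IsFilterOnOmega (F : Set Cantor) : Prop := IsSemifilter F ∧ ClosedUnderInter F

def IsHomogeneous (X : Type*) [TopologicalSpace X] : Prop :=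
  ∀ x y : X, ∃ h : X ≃ₜ X, h x = y

def IsFsigma (A : Set Cantor) : Prop :=
  ∃ F : ℕ → Set Cantor, (∀ n, IsClosed (F n)) ∧ A = ⋃ n, F n

def DOmegaSigmaTwo (X : Set Cantor) : Prop :=
  ∃ A : ℕ → Set Cantor, (∀ n, IsFsigma (A n)) ∧ Monotone A ∧
    X = ⋃ n ∈ {n : ℕ | Odd n}, (A n \ ⋃ m < n, A m)

def InDelta (X : Set Cantor) : Prop := DOmegaSigmaTwo X ∧ DOmegaSigmaTwo Xᶜ

def WadgeLe (A B : Set Cantor) : Prop :=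
  ∃ f : Cantor → Cantor, Continuous f ∧ A = f ⁻¹' B

def WadgeEquiv (A B : Set Cantor) : Prop := WadgeLe A B ∧ WadgeLe B A

def CompletelyMetrizable (X : Type*) [t : TopologicalSpace X] : Prop :=
  ∃ m : MetricSpace X, m.toUniformSpace.toTopologicalSpace = t ∧
    @CompleteSpace X m.toUniformSpace

def FirstCategory (X : Type*) [TopologicalSpace X] : Prop :=
  ∃ f : ℕ → Set X, (∀ n, interior (closure (f n)) = ∅) ∧ (Set.univ : Set X) = ⋃ n, f n

def CantorFin : Set Cantor := {x | {n | x n = true}.Finite}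

def BorelSet (X : Set Cantor) : Prop := @MeasurableSet Cantor (borel Cantor) X


/-- A pruned game tree. -/
structure GT where
  T : Type
  len : T → ℕ
  par : T → T
  root : T
  len_root : len root = 0
  root_uniq : ∀ t, len t = 0 → t = root
  len_par : ∀ t, len (par t) = len t - 1
  child : ∀ t, ∃ s, len s = len t + 1 ∧ par s = t

namespace GT

def anc (G : GT) (n : ℕ) (t : G.T) : G.T := G.par^[G.len t - n] t

def Child (G : GT) (t s : G.T) : Prop := G.len s = G.len t + 1 ∧ G.par s = t

def IsPlay (G : GT) (x : ℕ → G.T) : Prop := ∀ n, G.len (x n) = n ∧ G.par (x (n+1)) = x n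

/-- `turn true n`: player I moves at positions of even length. -/
def turn (p : Bool) (n : ℕ) : Prop := if p then n % 2 = 0 else n % 2 = 1

theorem turn_true (n : ℕ) : turn true n ↔ n % 2 = 0 := by simp [turn]
theorem turn_false (n : ℕ) : turn false n ↔ n % 2 = 1 := by simp [turn]
theorem not_turn (p : Bool) (n : ℕ) : ¬ turn p n ↔ turn (!p) n := by
  cases p <;> simp [turn]

variable (G : GT)

theorem anc_ge {n : ℕ} {t : G.T} (h : G.len t ≤ n) : G.anc n t = t := by
  simp [anc, Nat.sub_eq_zero_of_le h]

theorem anc_self (t : G.T) : G.anc (G.len t) t = t := G.anc_ge le_rfl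

theorem anc_par {n : ℕ} {t : G.T} (h : n < G.len t) : G.anc n (G.par t) = G.anc n t := by
  unfold anc
  rw [G.len_par]
  obtain ⟨d, hd⟩ : ∃ d, G.len t = n + d + 1 := ⟨G.len t - n - 1, by omega⟩
  rw [hd, show n + d + 1 - 1 - n = d by omega, show n + d + 1 - n = d + 1 by omega]
  rfl

theorem len_iter (d : ℕ) (t : G.T) : G.len (G.par^[d] t) = G.len t - d := by
  induction d generalizing t with
  | zero => simp
  | succ d ih => rw [Function.iterate_succ_apply, ih, G.len_par]; omega

theorem len_anc {n : ℕ} {t : G.T} (h : n ≤ G.len t) : G.len (G.anc n t) = n := by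
  unfold anc; rw [len_iter]; omega

theorem len_anc_le (n : ℕ) (t : G.T) : G.len (G.anc n t) ≤ n := by
  unfold anc; rw [len_iter]; omega

theorem anc_anc {m n : ℕ} (h : m ≤ n) (t : G.T) : G.anc m (G.anc n t) = G.anc m t := by
  unfold anc
  rw [len_iter, ← Function.iterate_add_apply]
  congr 1
  rcases le_total (G.len t) n with h' | h' <;> congr 1 <;> omega

theorem par_anc {n : ℕ} {t : G.T} (h : n + 1 ≤ G.len t) : G.par (G.anc (n+1) t) = G.anc n t := by
  unfold anc
  rw [← Function.iterate_succ_apply' G.par]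
  congr 1; congr 1; omega

theorem anc_zero (t : G.T) : G.anc 0 t = G.root := G.root_uniq _ (G.len_anc (Nat.zero_le _))

variable {G}

theorem Child.anc {t s : G.T} (h : G.Child t s) {n : ℕ} (hn : n ≤ G.len t) :
    G.anc n s = G.anc n t := by
  rw [← h.2, G.anc_par]; have := h.1; omega

theorem IsPlay.anc {x : ℕ → G.T} (h : G.IsPlay x) {n m : ℕ} (hn : n ≤ m) : G.anc n (x m) = x n := by
  induction m, hn using Nat.le_induction with
  | base => exact G.anc_ge (h n).1.le
  | succ m hm ih => rw [← G.anc_par (by rw [(h _).1]; omega), (h m).2, ih]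

theorem IsPlay.child {x : ℕ → G.T} (h : G.IsPlay x) (n : ℕ) : G.Child (x n) (x (n+1)) :=
  ⟨by rw [(h _).1, (h _).1], (h n).2⟩

theorem child_anc {n : ℕ} {t : G.T} (h : n < G.len t) : G.Child (G.anc n t) (G.anc (n+1) t) :=
  ⟨by rw [G.len_anc h, G.len_anc h.le], G.par_anc h⟩

/-- A play through a given node. -/
theorem exists_play (t : G.T) : ∃ x, G.IsPlay x ∧ x (G.len t) = t := by
  choose c hc using G.child
  let y : ℕ → G.T := fun n => c^[n] t
  have hy : ∀ n, G.len (y n) = G.len t + n := by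
    intro n
    induction n with
    | zero => rfl
    | succ n ih => 
      show G.len (c^[n+1] t) = _
      rw [Function.iterate_succ_apply', (hc _).1]; change G.len (y n) + 1 = _; omega
  refine ⟨fun n => G.anc n (y n), ?_, ?_⟩
  · intro n
    refine ⟨G.len_anc (by rw [hy]; omega), ?_⟩
    show G.par (G.anc (n+1) (y (n+1))) = G.anc n (y n)
    rw [G.par_anc (by rw [hy]; omega)]
    show G.anc n (c^[n+1] t) = _
    rw [Function.iterate_succ_apply']
    have := hc (c^[n] t)
    rw [← G.anc_par (by rw [this.1]; change n < G.len (y n) + 1; rw [hy]; omega), this.2]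
  · show G.anc (G.len t) (y (G.len t)) = t
    have : ∀ n, G.anc (G.len t) (y n) = t := by
      intro n
      induction n with
      | zero => exact G.anc_self t
      | succ n ih =>
        show G.anc _ (c^[n+1] t) = t
        rw [Function.iterate_succ_apply']
        have := hc (c^[n] t)
        rw [← G.anc_par (by rw [this.1]; change _ < G.len (y n) + 1; rw [hy]; omega), this.2]
        exact ih
    exact this _

/-- Quasi-strategies. -/
structure IsStrat (G : GT) (p : Bool) (S : Set G.T) : Prop where
  root : G.root ∈ S
  par : ∀ t ∈ S, G.par t ∈ S
  mine : ∀ t ∈ S, turn p (G.len t) → ∃ s, G.Child t s ∧ s ∈ S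
  opp : ∀ t ∈ S, ¬ turn p (G.len t) → ∀ s, G.Child t s → s ∈ S

theorem IsStrat.anc {p : Bool} {S : Set G.T} (h : G.IsStrat p S) {t : G.T} (ht : t ∈ S) (n : ℕ) :
    G.anc n t ∈ S := by
  unfold GT.anc
  generalize G.len t - n = d
  induction d with
  | zero => exact ht
  | succ d ih => rw [Function.iterate_succ_apply']; exact h.par _ ih

/-- Forcing to reach a goal inside a set. -/
inductive Frc (G : GT) (p : Bool) (Sg goal : Set G.T) : G.T → Prop
  | base (t : G.T) : t ∈ Sg → t ∈ goal → Frc G p Sg goal t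
  | mine (t s : G.T) : t ∈ Sg → turn p (G.len t) → G.Child t s → s ∈ Sg → Frc G p Sg goal s →
      Frc G p Sg goal t
  | opp (t : G.T) : t ∈ Sg → ¬ turn p (G.len t) →
      (∀ s, G.Child t s → s ∈ Sg → Frc G p Sg goal s) → Frc G p Sg goal t

structure IsFTree (G : GT) (p : Bool) (Sg goal : Set G.T) (t : G.T) (Y : Set G.T) : Prop where
  mem : t ∈ Y
  sub : Y ⊆ Sg
  ext : ∀ s ∈ Y, G.len t ≤ G.len s ∧ G.anc (G.len t) s = t
  mine : ∀ s ∈ Y, turn p (G.len s) → ∃ r, G.Child s r ∧ r ∈ Y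
  opp : ∀ s ∈ Y, ¬ turn p (G.len s) → ∀ r, G.Child s r → r ∈ Sg → r ∈ Y
  hit : ∀ x, G.IsPlay x → (∀ n, G.len t ≤ n → x n ∈ Y) → ∃ n, G.len t ≤ n ∧ x n ∈ goal

theorem Frc.exists_tree {p : Bool} {Sg goal : Set G.T}
    (hS : ∀ t ∈ Sg, turn p (G.len t) → ∃ s, G.Child t s ∧ s ∈ Sg) {t : G.T}
    (h : G.Frc p Sg goal t) : ∃ Y, G.IsFTree p Sg goal t Y := by
  have key : ∀ (t : G.T) (C : Set G.T) (Z : G.T → Set G.T), t ∈ Sg →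
      (∀ c ∈ C, G.Child t c ∧ G.IsFTree p Sg goal c (Z c)) →
      (turn p (G.len t) → ∃ c, c ∈ C) →
      (¬ turn p (G.len t) → ∀ c, G.Child t c → c ∈ Sg → c ∈ C) →
      ∃ Y, G.IsFTree p Sg goal t Y := by
    intro t C Z ht hC h1 h2
    refine ⟨{t} ∪ {s | ∃ c ∈ C, s ∈ Z c}, ?_⟩
    have hext : ∀ s, (∃ c ∈ C, s ∈ Z c) → G.len t < G.len s ∧ G.anc (G.len t) s = t := by
      rintro s ⟨c, hc, hs⟩
      obtain ⟨h3, h4⟩ := (hC c hc).2.ext s hs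
      have h5 := (hC c hc).1.1
      refine ⟨by omega, ?_⟩
      rw [← G.anc_anc (show G.len t ≤ G.len c by omega), h4, (hC c hc).1.anc le_rfl, G.anc_self]
    constructor
    · simp
    · rintro s (rfl | ⟨c, hc, hs⟩)
      · exact ht
      · exact (hC c hc).2.sub hs
    · rintro s (rfl | hs)
      · exact ⟨le_rfl, G.anc_self _⟩
      · exact ⟨(hext s hs).1.le, (hext s hs).2⟩
    · rintro s (rfl | ⟨c, hc, hs⟩) hturn
      · obtain ⟨c, hc⟩ := h1 hturn
        exact ⟨c, (hC c hc).1, Or.inr ⟨c, hc, (hC c hc).2.mem⟩⟩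
      · obtain ⟨r, hr, hr'⟩ := (hC c hc).2.mine s hs hturn
        exact ⟨r, hr, Or.inr ⟨c, hc, hr'⟩⟩
    · rintro s (rfl | ⟨c, hc, hs⟩) hturn r hr hrS
      · exact Or.inr ⟨r, h2 hturn r hr hrS, (hC _ (h2 hturn r hr hrS)).2.mem⟩
      · exact Or.inr ⟨c, hc, (hC c hc).2.opp s hs hturn r hr hrS⟩
    · intro x hx hxY
      have hx1 := hxY (G.len t + 1) (by omega)
      have hx2 : ∃ c ∈ C, x (G.len t + 1) ∈ Z c := by
        rcases hx1 with h3 | h3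
        · have := (hx (G.len t + 1)).1
          rw [h3] at this; omega
        · exact h3
      obtain ⟨c, hc, hcx⟩ := hx2
      have hlc := (hC c hc).1.1
      have hcc : x (G.len t + 1) = c := by
        have := ((hC c hc).2.ext _ hcx).2
        rwa [G.anc_ge (by rw [(hx _).1]; omega)] at this
      obtain ⟨n, hn, hn'⟩ := (hC c hc).2.hit x hx (by
        intro n hn
        rcases hxY n (by omega) with h3 | ⟨c', hc', h4⟩
        · have := (hx n).1
          rw [h3] at this; omega
        · have h5 := ((hC c' hc').2.ext _ h4).2
          have hlc' := (hC c' hc').1.1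
          rw [hx.anc (by omega), hlc', hcc] at h5
          rw [h5]; exact h4)
      exact ⟨n, by omega, hn'⟩
  induction h with
  | base t ht hg =>
    refine ⟨{s ∈ Sg | G.len t ≤ G.len s ∧ G.anc (G.len t) s = t}, ?_⟩
    constructor
    · exact ⟨ht, le_rfl, G.anc_self t⟩
    · exact fun s hs => hs.1
    · exact fun s hs => hs.2
    · intro s hs hturn
      obtain ⟨r, hr, hr'⟩ := hS s hs.1 hturn
      exact ⟨r, hr, hr', by have := hr.1; have := hs.2.1; omega, by rw [hr.anc hs.2.1]; exact hs.2.2⟩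
    · intro s hs hturn r hr hr'
      exact ⟨hr', by have := hr.1; have := hs.2.1; omega, by rw [hr.anc hs.2.1]; exact hs.2.2⟩
    · intro x hx h
      refine ⟨G.len t, le_rfl, ?_⟩
      have := (h (G.len t) le_rfl).2.2
      rw [hx.anc le_rfl] at this
      rwa [this]
  | mine t s ht hturn hc hs _ ih =>
    obtain ⟨Y, hY⟩ := ih
    exact key t {s} (fun _ => Y) ht (by rintro c rfl; exact ⟨hc, hY⟩) (fun _ => ⟨s, rfl⟩)
      (fun h => absurd hturn h)
  | opp t ht hturn _ ih =>
    choose! Z hZ using ih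
    exact key t {c | G.Child t c ∧ c ∈ Sg} Z ht (fun c hc => ⟨hc.1, hZ c hc.1 hc.2⟩)
      (fun h => absurd h hturn) (fun _ c h1 h2 => ⟨h1, h2⟩)

def Decided (G : GT) (A : Set (ℕ → G.T)) : Prop :=
  ∃ N, ∀ x y, G.IsPlay x → G.IsPlay y → x N = y N → (x ∈ A ↔ y ∈ A)

theorem clopen_det (A : Set (ℕ → G.T)) (h : G.Decided A) :
    (∃ S, G.IsStrat true S ∧ ∀ x, G.IsPlay x → (∀ n, x n ∈ S) → x ∈ A) ∨
    (∃ S, G.IsStrat false S ∧ ∀ x, G.IsPlay x → (∀ n, x n ∈ S) → x ∉ A) := by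
  obtain ⟨N, hN⟩ := h
  let goal : Set G.T := {t | G.len t = N ∧ ∃ y, G.IsPlay y ∧ y N = t ∧ y ∈ A}
  by_cases hr : G.Frc true univ goal G.root
  · left
    obtain ⟨Y, hY⟩ := hr.exists_tree (fun t _ _ => by
      obtain ⟨s, hs⟩ := G.child t; exact ⟨s, hs, trivial⟩)
    refine ⟨{t | ∀ n, G.anc n t ∈ Y}, ?_, ?_⟩
    · constructor
      · intro n; rw [G.anc_ge (by rw [G.len_root]; omega)]; exact hY.mem
      · intro t ht n
        rcases lt_or_ge n (G.len t) with h | h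
        · rw [G.anc_par h]; exact ht n
        · rcases Nat.eq_zero_or_pos (G.len t) with h0 | h0
          · have : G.par t = t := by
              rw [G.root_uniq t h0]; apply G.root_uniq; rw [G.len_par, G.len_root]
            rw [this]; exact ht n
          · rw [G.anc_ge (by rw [G.len_par]; omega)]
            have := ht (G.len t - 1)
            rwa [← G.anc_par (by omega), G.anc_ge (by rw [G.len_par])] at this
      · intro t ht hturn
        obtain ⟨r, hr, hr'⟩ := hY.mine t (by have := ht (G.len t); rwa [G.anc_self] at this) hturn
        refine ⟨r, hr, fun n => ?_⟩
        rcases le_or_gt n (G.len t) with h | h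
        · rw [hr.anc h]; exact ht n
        · rw [G.anc_ge (by rw [hr.1]; omega)]; exact hr'
      · intro t ht hturn r hr n
        rcases le_or_gt n (G.len t) with h | h
        · rw [hr.anc h]; exact ht n
        · rw [G.anc_ge (by rw [hr.1]; omega)]
          exact hY.opp t (by have := ht (G.len t); rwa [G.anc_self] at this) hturn r hr trivial
    · intro x hx hxS
      obtain ⟨n, -, hn, y, hy, hyn, hyA⟩ := hY.hit x hx (fun n _ => by
        have := hxS n n; rwa [hx.anc le_rfl] at this)
      rw [(hx n).1] at hn
      subst hn
      exact (hN x y hx hy hyn.symm).2 hyA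
  · right
    refine ⟨{t | ∀ n, ¬ G.Frc true univ goal (G.anc n t)}, ?_, ?_⟩
    · constructor
      · intro n; rw [G.anc_ge (by rw [G.len_root]; omega)]; exact hr
      · intro t ht n
        rcases lt_or_ge n (G.len t) with h | h
        · rw [G.anc_par h]; exact ht n
        · rcases Nat.eq_zero_or_pos (G.len t) with h0 | h0
          · have : G.par t = t := by
              rw [G.root_uniq t h0]; apply G.root_uniq; rw [G.len_par, G.len_root]
            rw [this]; exact ht n
          · rw [G.anc_ge (by rw [G.len_par]; omega)]
            have := ht (G.len t - 1)
            rwa [← G.anc_par (by omega), G.anc_ge (by rw [G.len_par])] at this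
      · intro t ht hturn
        have ht' := ht (G.len t)
        rw [G.anc_self] at ht'
        have hturn' : ¬ turn true (G.len t) := by rw [turn_true]; rw [turn_false] at hturn; omega
        have : ∃ s, G.Child t s ∧ ¬ G.Frc true univ goal s := by
          by_contra hcon
          push Not at hcon
          exact ht' (Frc.opp t trivial hturn' (fun s hs _ => hcon s hs))
        obtain ⟨r, hr, hr'⟩ := this
        refine ⟨r, hr, fun n => ?_⟩
        rcases le_or_gt n (G.len t) with h | h
        · rw [hr.anc h]; exact ht n
        · rw [G.anc_ge (by rw [hr.1]; omega)]; exact hr'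
      · intro t ht hturn r hr n
        rcases le_or_gt n (G.len t) with h | h
        · rw [hr.anc h]; exact ht n
        · rw [G.anc_ge (by rw [hr.1]; omega)]
          have ht' := ht (G.len t)
          rw [G.anc_self] at ht'
          have hturn' : turn true (G.len t) := by rw [turn_true]; rw [turn_false] at hturn; omega
          exact fun h => ht' (Frc.mine t r trivial hturn' hr trivial h)
    · intro x hx hxS hxA
      have := hxS N N
      rw [hx.anc le_rfl] at this
      exact this (Frc.base _ trivial ⟨(hx N).1, x, hx, rfl, hxA⟩)

/-- Coverings of game trees. -/
structure Cov (k : ℕ) (H G : GT) where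
  f : H.T → G.T
  len_f : ∀ t, G.len (f t) = H.len t
  par_f : ∀ t, f (H.par t) = G.par (f t)
  bij : ∀ t : G.T, G.len t ≤ k → ∃! s, f s = t
  phi : Bool → Set H.T → Set G.T
  strat : ∀ p S, H.IsStrat p S → G.IsStrat p (phi p S)
  loc : ∀ p S S' n, H.IsStrat p S → H.IsStrat p S' →
    (∀ t, H.len t ≤ n → (t ∈ S ↔ t ∈ S')) → ∀ t, G.len t ≤ n → t ∈ phi p S → t ∈ phi p S'
  idk : ∀ p S, H.IsStrat p S → ∀ t, H.len t ≤ k → (f t ∈ phi p S ↔ t ∈ S)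
  lift : ∀ p S, H.IsStrat p S → ∀ x, G.IsPlay x → (∀ n, x n ∈ phi p S) →
    ∃ y, H.IsPlay y ∧ (∀ n, y n ∈ S) ∧ ∀ n, f (y n) = x n

def Cov.id (k : ℕ) (G : GT) : Cov k G G where
  f := fun t => t
  len_f := fun _ => rfl
  par_f := fun _ => rfl
  bij := fun t _ => ⟨t, rfl, fun _ h => h⟩
  phi := fun _ S => S
  strat := fun _ _ h => h
  loc := fun _ _ _ _ _ _ h t ht hS => (h t ht).1 hS
  idk := fun _ _ _ _ _ => Iff.rfl
  lift := fun _ _ _ x hx hxS => ⟨x, hx, hxS, fun _ => rfl⟩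

def Cov.mono {k l : ℕ} {H G : GT} (c : Cov l H G) (h : k ≤ l) : Cov k H G where
  f := c.f
  len_f := c.len_f
  par_f := c.par_f
  bij := fun t ht => c.bij t (ht.trans h)
  phi := c.phi
  strat := c.strat
  loc := c.loc
  idk := fun p S hS t ht => c.idk p S hS t (ht.trans h)
  lift := c.lift

def Cov.comp {k : ℕ} {K H G : GT} (d : Cov k K H) (c : Cov k H G) : Cov k K G where
  f := fun t => c.f (d.f t)
  len_f := fun t => by rw [c.len_f, d.len_f]
  par_f := fun t => by rw [d.par_f, c.par_f]
  bij := fun t ht => by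
    obtain ⟨s, hs, hs'⟩ := c.bij t ht
    simp only at hs hs'
    obtain ⟨r, hr, hr'⟩ := d.bij s (by rw [← c.len_f, hs]; exact ht)
    exact ⟨r, by simp only [hr, hs], fun q hq => hr' q (hs' _ hq)⟩
  phi := fun p S => c.phi p (d.phi p S)
  strat := fun p S h => c.strat p _ (d.strat p S h)
  loc := fun p S S' n h h' H t ht hm => c.loc p _ _ n (d.strat p S h) (d.strat p S' h')
    (fun s hs => ⟨d.loc p S S' n h h' H s hs,
      d.loc p S' S n h' h (fun t ht => (H t ht).symm) s hs⟩) t ht hm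
  idk := fun p S h t ht => by
    rw [c.idk p _ (d.strat p S h) _ (by rw [d.len_f]; exact ht), d.idk p S h t ht]
  lift := fun p S h x hx hxS => by
    obtain ⟨y, hy, hyS, hyx⟩ := c.lift p _ (d.strat p S h) x hx hxS
    obtain ⟨z, hz, hzS, hzy⟩ := d.lift p _ h y hy hyS
    exact ⟨z, hz, hzS, fun n => by rw [hzy, hyx]⟩

theorem Cov.isPlay {k : ℕ} {H G : GT} (c : Cov k H G) {x : ℕ → H.T} (hx : H.IsPlay x) :
    G.IsPlay (fun n => c.f (x n)) := fun n =>
  ⟨by rw [c.len_f, (hx n).1], by rw [← c.par_f, (hx n).2]⟩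

end GT


namespace GT

/-- Data of a two-phase local strategy condition. -/
structure Ph (G : GT) where
  p : Bool
  Amb : Set G.T
  goal : Set G.T
  b : ℕ
  A : G.T → Prop
  B : G.T → G.T → Prop

namespace Ph
variable {G : GT} (P : Ph G)

def W (t : G.T) : Prop := G.Frc P.p P.Amb P.goal t

noncomputable def Y (t : G.T) : Set G.T :=
  Classical.epsilon (fun Y => G.IsFTree P.p P.Amb P.goal t Y)

def c1 (t : G.T) : Prop := (∀ j, P.b ≤ j → j ≤ G.len t → ¬ P.W (G.anc j t)) ∧ P.A t

def FstW (m : ℕ) (t : G.T) : Prop :=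
  P.b ≤ m ∧ m ≤ G.len t ∧ P.W (G.anc m t) ∧ ∀ j, P.b ≤ j → j < m → ¬ P.W (G.anc j t)

def c2 (t : G.T) : Prop := ∃ m, P.FstW m t ∧ (∀ j, m ≤ j → j ≤ G.len t → G.anc j t ∉ P.goal) ∧
  t ∈ P.Y (G.anc m t)

def c3 (t : G.T) : Prop := ∃ m l, P.FstW m t ∧ m ≤ l ∧ l ≤ G.len t ∧ G.anc l t ∈ P.goal ∧
  (∀ j, m ≤ j → j < l → G.anc j t ∉ P.goal) ∧ P.B (G.anc l t) t

def Cond (t : G.T) : Prop := P.c1 t ∨ P.c2 t ∨ P.c3 t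

structure Ok (s0 : ℕ) : Prop where
  amb : ∀ t ∈ P.Amb, turn P.p (G.len t) → ∃ s, G.Child t s ∧ s ∈ P.Amb
  ambo : ∀ t ∈ P.Amb, ¬ turn P.p (G.len t) → ∀ s, G.Child t s → s ∈ P.Amb
  bs : P.b ≤ s0 + 1
  sb : s0 ≤ P.b
  Amine : ∀ t, s0 ≤ G.len t → P.c1 t → turn P.p (G.len t) → ∃ r, G.Child t r ∧ ¬ P.W r ∧ P.A r
  Aopp : ∀ t, s0 ≤ G.len t → P.c1 t → ¬ turn P.p (G.len t) → ∀ r, G.Child t r → ¬ P.W r → P.A r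
  Bmine : ∀ u t, u ∈ P.goal → G.len u ≤ G.len t → G.anc (G.len u) t = u → P.B u t →
    turn P.p (G.len t) → ∃ r, G.Child t r ∧ P.B u r
  Bopp : ∀ u t, u ∈ P.goal → G.len u ≤ G.len t → G.anc (G.len u) t = u → P.B u t →
    ¬ turn P.p (G.len t) → ∀ r, G.Child t r → P.B u r
  Bst : ∀ u ∈ P.goal, u ∈ P.Amb → P.B u u

variable {P}

theorem Y_spec {s0 : ℕ} (h : P.Ok s0) {t : G.T} (ht : P.W t) :
    G.IsFTree P.p P.Amb P.goal t (P.Y t) :=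
  Classical.epsilon_spec (Frc.exists_tree h.amb ht)

theorem W_amb {t : G.T} (h : P.W t) : t ∈ P.Amb := by
  cases h <;> assumption

theorem FstW.child {m : ℕ} {t r : G.T} (h : P.FstW m t) (hr : G.Child t r) : P.FstW m r := by
  obtain ⟨h1, h2, h3, h4⟩ := h
  have := hr.1
  refine ⟨h1, by omega, by rwa [hr.anc h2], fun j hj hj' => ?_⟩
  rw [hr.anc (by omega)]; exact h4 j hj hj'

theorem FstW.uniq {m m' : ℕ} {t : G.T} (h : P.FstW m t) (h' : P.FstW m' t) : m = m' := by
  rcases lt_trichotomy m m' with h1 | h1 | h1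
  · exact absurd h.2.2.1 (h'.2.2.2 m h.1 h1)
  · exact h1
  · exact absurd h'.2.2.1 (h.2.2.2 m' h'.1 h1)

theorem cond_newW {s0 : ℕ} (h : P.Ok s0) {r : G.T} (hb : P.b ≤ G.len r)
    (hno : ∀ j, P.b ≤ j → j < G.len r → ¬ P.W (G.anc j r)) (hW : P.W r) : P.Cond r := by
  have hF : P.FstW (G.len r) r := ⟨hb, le_rfl, by rwa [G.anc_self], hno⟩
  by_cases hg : r ∈ P.goal
  · right; right
    refine ⟨G.len r, G.len r, hF, le_rfl, le_rfl, by rwa [G.anc_self], fun j h1 h2 => by omega, ?_⟩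
    rw [G.anc_self]; exact h.Bst r hg (W_amb hW)
  · right; left
    refine ⟨G.len r, hF, fun j h1 h2 => ?_, ?_⟩
    · rwa [le_antisymm h2 h1, G.anc_self]
    · rw [G.anc_self]; exact (Y_spec h hW).mem

theorem cond_c2 {s0 : ℕ} (h : P.Ok s0) {t r : G.T} {m : ℕ} (hF : P.FstW m t)
    (hg : ∀ j, m ≤ j → j ≤ G.len t → G.anc j t ∉ P.goal) (hr : G.Child t r)
    (hrY : r ∈ P.Y (G.anc m t)) : P.Cond r := by
  have hF' := hF.child hr
  have hl := hr.1
  have hm := hF.2.1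
  have hg' : ∀ j, m ≤ j → j ≤ G.len t → G.anc j r ∉ P.goal := by
    intro j h1 h2; rw [hr.anc h2]; exact hg j h1 h2
  by_cases hgr : r ∈ P.goal
  · right; right
    refine ⟨m, G.len r, hF', by omega, le_rfl, by rwa [G.anc_self],
      fun j h1 h2 => hg' j h1 (by omega), ?_⟩
    rw [G.anc_self]
    exact h.Bst r hgr ((Y_spec h hF.2.2.1).sub hrY)
  · right; left
    refine ⟨m, hF', fun j h1 h2 => ?_, ?_⟩
    · rcases Nat.lt_or_ge (G.len t) j with h3 | h3
      · rwa [G.anc_ge (by omega)]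
      · exact hg' j h1 h3
    · rwa [hr.anc hm]

theorem cond_c3 {t r : G.T} {m l : ℕ} (hF : P.FstW m t)
    (hml : m ≤ l) (hl : l ≤ G.len t) (hlg : G.anc l t ∈ P.goal)
    (hg : ∀ j, m ≤ j → j < l → G.anc j t ∉ P.goal) (hr : G.Child t r)
    (hB : P.B (G.anc l t) r) : P.Cond r := by
  have hl1 := hr.1
  right; right
  refine ⟨m, l, hF.child hr, hml, by omega, by rwa [hr.anc hl], fun j h1 h2 => ?_, by rwa [hr.anc hl]⟩
  rw [hr.anc (by omega)]; exact hg j h1 h2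

theorem cond_c1 {t r : G.T} (h1 : P.c1 t) (hr : G.Child t r) (hW : ¬ P.W r) (hA : P.A r) :
    P.Cond r := by
  left
  refine ⟨fun j hj hj' => ?_, hA⟩
  rcases Nat.lt_or_ge (G.len t) j with h3 | h3
  · rwa [G.anc_ge (by have := hr.1; omega)]
  · rw [hr.anc h3]; exact h1.1 j hj h3

theorem step_mine {s0 : ℕ} (h : P.Ok s0) {t : G.T} (ht : s0 ≤ G.len t) (hc : P.Cond t)
    (hturn : turn P.p (G.len t)) : ∃ r, G.Child t r ∧ P.Cond r := by
  rcases hc with hc | ⟨m, hF, hg, hY⟩ | ⟨m, l, hF, hml, hl, hlg, hg, hB⟩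
  · obtain ⟨r, hr, hW, hA⟩ := h.Amine t ht hc hturn
    exact ⟨r, hr, cond_c1 hc hr hW hA⟩
  · obtain ⟨r, hr, hrY⟩ := (Y_spec h hF.2.2.1).mine t hY hturn
    exact ⟨r, hr, cond_c2 h hF hg hr hrY⟩
  · obtain ⟨r, hr, hB'⟩ := h.Bmine _ t hlg (by rw [G.len_anc hl]; exact hl)
      (by rw [G.len_anc hl]) hB hturn
    exact ⟨r, hr, cond_c3 hF hml hl hlg hg hr hB'⟩

theorem step_opp {s0 : ℕ} (h : P.Ok s0) {t : G.T} (ht : s0 ≤ G.len t) (hc : P.Cond t)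
    (hturn : ¬ turn P.p (G.len t)) {r : G.T} (hr : G.Child t r) : P.Cond r := by
  have hl1 := hr.1
  have hbs := h.bs
  rcases hc with hc | ⟨m, hF, hg, hY⟩ | ⟨m, l, hF, hml, hl, hlg, hg, hB⟩
  · by_cases hW : P.W r
    · refine cond_newW h (by omega) (fun j hj hj' => ?_) hW
      rw [hr.anc (by omega)]; exact hc.1 j hj (by omega)
    · exact cond_c1 hc hr hW (h.Aopp t ht hc hturn r hr hW)
  · have hYs := Y_spec h hF.2.2.1
    exact cond_c2 h hF hg hr (hYs.opp t hY hturn r hr (h.ambo t (hYs.sub hY) hturn r hr))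
  · exact cond_c3 hF hml hl hlg hg hr (h.Bopp _ t hlg (by rw [G.len_anc hl]; exact hl)
      (by rw [G.len_anc hl]) hB hturn r hr)

theorem lift_cases {s0 : ℕ} (h : P.Ok s0) {x : ℕ → G.T} (hx : G.IsPlay x)
    (hc : ∀ n, s0 ≤ n → P.Cond (x n)) :
    (∀ n, s0 ≤ n → P.c1 (x n)) ∨
    (∃ l, x l ∈ P.goal ∧ ∀ n, s0 ≤ n → l ≤ n → P.B (x l) (x n)) := by
  by_cases hW : ∃ m, P.b ≤ m ∧ P.W (x m)
  · right
    classical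
    obtain ⟨m, hm, hmin⟩ : ∃ m, (P.b ≤ m ∧ P.W (x m)) ∧ ∀ j < m, ¬ (P.b ≤ j ∧ P.W (x j)) :=
      ⟨Nat.find hW, Nat.find_spec hW, fun j hj => Nat.find_min hW hj⟩
    have hF : ∀ n, m ≤ n → P.FstW m (x n) := by
      intro n hn
      refine ⟨hm.1, by rw [(hx n).1]; exact hn, by rw [hx.anc hn]; exact hm.2, fun j h1 h2 => ?_⟩
      rw [hx.anc (by omega)]; exact fun h3 => hmin j h2 ⟨h1, h3⟩
    have hY := Y_spec h hm.2
    -- there is a goal node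
    have hgoal : ∃ l, m ≤ l ∧ x l ∈ P.goal := by
      by_contra hcon
      push Not at hcon
      obtain ⟨n, hn, hn'⟩ := hY.hit x hx (by
          intro k hmk
          rw [(hx m).1] at hmk
          have hk : s0 ≤ k := by have := h.sb; have := hm.1; omega
          rcases hc k hk with hc | ⟨m', hF', hg, hYm⟩ | ⟨m', l, hF', hml, hl, hlg, hg, hB⟩
          · exact absurd (hF k hmk).2.2.1 (hc.1 m hm.1 (by rw [(hx k).1]; exact hmk))
          · rw [hF'.uniq (hF k hmk), hx.anc hmk] at hYm; exact hYm
          · rw [(hx k).1] at hl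
            rw [hx.anc hl] at hlg
            rw [hF'.uniq (hF k hmk)] at hml
            exact absurd hlg (hcon l hml))
      rw [(hx m).1] at hn
      exact hcon n hn hn'
    obtain ⟨l, hl, hlmin⟩ : ∃ l, (m ≤ l ∧ x l ∈ P.goal) ∧ ∀ j < l, ¬ (m ≤ j ∧ x j ∈ P.goal) :=
      ⟨Nat.find hgoal, Nat.find_spec hgoal, fun j hj => Nat.find_min hgoal hj⟩
    have hfin : ∀ n, s0 ≤ n → l ≤ n → P.B (x l) (x n) := by
      intro n hn hln
      have hmn : m ≤ n := by omega
      rcases hc n hn with hc | ⟨m', hF', hg, hYm⟩ | ⟨m', l', hF', hml, hl', hlg, hg, hB⟩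
      · exact absurd (hF n hmn).2.2.1 (hc.1 m hm.1 (by rw [(hx n).1]; exact hmn))
      · rw [hF'.uniq (hF n hmn)] at hg
        have := hg l hl.1 (by rw [(hx n).1]; exact hln)
        rw [hx.anc hln] at this
        exact absurd hl.2 this
      · have hmm := hF'.uniq (hF n hmn)
        subst hmm
        rw [(hx n).1] at hl'
        have : l' = l := by
          rcases lt_trichotomy l' l with h1 | h1 | h1
          · rw [hx.anc hl'] at hlg
            exact absurd ⟨hml, hlg⟩ (hlmin l' h1)
          · exact h1
          · have := hg l hl.1 h1
            rw [hx.anc hln] at this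
            exact absurd hl.2 this
        subst this
        rwa [hx.anc hl'] at hB
    exact ⟨l, hl.2, hfin⟩
  · left
    push Not at hW
    intro n hn
    rcases hc n hn with hc | ⟨m', hF', hg, hYm⟩ | ⟨m', l', hF', hml, hl', hlg, hg, hB⟩
    · exact hc
    · have h1 := hF'.2.2.1
      have h2 := hF'.2.1
      rw [(hx n).1] at h2
      rw [hx.anc h2] at h1
      exact absurd h1 (hW _ hF'.1)
    · have h1 := hF'.2.2.1
      have h2 := hF'.2.1
      rw [(hx n).1] at h2
      rw [hx.anc h2] at h1
      exact absurd h1 (hW _ hF'.1)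

end Ph
end GT


namespace GT

structure QI (G : GT) (q : G.T) (s : Set G.T) : Prop where
  mem : q ∈ s
  ext : ∀ t ∈ s, G.len q ≤ G.len t ∧ G.anc (G.len q) t = q
  par : ∀ t ∈ s, G.len q < G.len t → G.par t ∈ s
  mine : ∀ t ∈ s, turn true (G.len t) → ∃ r, G.Child t r ∧ r ∈ s
  opp : ∀ t ∈ s, ¬ turn true (G.len t) → ∀ r, G.Child t r → r ∈ s

structure QII (G : GT) (J : Set G.T) (c : G.T) (s s' : Set G.T) : Prop where
  mem : c ∈ s'
  par : ∀ t ∈ s', G.len c < G.len t → G.par t ∈ s'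
  sub : s' ⊆ s
  subJ : s' ⊆ J
  mine : ∀ t ∈ s', turn false (G.len t) → ∃ r, G.Child t r ∧ r ∈ s'
  opp : ∀ t ∈ s', ¬ turn false (G.len t) → ∀ r, G.Child t r → r ∈ s → r ∈ s'

def CV (G : GT) (J : Set G.T) (a : ℕ) (q : G.T) (s : Set G.T) (u : Option G.T) (s' : Set G.T) :
    Prop :=
  (a + 1 ≤ G.len q → G.QI (G.anc (a+1) q) s) ∧
  (a + 2 ≤ G.len q → (∃ v, u = some v ∧ s' = ∅ ∧ v ∈ s ∧ v ∉ J ∧ a + 2 ≤ G.len v ∧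
      ∀ n, n ≤ G.len q → n ≤ G.len v → G.anc n q = G.anc n v) ∨
    (u = none ∧ q ∈ s' ∧ G.QII J (G.anc (a+2) q) s s'))

def CN (G : GT) (J : Set G.T) (a : ℕ) : Type :=
  {ν : G.T × Set G.T × Option G.T × Set G.T // G.CV J a ν.1 ν.2.1 ν.2.2.1 ν.2.2.2 ∧
    (G.len ν.1 < a + 1 → ν.2.1 = ∅) ∧ (G.len ν.1 < a + 2 → ν.2.2.1 = none ∧ ν.2.2.2 = ∅)}

section
variable {G : GT} {J : Set G.T} {a : ℕ}

open Classical in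
noncomputable def mkN (q : G.T) (s : Set G.T) (u : Option G.T) (s' : Set G.T)
    (h : G.CV J a q s u s') : G.CN J a :=
  ⟨(q, if a + 1 ≤ G.len q then s else ∅, if a + 2 ≤ G.len q then u else none,
    if a + 2 ≤ G.len q then s' else ∅), by
    refine ⟨⟨fun h1 => ?_, fun h1 => ?_⟩, fun h1 => ?_, fun h1 => ?_⟩
    · simp only [h1, if_true]; exact h.1 h1
    · simp only at h1
      have h2 : a + 1 ≤ G.len q := by omega
      simp only [h1, h2, if_true]; exact h.2 h1
    · simp only at h1
      simp [show ¬ (a + 1 ≤ G.len q) by omega]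
    · simp only at h1
      simp [show ¬ (a + 2 ≤ G.len q) by omega]⟩

theorem CN.eta (ν : G.CN J a) : ν = mkN ν.1.1 ν.1.2.1 ν.1.2.2.1 ν.1.2.2.2 ν.2.1 := by
  obtain ⟨⟨q, s, u, s'⟩, h1, h2, h3⟩ := ν
  apply Subtype.ext
  simp only at h2 h3
  by_cases h4 : a + 1 ≤ G.len q
  · by_cases h5 : a + 2 ≤ G.len q
    · simp [mkN, h4, h5]
    · simp [mkN, h4, h5, h3 (by omega)]
  · simp [mkN, h4, show ¬ (a + 2 ≤ G.len q) by omega, h2 (by omega), h3 (by omega)]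

theorem mkN_eq {q : G.T} {s : Set G.T} {u : Option G.T} {s' : Set G.T} {h : G.CV J a q s u s'}
    {q2 : G.T} {s2 : Set G.T} {u2 : Option G.T} {s2' : Set G.T} {h2 : G.CV J a q2 s2 u2 s2'} 
    (e : mkN q s u s' h = mkN q2 s2 u2 s2' h2) : q = q2 ∧ (a + 1 ≤ G.len q → s = s2) ∧
    (a + 2 ≤ G.len q → u = u2 ∧ s' = s2') := by
  have e1 := congrArg Subtype.val e
  simp only [mkN, Prod.mk.injEq] at e1
  obtain ⟨rfl, e2, e3, e4⟩ := e1
  refine ⟨rfl, fun h => by simpa [h] using e2, fun h => ⟨by simpa [h] using e3, by simpa [h] using e4⟩⟩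

theorem mkN_congr {q : G.T} {s : Set G.T} {u : Option G.T} {s' : Set G.T} {h : G.CV J a q s u s'}
    {s2 : Set G.T} {u2 : Option G.T} {s2' : Set G.T} {h2 : G.CV J a q s2 u2 s2'}
    (e1 : a + 1 ≤ G.len q → s = s2) (e2 : a + 2 ≤ G.len q → u = u2 ∧ s' = s2') :
    mkN q s u s' h = mkN q s2 u2 s2' h2 := by
  apply Subtype.ext
  by_cases h4 : a + 1 ≤ G.len q
  · by_cases h5 : a + 2 ≤ G.len q
    · simp [mkN, h4, h5, e1 h4, e2 h5]
    · simp [mkN, h4, h5, e1 h4]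
  · simp [mkN, h4, show ¬ (a + 2 ≤ G.len q) by omega]

theorem CV.par {q : G.T} {s : Set G.T} {u : Option G.T} {s' : Set G.T} (h : G.CV J a q s u s') :
    G.CV J a (G.par q) s u s' := by
  have hl := G.len_par q
  refine ⟨fun h1 => ?_, fun h1 => ?_⟩
  · rw [G.anc_par (by omega)]; exact h.1 (by omega)
  · rw [G.anc_par (by omega)]
    rcases h.2 (by omega) with ⟨v, h2, h3, h4, h5, h6, h7⟩ | ⟨h2, h3, h4⟩
    · left
      refine ⟨v, h2, h3, h4, h5, h6, fun n hn hn' => ?_⟩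
      rw [G.anc_par (by omega)]; exact h7 n (by omega) hn'
    · right
      exact ⟨h2, h4.par _ h3 (by rw [G.len_anc (by omega)]; omega), h4⟩

theorem CV.low {q : G.T} {s : Set G.T} {u : Option G.T} {s' : Set G.T} (h : G.len q < a + 1) :
    G.CV J a q s u s' := ⟨fun _ => by omega, fun _ => by omega⟩

theorem CV.low2 {q : G.T} {s : Set G.T} {u u2 : Option G.T} {s' s2' : Set G.T}
    (hV : G.CV J a q s u s') (h : G.len q < a + 2) :
    G.CV J a q s u2 s2' := ⟨hV.1, fun _ => by omega⟩

theorem QI_full (c : G.T) : G.QI c {t | G.len c ≤ G.len t ∧ G.anc (G.len c) t = c} where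
  mem := ⟨le_rfl, G.anc_self c⟩
  ext := fun _ h => h
  par := fun t h h' => ⟨by rw [G.len_par]; omega, by rw [G.anc_par h']; exact h.2⟩
  mine := fun t h _ => by
    obtain ⟨r, hr⟩ := G.child t
    have hr' : G.Child t r := hr
    exact ⟨r, hr, by rw [hr.1]; have := h.1; omega, by rw [hr'.anc h.1]; exact h.2⟩
  opp := fun t h _ r hr => ⟨by rw [hr.1]; have := h.1; omega, by rw [hr.anc h.1]; exact h.2⟩

theorem QI.anc_mem {q : G.T} {s : Set G.T} (h : G.QI q s) {t : G.T} (ht : t ∈ s) {n : ℕ}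
    (hn : G.len q ≤ n) : G.anc n t ∈ s := by
  rcases Nat.lt_or_ge (G.len t) n with h1 | h1
  · rwa [G.anc_ge h1.le]
  obtain ⟨d, hd⟩ : ∃ d, G.len t = n + d := ⟨G.len t - n, by omega⟩
  clear h1
  induction d generalizing n with
  | zero => rwa [G.anc_ge (by omega)]
  | succ d ih =>
    have := ih (n := n+1) (by omega) (by omega)
    rw [← G.par_anc (by omega)]
    exact h.par _ this (by rw [G.len_anc (by omega)]; omega)

theorem QI.exists_ext {q : G.T} {s : Set G.T} (h : G.QI q s) {t : G.T} (ht : t ∈ s) :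
    ∃ r, G.Child t r ∧ r ∈ s := by
  by_cases h1 : turn true (G.len t)
  · exact h.mine t ht h1
  · obtain ⟨r, hr⟩ := G.child t
    exact ⟨r, hr, h.opp t ht h1 r hr⟩

theorem CV_succ {q : G.T} {s : Set G.T} {u : Option G.T} {s' : Set G.T}
    (h : G.CV J a q s u s') : ∃ r s2 u2 s2', G.Child q r ∧ G.CV J a r s2 u2 s2' ∧
      (a + 1 ≤ G.len q → s2 = s) ∧ (a + 2 ≤ G.len q → u2 = u ∧ s2' = s') := by
  rcases Nat.lt_or_ge (G.len q) a with h1 | h1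
  · obtain ⟨r, hr⟩ := G.child q
    exact ⟨r, s, u, s', hr, CV.low (by rw [hr.1]; omega), fun _ => rfl, fun _ => ⟨rfl, rfl⟩⟩
  rcases Nat.eq_or_lt_of_le h1 with h1 | h1
  · obtain ⟨r, hr⟩ := G.child q
    have hlr : G.len r = a + 1 := by rw [hr.1]; omega
    refine ⟨r, {t | G.len r ≤ G.len t ∧ G.anc (G.len r) t = r}, u, s', hr, ⟨fun _ => ?_, fun _ => ?_⟩,
      fun _ => by omega, fun _ => by omega⟩
    · rw [G.anc_ge (by omega)]
      exact QI_full r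
    · omega
  rcases Nat.eq_or_lt_of_le h1 with h1 | h1
  · have hQ := h.1 (by omega)
    rw [G.anc_ge (by omega)] at hQ
    by_cases hv : ∃ v ∈ s, v ∉ J ∧ a + 2 ≤ G.len v
    · obtain ⟨v, hv, hvJ, hvl⟩ := hv
      refine ⟨G.anc (a+2) v, s, some v, ∅, ⟨?_, ?_⟩, ⟨fun _ => ?_, fun _ => Or.inl ?_⟩,
        fun _ => rfl, fun _ => by omega⟩
      · rw [G.len_anc hvl]; omega
      · rw [G.par_anc hvl]
        have := (hQ.ext v hv).2
        rwa [← h1] at this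
      · rw [G.anc_anc (by omega)]
        have := (hQ.ext v hv).2
        rw [← h1] at this
        simp only [Nat.succ_eq_add_one] at this
        rw [this]; exact hQ
      · refine ⟨v, rfl, rfl, hv, hvJ, hvl, fun n hn _ => ?_⟩
        rw [G.len_anc hvl] at hn
        rw [G.anc_anc hn]
    · push Not at hv
      have hsJ : ∀ t ∈ s, a + 2 ≤ G.len t → t ∈ J := by
        intro t ht htl
        by_contra hcon
        have := hv t ht hcon
        omega
      obtain ⟨r, hr, hrs⟩ := hQ.exists_ext hQ.mem
      have hlr : G.len r = a + 2 := by rw [hr.1]; omega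
      refine ⟨r, s, none, {t ∈ s | G.len r ≤ G.len t ∧ G.anc (G.len r) t = r}, hr,
        ⟨fun _ => ?_, fun _ => Or.inr ⟨rfl, ⟨hrs, le_rfl, G.anc_self r⟩, ?_⟩⟩, fun _ => rfl,
        fun _ => by omega⟩
      · rw [hr.anc (by omega), G.anc_ge (by omega)]; exact hQ
      · rw [G.anc_ge (by omega)]
        refine ⟨⟨hrs, le_rfl, G.anc_self r⟩, fun t ht ht' => ⟨hQ.par t ht.1 (by omega), ?_⟩,
          fun t ht => ht.1, fun t ht => hsJ t ht.1 (by have := ht.2.1; omega), fun t ht hturn => ?_,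
          fun t ht hturn r' hr' hr's => ?_⟩
        · exact ⟨by rw [G.len_par]; omega, by rw [G.anc_par ht']; exact ht.2.2⟩
        · obtain ⟨r', hr', hr's⟩ := hQ.exists_ext ht.1
          exact ⟨r', hr', hr's, by rw [hr'.1]; have := ht.2.1; omega, by rw [hr'.anc ht.2.1]; exact ht.2.2⟩
        · exact ⟨hr's, by rw [hr'.1]; have := ht.2.1; omega, by rw [hr'.anc ht.2.1]; exact ht.2.2⟩
  · rcases h.2 (by omega) with ⟨v, h2, h3, h4, h5, h6, h7⟩ | ⟨h2, h3, h4⟩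
    · rcases Nat.lt_or_ge (G.len q) (G.len v) with h8 | h8
      · have hq : G.anc (G.len q) v = q := by
          have := h7 (G.len q) le_rfl h8.le
          rw [G.anc_self] at this
          exact this.symm
        have hc := G.child_anc h8
        rw [hq] at hc
        have hlc := hc.1
        refine ⟨_, s, u, s', hc, ⟨fun _ => ?_, fun _ => Or.inl
          ⟨v, h2, h3, h4, h5, h6, fun n hn hn' => ?_⟩⟩, fun _ => rfl, fun _ => ⟨rfl, rfl⟩⟩
        · rw [hc.anc (by omega)]; exact h.1 (by omega)
        · rw [hlc] at hn
          rw [G.anc_anc hn]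
      · obtain ⟨r, hr⟩ := G.child q
        have hr' : G.Child q r := hr
        refine ⟨r, s, u, s', hr, ⟨fun _ => ?_, fun _ => Or.inl
          ⟨v, h2, h3, h4, h5, h6, fun n hn hn' => ?_⟩⟩, fun _ => rfl, fun _ => ⟨rfl, rfl⟩⟩
        · rw [hr'.anc (by omega)]; exact h.1 (by omega)
        · rw [hr'.anc (by omega)]; exact h7 n (by omega) hn'
    · have hQ := h.1 (by omega)
      have : ∃ r, G.Child q r ∧ r ∈ s' := by
        by_cases hturn : turn false (G.len q)
        · exact h4.mine q h3 hturn
        · obtain ⟨r, hr, hr'⟩ := hQ.exists_ext (h4.sub h3)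
          exact ⟨r, hr, h4.opp q h3 hturn r hr hr'⟩
      obtain ⟨r, hr, hrs⟩ := this
      refine ⟨r, s, u, s', hr, ⟨fun _ => ?_, fun _ => Or.inr
          ⟨h2, hrs, ?_⟩⟩, fun _ => rfl, fun _ => ⟨rfl, rfl⟩⟩
      · rw [hr.anc (by omega)]; exact hQ
      · rw [hr.anc (by omega)]; exact h4

theorem par_mkN_aux {q : G.T} {s : Set G.T} {u : Option G.T} {s' : Set G.T} (h : G.CV J a q s u s') :
    mkN (J := J) (G.par q) (mkN q s u s' h).1.2.1 (mkN q s u s' h).1.2.2.1 (mkN q s u s' h).1.2.2.2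
      (CV.par (mkN q s u s' h).2.1)
    = mkN (G.par q) s u s' h.par := by
  have := G.len_par q
  apply mkN_congr
  · intro h1; simp [mkN, show a + 1 ≤ G.len q by omega]
  · intro h1; simp [mkN, show a + 2 ≤ G.len q by omega]

end

variable (G : GT) (J : Set G.T) (a : ℕ)

noncomputable def CT : GT where
  T := G.CN J a
  len := fun ν => G.len ν.1.1
  par := fun ν => mkN (G.par ν.1.1) ν.1.2.1 ν.1.2.2.1 ν.1.2.2.2 ν.2.1.par
  root := mkN G.root ∅ none ∅ (CV.low (by rw [G.len_root]; omega))
  len_root := G.len_root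
  root_uniq := fun ν h => by
    rw [CN.eta ν]
    have hr := G.root_uniq _ h
    generalize_proofs h1 h2
    revert h1
    rw [hr]
    intro h1
    apply mkN_congr <;> (intro h3; rw [G.len_root] at h3; omega)
  len_par := fun ν => G.len_par _
  child := fun ν => by
    obtain ⟨r, s2, u2, s2', hr, hV, h1, h2⟩ := CV_succ ν.2.1
    refine ⟨mkN r s2 u2 s2' hV, hr.1, ?_⟩
    rw [CN.eta ν]
    show mkN (G.par r) _ _ _ _ = _
    rw [par_mkN_aux]
    generalize_proofs h3 h4
    revert h3
    rw [hr.2]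
    intro h3
    exact mkN_congr h1 h2

variable {G J a}

def In (S : Set (G.CT J a).T) (q : G.T) (s : Set G.T) (u : Option G.T) (s' : Set G.T) : Prop :=
  ∃ h : G.CV J a q s u s', mkN q s u s' h ∈ S

section
variable {p : Bool} {S : Set (G.CT J a).T}
  {q r : G.T} {s s2 : Set G.T} {u u2 : Option G.T} {s' s2' : Set G.T}

theorem In.par (hS : (G.CT J a).IsStrat p S) (h : In S q s u s') : In S (G.par q) s u s' := by
  obtain ⟨h, h'⟩ := h
  refine ⟨h.par, ?_⟩
  have := hS.par _ h'
  rw [← par_mkN_aux h]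
  exact this

theorem In.anc (hS : (G.CT J a).IsStrat p S) (h : In S q s u s') (n : ℕ) : In S (G.anc n q) s u s' := by
  unfold GT.anc
  generalize G.len q - n = d
  induction d with
  | zero => exact h
  | succ d ih => rw [Function.iterate_succ_apply']; exact ih.par hS

theorem In.low (h : In S q s u s') (hl : G.len q < a + 1) : In S q s2 u2 s2' := by
  obtain ⟨h, h'⟩ := h
  refine ⟨CV.low hl, ?_⟩
  rwa [mkN_congr (h2 := h)]
  · intro; omega
  · intro; omega

theorem In.low2 (h : In S q s u s') (hl : G.len q < a + 2) : In S q s u2 s2' := by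
  obtain ⟨h, h'⟩ := h
  refine ⟨h.low2 hl, ?_⟩
  rwa [mkN_congr (h2 := h)]
  · intro; rfl
  · intro; omega

theorem In_root (hS : (G.CT J a).IsStrat p S) : In S G.root s u s' := by
  have : In S G.root ∅ none ∅ := ⟨CV.low (by rw [G.len_root]; omega), hS.root⟩
  exact this.low (by rw [G.len_root]; omega)

theorem Child_iff {h : G.CV J a q s u s'} {h2 : G.CV J a r s2 u2 s2'} :
    (G.CT J a).Child (mkN q s u s' h) (mkN r s2 u2 s2' h2) ↔
    G.Child q r ∧ (a + 1 ≤ G.len q → s2 = s) ∧ (a + 2 ≤ G.len q → u2 = u ∧ s2' = s') := by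
  have hp : (G.CT J a).par (mkN r s2 u2 s2' h2) = mkN (G.par r) s2 u2 s2' h2.par := par_mkN_aux h2
  constructor
  · rintro ⟨h3, h4⟩
    rw [hp] at h4
    obtain ⟨h5, h6, h7⟩ := mkN_eq h4
    rw [h5] at h6 h7
    exact ⟨⟨h3, h5⟩, h6, h7⟩
  · rintro ⟨h3, h4, h5⟩
    refine ⟨h3.1, ?_⟩
    rw [hp]
    generalize_proofs h6
    revert h6
    rw [h3.2]
    intro h6
    exact mkN_congr h4 h5

theorem In.mine (hS : (G.CT J a).IsStrat p S) (h : In S q s u s') (hturn : turn p (G.len q)) :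
    ∃ r s2 u2 s2', G.Child q r ∧ In S r s2 u2 s2' ∧ (a + 1 ≤ G.len q → s2 = s) ∧
      (a + 2 ≤ G.len q → u2 = u ∧ s2' = s') := by
  obtain ⟨h, h'⟩ := h
  obtain ⟨ν, hν, hνS⟩ := hS.mine _ h' hturn
  have e : ν = _ := CN.eta ν
  rw [e] at hν hνS
  obtain ⟨h1, h2, h3⟩ := Child_iff.1 hν
  exact ⟨_, _, _, _, h1, ⟨_, hνS⟩, h2, h3⟩

theorem In.opp (hS : (G.CT J a).IsStrat p S) (h : In S q s u s') (hturn : ¬ turn p (G.len q)) (hr : G.Child q r)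
    (hV : G.CV J a r s2 u2 s2') (h1 : a + 1 ≤ G.len q → s2 = s)
    (h2 : a + 2 ≤ G.len q → u2 = u ∧ s2' = s') : In S r s2 u2 s2' := by
  obtain ⟨h, h'⟩ := h
  exact ⟨hV, hS.opp _ h' hturn _ (Child_iff.2 ⟨hr, h1, h2⟩)⟩

theorem CV.after {v : G.T} (h : G.CV J a q s (some v) ∅) (hl : a + 2 ≤ G.len q)
    (hv : G.len v ≤ G.len q) (hr : G.Child q r) : G.CV J a r s (some v) ∅ := by
  refine ⟨fun _ => ?_, fun _ => Or.inl ?_⟩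
  · rw [hr.anc (by omega)]; exact h.1 (by omega)
  · rcases h.2 hl with ⟨v, h2, h3, h4, h5, h6, h7⟩ | ⟨h2, h3, h4⟩
    · simp only [Option.some.injEq] at h2
      subst h2
      refine ⟨_, rfl, rfl, h4, h5, h6, fun n hn hn' => ?_⟩
      rw [hr.anc (by omega)]; exact h7 n (by omega) hn'
    · simp at h2

theorem In.forced (hS : (G.CT J a).IsStrat p S) {v : G.T} (hv : a + 2 ≤ G.len v) (h : In S (G.anc (a+2) v) s (some v) ∅) :
    ∀ m, a + 2 ≤ m → m ≤ G.len v → In S (G.anc m v) s (some v) ∅ := by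
  intro m hm
  induction m, hm using Nat.le_induction with
  | base => exact fun _ => h
  | succ m hm ih =>
    intro hmv
    have ih := ih (by omega)
    have hlm : G.len (G.anc m v) = m := G.len_anc (by omega)
    by_cases hturn : turn p (G.len (G.anc m v))
    · obtain ⟨r, s2, u2, s2', hr, hIn, h1, h2⟩ := ih.mine hS hturn
      obtain ⟨rfl, rfl⟩ := h2 (by omega)
      obtain rfl := h1 (by omega)
      have hrl := hr.1
      rcases hIn.1.2 (by omega) with ⟨v', h2, h3, h4, h5, h6, h7⟩ | ⟨h2, h3, h4⟩
      · simp only [Option.some.injEq] at h2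
        subst h2
        have := h7 (m+1) (by omega) (by omega)
        rw [G.anc_ge (by omega)] at this
        rwa [← this]
      · simp at h2
    · have hc := G.child_anc (t := v) (n := m) (by omega)
      refine ih.opp hS hturn hc ⟨fun _ => ?_, fun _ => Or.inl ?_⟩ (fun _ => rfl) (fun _ => ⟨rfl, rfl⟩)
      · rw [G.anc_anc (by omega)]
        have := ih.1.1 (by omega)
        rwa [G.anc_anc (by omega)] at this
      · rcases ih.1.2 (by omega) with ⟨v', h2, h3, h4, h5, h6, h7⟩ | ⟨h2, h3, h4⟩
        · simp only [Option.some.injEq] at h2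
          subst h2
          refine ⟨_, rfl, rfl, h4, h5, h6, fun n hn hn' => ?_⟩
          rw [G.len_anc hmv] at hn
          rw [G.anc_anc hn]
        · simp at h2

theorem In.lift (hS : (G.CT J a).IsStrat p S) {x : ℕ → G.T} (hx : G.IsPlay x) {n0 : ℕ} (h : ∀ n, n0 ≤ n → In S (x n) s u s') :
    ∃ y, (G.CT J a).IsPlay y ∧ (∀ n, y n ∈ S) ∧ ∀ n, (y n).1.1 = x n := by
  have h' : ∀ n, In S (x n) s u s' := by
    intro n
    have := (h (n + n0) (by omega)).anc hS n
    rwa [hx.anc (by omega)] at this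
  refine ⟨fun n => mkN (x n) s u s' (h' n).1, fun n => ⟨(hx n).1, ?_⟩, fun n => (h' n).2, fun n => rfl⟩
  exact (Child_iff.2 ⟨hx.child n, fun _ => rfl, fun _ => ⟨rfl, rfl⟩⟩ : (G.CT J a).Child 
    (mkN (x n) s u s' (h' n).1) (mkN (x (n+1)) s u s' (h' (n+1)).1)).2

end
end GT


namespace GT

section
variable {G : GT}

def phiOf (C : G.T → Prop) : Set G.T := {t | ∀ n, n ≤ G.len t → C (G.anc n t)}

theorem phiOf_self {C : G.T → Prop} {t : G.T} (h : t ∈ phiOf C) : C t := by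
  have := h (G.len t) le_rfl; rwa [G.anc_self] at this

theorem phiOf_par {C : G.T → Prop} {t : G.T} (h : t ∈ phiOf C) : G.par t ∈ phiOf C := by
  intro n hn
  rcases Nat.eq_zero_or_pos (G.len t) with h0 | h0
  · rw [G.anc_ge (by rw [G.len_par]; omega)]
    have : G.par t = t := by
      rw [G.root_uniq t h0]; apply G.root_uniq; rw [G.len_par, G.len_root]
    rw [this]; exact phiOf_self h
  · rw [G.len_par] at hn
    rw [G.anc_par (by omega)]; exact h n (by omega)

theorem phiOf_child {C : G.T → Prop} {t r : G.T} (h : t ∈ phiOf C) (hr : G.Child t r) (hC : C r) :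
    r ∈ phiOf C := by
  intro n hn
  rcases Nat.lt_or_ge (G.len t) n with h1 | h1
  · rwa [G.anc_ge (by rw [hr.1]; omega)]
  · rw [hr.anc h1]; exact h n h1

theorem phiOf_strat {C : G.T → Prop} {p : Bool} (h0 : C G.root)
    (h1 : ∀ t ∈ phiOf C, turn p (G.len t) → ∃ s, G.Child t s ∧ C s)
    (h2 : ∀ t ∈ phiOf C, ¬ turn p (G.len t) → ∀ s, G.Child t s → C s) : G.IsStrat p (phiOf C) where
  root := fun n _ => by rwa [G.anc_ge (by rw [G.len_root]; omega)]
  par := fun t ht => phiOf_par ht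
  mine := fun t ht hturn => by
    obtain ⟨s, hs, hs'⟩ := h1 t ht hturn
    exact ⟨s, hs, phiOf_child ht hs hs'⟩
  opp := fun t ht hturn s hs => phiOf_child ht hs (h2 t ht hturn s hs)

theorem Ph.Cond.congr {P : Ph G} {t : G.T} (h : P.Cond t) {A' : G.T → Prop} {B' : G.T → G.T → Prop}
    (hA : P.A t → A' t) (hB : ∀ u ∈ P.goal, P.B u t → B' u t) :
    (Ph.mk P.p P.Amb P.goal P.b A' B').Cond t := by
  rcases h with h | h | ⟨m, l, hF, hml, hl, hlg, hg, hB'⟩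
  · exact Or.inl ⟨h.1, hA h.2⟩
  · exact Or.inr (Or.inl h)
  · exact Or.inr (Or.inr ⟨m, l, hF, hml, hl, hlg, hg, hB _ hlg hB'⟩)
end

variable {G : GT} {J : Set G.T} {a : ℕ}

noncomputable def Sg (S : Set (G.CT J a).T) (t1 : G.T) : Set G.T :=
  Classical.epsilon (fun s => In S t1 s none ∅)

def gI (J : Set G.T) (a : ℕ) : Set G.T := {u | a + 2 ≤ G.len u ∧ u ∉ J}

def SA (J : Set G.T) (a : ℕ) (s : Set G.T) (c : G.T) : Set G.T :=
  {t ∈ s | G.len c ≤ G.len t ∧ G.anc (G.len c) t = c ∧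
    ∀ j, G.len c ≤ j → j ≤ G.len t → ¬ G.Frc true s (gI J a) (G.anc j t)}

noncomputable def PI (S : Set (G.CT J a).T) (t1 : G.T) : Ph G where
  p := true
  Amb := Sg S t1
  goal := gI J a
  b := a + 2
  A := fun t => In S t (Sg S t1) none (SA J a (Sg S t1) (G.anc (a+2) t))
  B := fun u t => In S t (Sg S t1) (some u) ∅

def CI (S : Set (G.CT J a).T) (t : G.T) : Prop :=
  (G.len t ≤ a → In S t ∅ none ∅) ∧ (a + 1 ≤ G.len t → (PI S (G.anc (a+1) t)).Cond t)

theorem QII_SA {s : Set G.T} {t1 c : G.T} (hQ : G.QI t1 s) (h1 : G.len t1 = a + 1) (hc : c ∈ s)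
    (hlc : G.len c = a + 2) (hW : ¬ G.Frc true s (gI J a) c) : G.QII J c s (SA J a s c) where
  mem := ⟨hc, le_rfl, G.anc_self c, fun j h2 h3 => by rwa [le_antisymm h3 h2, G.anc_self]⟩
  par := fun t ht hl => ⟨hQ.par t ht.1 (by omega), by rw [G.len_par]; omega,
    by rw [G.anc_par hl]; exact ht.2.2.1, fun j h2 h3 => by
      rw [G.len_par] at h3
      rw [G.anc_par (by omega)]; exact ht.2.2.2 j h2 (by omega)⟩
  sub := fun t ht => ht.1
  subJ := fun t ht => by
    by_contra hcon
    have := ht.2.2.2 (G.len t) ht.2.1 le_rfl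
    rw [G.anc_self] at this
    exact this (Frc.base t ht.1 ⟨by have := ht.2.1; omega, hcon⟩)
  mine := fun t ht hturn => by
    have h2 := ht.2.2.2 (G.len t) ht.2.1 le_rfl
    rw [G.anc_self] at h2
    have h3 : ∃ r, G.Child t r ∧ r ∈ s ∧ ¬ G.Frc true s (gI J a) r := by
      by_contra hcon
      push Not at hcon
      exact h2 (Frc.opp t ht.1 (by rw [turn_true]; rw [turn_false] at hturn; omega) hcon)
    obtain ⟨r, hr, hrs, hrW⟩ := h3
    have hl := hr.1
    have hl2 := ht.2.1
    refine ⟨r, hr, hrs, by omega, by rw [hr.anc ht.2.1]; exact ht.2.2.1, fun j h4 h5 => ?_⟩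
    rcases Nat.lt_or_ge (G.len t) j with h6 | h6
    · rwa [G.anc_ge (by omega)]
    · rw [hr.anc h6]; exact ht.2.2.2 j h4 h6
  opp := fun t ht hturn r hr hrs => by
    have hl := hr.1
    have hl2 := ht.2.1
    refine ⟨hrs, by omega, by rw [hr.anc ht.2.1]; exact ht.2.2.1, fun j h4 h5 => ?_⟩
    rcases Nat.lt_or_ge (G.len t) j with h6 | h6
    · rw [G.anc_ge (by omega)]
      intro hrW
      have h2 := ht.2.2.2 (G.len t) ht.2.1 le_rfl
      rw [G.anc_self] at h2
      exact h2 (Frc.mine t r ht.1 (by rw [turn_true]; rw [turn_false] at hturn; omega) hr hrs hrW)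
    · rw [hr.anc h6]; exact ht.2.2.2 j h4 h6

theorem In.Bmine {p : Bool} {S : Set (G.CT J a).T} (hS : (G.CT J a).IsStrat p S) {u t : G.T}
    {s : Set G.T} (h : In S t s (some u) ∅) (hl : a + 2 ≤ G.len t) (hturn : turn p (G.len t)) :
    ∃ r, G.Child t r ∧ In S r s (some u) ∅ := by
  obtain ⟨r, s2, u2, s2', hr, hIn, h1, h2⟩ := h.mine hS hturn
  obtain ⟨rfl, rfl⟩ := h2 hl
  obtain rfl := h1 (by omega)
  exact ⟨r, hr, hIn⟩

theorem In.Bopp {p : Bool} {S : Set (G.CT J a).T} (hS : (G.CT J a).IsStrat p S) {u t : G.T}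
    {s : Set G.T} (h : In S t s (some u) ∅) (hl : a + 2 ≤ G.len t) (hu : G.len u ≤ G.len t)
    (hturn : ¬ turn p (G.len t))
    {r : G.T} (hr : G.Child t r) : In S r s (some u) ∅ :=
  h.opp hS hturn hr (h.1.after hl hu hr) (fun _ => rfl) (fun _ => ⟨rfl, rfl⟩)

theorem PI_ok (ha : a % 2 = 0) {S : Set (G.CT J a).T} (hS : (G.CT J a).IsStrat true S) {t1 : G.T}
    (h1 : G.len t1 = a + 1) (hIn : In S t1 (Sg S t1) none ∅) : (PI S t1).Ok (a + 1) := by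
  have hQ : G.QI t1 (Sg S t1) := by
    have := hIn.1.1 (by omega)
    rwa [G.anc_ge (by omega)] at this
  constructor
  · exact fun t ht hturn => hQ.mine t ht hturn
  · exact fun t ht hturn => hQ.opp t ht hturn
  · exact le_rfl
  · exact Nat.le_succ _
  · intro t ht hc hturn
    have hturn' := (turn_true _).1 hturn
    have hlt : a + 2 ≤ G.len t := by omega
    have hA : In S t _ _ _ := hc.2
    obtain ⟨r, s2, u2, s2', hr, hInr, h3, h4⟩ := hA.mine hS hturn
    obtain rfl := h3 (by omega)
    obtain ⟨rfl, rfl⟩ := h4 (by omega)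
    have hlr := hr.1
    refine ⟨r, hr, ?_, ?_⟩
    · rcases hInr.1.2 (by omega) with ⟨v, h5, -⟩ | ⟨-, h5, -⟩
      · simp at h5
      · have := h5.2.2.2 (G.len r) (by rw [G.len_anc (by omega)]; omega) le_rfl
        rw [G.anc_self] at this
        exact this
    · show In S r _ none _
      rw [hr.anc hlt]; exact hInr
  · intro t ht hc hturn r hr hrW
    have hA : In S t _ _ _ := hc.2
    have hlr := hr.1
    have hQt := hA.1.1 ht
    have htS : t ∈ Sg S t1 := by
      rcases Nat.eq_or_lt_of_le ht with h2 | h2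
      · have := hQt.mem
        rwa [G.anc_ge (by omega)] at this
      · rcases hA.1.2 h2 with ⟨v, h5, -⟩ | ⟨-, h5, -⟩
        · simp at h5
        · exact h5.1
    have hrS : r ∈ Sg S t1 := hQ.opp t htS hturn r hr
    have hlc : G.len (G.anc (a+2) r) = a + 2 := G.len_anc (by omega)
    have hcS : G.anc (a+2) r ∈ Sg S t1 := hQ.anc_mem hrS (by omega)
    have hnoW : ∀ j, a + 2 ≤ j → j ≤ G.len r → ¬ G.Frc true (Sg S t1) (gI J a) (G.anc j r) := by
      intro j h2 h3
      rcases Nat.lt_or_ge (G.len t) j with h4 | h4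
      · rw [G.anc_ge (by omega)]; exact hrW
      · rw [hr.anc h4]; exact hc.1 j h2 h4
    refine hA.opp hS hturn hr ⟨fun _ => ?_, fun _ => Or.inr ⟨rfl, ⟨hrS, by omega, by rw [hlc], ?_⟩, ?_⟩⟩
      (fun _ => rfl) (fun h2 => ⟨rfl, by rw [hr.anc h2]⟩)
    · rw [hr.anc ht]; exact hQt
    · intro j h2 h3
      exact hnoW j (by omega) h3
    · exact QII_SA hQ h1 hcS hlc (hnoW _ le_rfl (by omega))
  · intro u t hu hut hanc hB hturn
    have hB' : In S t _ _ _ := hB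
    exact hB'.Bmine hS (by have := hu.1; omega) hturn
  · intro u t hu hut hanc hB hturn r hr
    have hB' : In S t _ _ _ := hB
    exact hB'.Bopp hS (by have := hu.1; omega) hut hturn hr
  · intro u hu huS
    show In S u (Sg S t1) (some u) ∅
    have hlu := hu.1
    have hext := (hQ.ext u huS).2
    rw [h1] at hext
    have h2 : In S (G.anc (a+2) u) (Sg S t1) (some u) ∅ := by
      refine hIn.opp hS (by rw [turn_true]; omega) (r := G.anc (a+2) u) ⟨?_, ?_⟩
        ⟨fun _ => ?_, fun _ => Or.inl ⟨u, rfl, rfl, huS, hu.2, hlu, fun n hn hn' => ?_⟩⟩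
        (fun _ => rfl) (fun h => by omega)
      · rw [G.len_anc hlu, h1]
      · rw [G.par_anc hlu, hext]
      · rw [G.anc_anc (by omega), hext]; exact hQ
      · rw [G.len_anc hlu] at hn
        rw [G.anc_anc hn]
    have := h2.forced hS hlu (G.len u) hlu le_rfl
    rwa [G.anc_self] at this

theorem CI_base {S : Set (G.CT J a).T} {t1 : G.T} (h1 : G.len t1 = a + 1) (h : CI S t1) :
    In S t1 (Sg S t1) none ∅ := by
  have h2 := h.2 h1.ge
  rw [G.anc_ge (by omega)] at h2
  rcases h2 with h2 | ⟨m, hF, -⟩ | ⟨m, l, hF, -⟩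
  · have h3 : In S t1 _ _ _ := h2.2
    exact h3.low2 (by omega)
  · have h3 : a + 2 ≤ m := hF.1
    have := hF.2.1
    omega
  · have h3 : a + 2 ≤ m := hF.1
    have := hF.2.1
    omega

theorem CI_okt (ha : a % 2 = 0) {S : Set (G.CT J a).T} (hS : (G.CT J a).IsStrat true S)
    {t : G.T} (ht : t ∈ phiOf (CI S)) (hl : a + 1 ≤ G.len t) :
    (PI S (G.anc (a+1) t)).Ok (a + 1) :=
  PI_ok ha hS (G.len_anc hl) (CI_base (G.len_anc hl) (ht _ hl))

theorem CI_strat (ha : a % 2 = 0) {S : Set (G.CT J a).T} (hS : (G.CT J a).IsStrat true S) :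
    G.IsStrat true (phiOf (CI S)) := by
  apply phiOf_strat
  · exact ⟨fun _ => In_root hS, fun h => by rw [G.len_root] at h; omega⟩
  · intro t ht hturn
    rcases Nat.lt_or_ge a (G.len t) with h1 | h1
    · obtain ⟨r, hr, hr'⟩ := Ph.step_mine (CI_okt ha hS ht h1) h1 ((phiOf_self ht).2 h1) hturn
      refine ⟨r, hr, fun h => ?_, fun _ => ?_⟩
      · rw [hr.1] at h; omega
      · rw [hr.anc h1]; exact hr'
    · obtain ⟨r, s2, u2, s2', hr, hIn, h3, h4⟩ := ((phiOf_self ht).1 h1).mine hS hturn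
      refine ⟨r, hr, fun h => hIn.low (by omega), fun h => ?_⟩
      have hlr := hr.1
      rw [G.anc_ge (by omega)]
      have h5 : In S r (Sg S r) none ∅ := 
        Classical.epsilon_spec (p := fun s => In S r s none ∅) ⟨s2, hIn.low2 (by omega)⟩
      left
      refine ⟨fun j h6 h7 => ?_, h5.low2 (by omega)⟩
      have h8 : a + 2 ≤ j := h6
      omega
  · intro t ht hturn r hr
    have hlr := hr.1
    rcases Nat.lt_or_ge a (G.len t) with h1 | h1
    · have hr' := Ph.step_opp (CI_okt ha hS ht h1) h1 ((phiOf_self ht).2 h1) hturn hr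
      refine ⟨fun h => ?_, fun _ => ?_⟩
      · omega
      · rw [hr.anc h1]; exact hr'
    · have h2 : G.len t ≠ a := by rintro h; rw [turn_true] at hturn; omega
      refine ⟨fun _ => ?_, fun _ => by omega⟩
      exact ((phiOf_self ht).1 h1).opp hS hturn hr (CV.low (by omega)) (fun _ => by omega)
        (fun _ => by omega)

theorem In_loc {S S' : Set (G.CT J a).T} {n : ℕ} (h : ∀ t, (G.CT J a).len t ≤ n → (t ∈ S ↔ t ∈ S'))
    {q : G.T} {s : Set G.T} {u : Option G.T} {s' : Set G.T} (hq : G.len q ≤ n) :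
    In S q s u s' ↔ In S' q s u s' := by
  constructor
  · rintro ⟨h1, h2⟩
    exact ⟨h1, (h (mkN q s u s' h1) hq).1 h2⟩
  · rintro ⟨h1, h2⟩
    exact ⟨h1, (h (mkN q s u s' h1) hq).2 h2⟩

theorem CI_loc {S S' : Set (G.CT J a).T} {n : ℕ} (h : ∀ t, (G.CT J a).len t ≤ n → (t ∈ S ↔ t ∈ S'))
    {t : G.T} (ht : G.len t ≤ n) (hC : CI S t) : CI S' t := by
  refine ⟨fun h1 => (In_loc h ht).1 (hC.1 h1), fun h1 => ?_⟩
  have hSg : Sg S (G.anc (a+1) t) = Sg S' (G.anc (a+1) t) := by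
    unfold Sg
    congr 1
    funext s
    exact propext (In_loc h (by rw [G.len_anc h1]; omega))
  have := (hC.2 h1).congr (A' := (PI S' (G.anc (a+1) t)).A) (B' := (PI S' (G.anc (a+1) t)).B) ?_ ?_
  · convert this using 1
    simp only [PI, hSg]
  · intro hA
    simp only [PI] at hA ⊢
    rw [← hSg]; exact (In_loc h ht).1 hA
  · intro u _ hA
    simp only [PI] at hA ⊢
    rw [← hSg]; exact (In_loc h ht).1 hA

theorem CI_lift (ha : a % 2 = 0) {S : Set (G.CT J a).T} (hS : (G.CT J a).IsStrat true S) 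
    {x : ℕ → G.T} (hx : G.IsPlay x) (hxS : ∀ n, x n ∈ phiOf (CI S)) :
    ∃ y, (G.CT J a).IsPlay y ∧ (∀ n, y n ∈ S) ∧ ∀ n, (y n).1.1 = x n := by
  have hok := CI_okt ha hS (hxS (a+1)) (by rw [(hx _).1])
  rw [hx.anc le_rfl] at hok
  have hcond : ∀ n, a + 1 ≤ n → (PI S (x (a+1))).Cond (x n) := by
    intro n hn
    have := (phiOf_self (hxS n)).2 (by rw [(hx _).1]; exact hn)
    rwa [hx.anc hn] at this
  rcases Ph.lift_cases hok hx hcond with h | ⟨l, hl, h⟩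
  · refine In.lift hS hx (n0 := a + 2) (s := Sg S (x (a+1))) (u := none)
      (s' := SA J a (Sg S (x (a+1))) (x (a+2))) (fun n hn => ?_)
    have h1 : In S (x n) _ _ _ := (h n (by omega)).2
    rwa [hx.anc hn] at h1
  · exact In.lift hS hx (n0 := a + 1 + l) (s := Sg S (x (a+1))) (u := some (x l)) (s' := ∅)
      (fun n hn => h n (by omega) (by omega))

/-! Player II. -/

def gII (S : Set (G.CT J a).T) : Set G.T :=
  {u | a + 2 ≤ G.len u ∧ ∃ s, In S (G.anc (a+2) u) s (some u) ∅}

def Sz (S : Set (G.CT J a).T) (t1 : G.T) : Set G.T :=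
  {t | G.len t1 ≤ G.len t ∧ G.anc (G.len t1) t = t1 ∧
    ∀ j, G.len t1 ≤ j → j ≤ G.len t → ¬ G.Frc false univ (gII S) (G.anc j t)}

noncomputable def sP (S : Set (G.CT J a).T) (t1 c : G.T) : Set G.T :=
  Classical.epsilon (fun s' => In S c (Sz S t1) none s')

noncomputable def sU (S : Set (G.CT J a).T) (u : G.T) : Set G.T :=
  Classical.epsilon (fun s => In S (G.anc (a+2) u) s (some u) ∅)

noncomputable def PII (S : Set (G.CT J a).T) (t1 : G.T) : Ph G where
  p := false
  Amb := univ
  goal := gII S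
  b := a + 1
  A := fun t => In S t (Sz S t1) none (sP S t1 (G.anc (a+2) t))
  B := fun u t => In S t (sU S u) (some u) ∅

def CII (S : Set (G.CT J a).T) (t : G.T) : Prop :=
  (G.len t ≤ a → In S t ∅ none ∅) ∧ (a + 2 ≤ G.len t → (PII S (G.anc (a+1) t)).Cond t)

theorem QI_Sz {S : Set (G.CT J a).T} {t1 : G.T} (hW : ¬ G.Frc false univ (gII S) t1) :
    G.QI t1 (Sz S t1) where
  mem := ⟨le_rfl, G.anc_self t1, fun j h2 h3 => by rwa [le_antisymm h3 h2, G.anc_self]⟩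
  ext := fun t ht => ⟨ht.1, ht.2.1⟩
  par := fun t ht hl => ⟨by rw [G.len_par]; omega,
    by rw [G.anc_par hl]; exact ht.2.1, fun j h2 h3 => by
      rw [G.len_par] at h3
      rw [G.anc_par (by omega)]; exact ht.2.2 j h2 (by omega)⟩
  mine := fun t ht hturn => by
    have h2 := ht.2.2 (G.len t) ht.1 le_rfl
    rw [G.anc_self] at h2
    have h3 : ∃ r, G.Child t r ∧ ¬ G.Frc false univ (gII S) r := by
      by_contra hcon
      push Not at hcon
      exact h2 (Frc.opp t trivial (by rw [turn_false]; rw [turn_true] at hturn; omega)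
        (fun r hr _ => hcon r hr))
    obtain ⟨r, hr, hrW⟩ := h3
    have hl := hr.1
    have hl2 := ht.1
    refine ⟨r, hr, by omega, by rw [hr.anc ht.1]; exact ht.2.1, fun j h4 h5 => ?_⟩
    rcases Nat.lt_or_ge (G.len t) j with h6 | h6
    · rwa [G.anc_ge (by omega)]
    · rw [hr.anc h6]; exact ht.2.2 j h4 h6
  opp := fun t ht hturn r hr => by
    have hl := hr.1
    have hl2 := ht.1
    refine ⟨by omega, by rw [hr.anc ht.1]; exact ht.2.1, fun j h4 h5 => ?_⟩
    rcases Nat.lt_or_ge (G.len t) j with h6 | h6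
    · rw [G.anc_ge (by omega)]
      intro hrW
      have h2 := ht.2.2 (G.len t) ht.1 le_rfl
      rw [G.anc_self] at h2
      exact h2 (Frc.mine t r trivial (by rw [turn_false]; rw [turn_true] at hturn; omega) hr trivial hrW)
    · rw [hr.anc h6]; exact ht.2.2 j h4 h6

theorem PII_ok (ha : a % 2 = 0) {S : Set (G.CT J a).T} (hS : (G.CT J a).IsStrat false S) {t1 : G.T}
    (h1 : G.len t1 = a + 1) : (PII S t1).Ok (a + 1) := by
  constructor
  · intro t _ _
    obtain ⟨r, hr⟩ := G.child t
    exact ⟨r, hr, trivial⟩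
  · exact fun t ht hturn r hr => trivial
  · exact Nat.le_succ _
  · exact le_rfl
  · intro t ht hc hturn
    have hA : In S t _ _ _ := hc.2
    obtain ⟨r, s2, u2, s2', hr, hInr, h3, h4⟩ := hA.mine hS hturn
    obtain rfl := h3 (by omega)
    have hlr := hr.1
    have hz : r ∈ Sz S t1 → ¬ (PII S t1).W r := by
      intro h
      have := h.2.2 (G.len r) h.1 le_rfl
      rw [G.anc_self] at this
      exact this
    rcases Nat.eq_or_lt_of_le ht with h2 | h2
    · rcases hInr.1.2 (by omega) with ⟨v, h5, h6, h7, h8, h9, h10⟩ | ⟨h5, h6, h7⟩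
      · exfalso
        subst h5 h6
        have h11 := h10 (a+2) (by omega) h9
        rw [G.anc_ge (by omega)] at h11
        have h12 := h7.2.2 (G.len v) h7.1 le_rfl
        rw [G.anc_self] at h12
        refine h12 (Frc.base v trivial ⟨h9, Sz S t1, ?_⟩)
        rwa [← h11]
      · subst h5
        refine ⟨r, hr, hz (h7.sub h6), ?_⟩
        show In S r _ none _
        rw [G.anc_ge (by omega)]
        exact Classical.epsilon_spec (p := fun s' => In S r (Sz S t1) none s') ⟨s2', hInr⟩
    · obtain ⟨rfl, rfl⟩ := h4 h2
      refine ⟨r, hr, ?_, ?_⟩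
      · rcases hInr.1.2 (by omega) with ⟨v, h5, -⟩ | ⟨-, h5, h6⟩
        · simp at h5
        · exact hz (h6.sub h5)
      · show In S r _ none _
        rw [hr.anc h2]; exact hInr
  · intro t ht hc hturn r hr hrW
    have hturn' : ¬ turn false (G.len t) := hturn
    rw [turn_false] at hturn'
    have hlt : a + 2 ≤ G.len t := by omega
    have hA : In S t _ _ _ := hc.2
    have hlr := hr.1
    rcases hA.1.2 hlt with ⟨v, h5, -⟩ | ⟨-, h5, h6⟩
    · simp at h5
    have htS := h6.sub h5
    have hlt1 := htS.1
    have hrS : r ∈ Sz S t1 := by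
      refine ⟨by omega, by rw [hr.anc htS.1]; exact htS.2.1, fun j h7 h8 => ?_⟩
      rcases Nat.lt_or_ge (G.len t) j with h9 | h9
      · rw [G.anc_ge (by omega)]; exact hrW
      · rw [hr.anc h9]; exact htS.2.2 j h7 h9
    show In S r _ none _
    rw [hr.anc hlt]
    refine hA.opp hS hturn hr ⟨fun _ => ?_, fun _ => Or.inr ⟨rfl, ?_, ?_⟩⟩
      (fun _ => rfl) (fun h2 => ⟨rfl, rfl⟩)
    · rw [hr.anc ht]; exact hA.1.1 ht
    · exact h6.opp t h5 hturn r hr hrS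
    · rw [hr.anc hlt]; exact h6
  · intro u t hu hut hanc hB hturn
    have hB' : In S t _ _ _ := hB
    exact hB'.Bmine hS (by have := hu.1; omega) hturn
  · intro u t hu hut hanc hB hturn r hr
    have hB' : In S t _ _ _ := hB
    exact hB'.Bopp hS (by have := hu.1; omega) hut hturn hr
  · intro u hu _
    show In S u (sU S u) (some u) ∅
    have h2 : In S (G.anc (a+2) u) (sU S u) (some u) ∅ := 
      Classical.epsilon_spec (p := fun s => In S (G.anc (a+2) u) s (some u) ∅) hu.2
    have := h2.forced hS hu.1 (G.len u) hu.1 le_rfl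
    rwa [G.anc_self] at this

theorem CII_cond1 (ha : a % 2 = 0) {S : Set (G.CT J a).T} (hS : (G.CT J a).IsStrat false S) {t : G.T}
    (ht : t ∈ phiOf (CII S)) (hl : G.len t = a + 1) : (PII S t).Cond t := by
  by_cases hW : (PII S t).W t
  · exact Ph.cond_newW (PII_ok ha hS hl) (show a + 1 ≤ G.len t by omega) (fun j h1 h2 => by
      have h3 : a + 1 ≤ j := h1
      omega) hW
  · left
    refine ⟨fun j h1 h2 => ?_, ?_⟩
    · have h3 : a + 1 ≤ j := h1
      rwa [G.anc_ge (by omega)]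
    · show In S t _ _ _
      have h1 := (ht a (by omega)).1 (by rw [G.len_anc (by omega)])
      have hla : G.len (G.anc a t) = a := G.len_anc (by omega)
      have hc := G.child_anc (t := t) (n := a) (by omega)
      rw [G.anc_ge (n := a+1) (by omega)] at hc
      refine h1.opp hS ?_ hc ⟨fun _ => ?_, fun _ => by omega⟩ (fun _ => by omega) (fun _ => by omega)
      · rw [turn_false]; omega
      · rw [G.anc_ge (by omega)]; exact QI_Sz hW

theorem CII_cond (ha : a % 2 = 0) {S : Set (G.CT J a).T} (hS : (G.CT J a).IsStrat false S) {t : G.T}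
    (ht : t ∈ phiOf (CII S)) (hl : a + 1 ≤ G.len t) : (PII S (G.anc (a+1) t)).Cond t := by
  rcases Nat.eq_or_lt_of_le hl with h1 | h1
  · rw [G.anc_ge (by omega)]; exact CII_cond1 ha hS ht h1.symm
  · exact (phiOf_self ht).2 h1

theorem CII_strat (ha : a % 2 = 0) {S : Set (G.CT J a).T} (hS : (G.CT J a).IsStrat false S) :
    G.IsStrat false (phiOf (CII S)) := by
  apply phiOf_strat
  · exact ⟨fun _ => In_root hS, fun h => by rw [G.len_root] at h; omega⟩
  · intro t ht hturn
    rcases Nat.lt_or_ge a (G.len t) with h1 | h1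
    · obtain ⟨r, hr, hr'⟩ := Ph.step_mine (PII_ok ha hS (G.len_anc h1)) h1 (CII_cond ha hS ht h1) hturn
      refine ⟨r, hr, fun h => ?_, fun _ => ?_⟩
      · rw [hr.1] at h; omega
      · rw [hr.anc h1]; exact hr'
    · obtain ⟨r, s2, u2, s2', hr, hIn, h3, h4⟩ := ((phiOf_self ht).1 h1).mine hS hturn
      have hlr := hr.1
      exact ⟨r, hr, fun h => hIn.low (by omega), fun h => by omega⟩
  · intro t ht hturn r hr
    have hlr := hr.1
    rcases Nat.lt_or_ge a (G.len t) with h1 | h1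
    · have hr' := Ph.step_opp (PII_ok ha hS (G.len_anc h1)) h1 (CII_cond ha hS ht h1) hturn hr
      refine ⟨fun h => ?_, fun _ => ?_⟩
      · omega
      · rw [hr.anc h1]; exact hr'
    · refine ⟨fun _ => ?_, fun _ => by omega⟩
      exact ((phiOf_self ht).1 h1).opp hS hturn hr (CV.low (by omega)) (fun _ => by omega)
        (fun _ => by omega)

theorem CII_loc {S S' : Set (G.CT J a).T} {n : ℕ} (h : ∀ t, (G.CT J a).len t ≤ n → (t ∈ S ↔ t ∈ S'))
    {t : G.T} (ht : G.len t ≤ n) (hC : CII S t) : CII S' t := by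
  refine ⟨fun h1 => (In_loc h ht).1 (hC.1 h1), fun h1 => ?_⟩
  have hg : gII S = gII S' := by
    ext u
    refine and_congr_right fun hu => exists_congr fun s => In_loc h (by rw [G.len_anc hu]; omega)
  have hz : Sz S = Sz S' := by
    funext t1
    simp only [Sz, hg]
  have hP : sP S (G.anc (a+1) t) (G.anc (a+2) t) = sP S' (G.anc (a+1) t) (G.anc (a+2) t) := by
    unfold sP
    congr 1
    funext s
    rw [hz]
    exact propext (In_loc h (by rw [G.len_anc h1]; omega))
  have hU : ∀ u ∈ gII S, sU S u = sU S' u := by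
    intro u hu
    unfold sU
    congr 1
    funext s
    exact propext (In_loc h (by rw [G.len_anc hu.1]; omega))
  have := (hC.2 h1).congr (A' := (PII S' (G.anc (a+1) t)).A) (B' := (PII S' (G.anc (a+1) t)).B) ?_ ?_
  · convert this using 1
    simp only [PII, hg]
  · intro hA
    simp only [PII] at hA ⊢
    rw [← hz, ← hP]; exact (In_loc h ht).1 hA
  · intro u hu hA
    simp only [PII] at hA ⊢
    rw [← hU u hu]; exact (In_loc h ht).1 hA

theorem CII_lift (ha : a % 2 = 0) {S : Set (G.CT J a).T} (hS : (G.CT J a).IsStrat false S) 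
    {x : ℕ → G.T} (hx : G.IsPlay x) (hxS : ∀ n, x n ∈ phiOf (CII S)) :
    ∃ y, (G.CT J a).IsPlay y ∧ (∀ n, y n ∈ S) ∧ ∀ n, (y n).1.1 = x n := by
  have hok : (PII S (x (a+1))).Ok (a+1) := PII_ok ha hS (hx (a+1)).1
  have hcond : ∀ n, a + 1 ≤ n → (PII S (x (a+1))).Cond (x n) := by
    intro n hn
    have := CII_cond ha hS (hxS n) (by rw [(hx _).1]; exact hn)
    rwa [hx.anc hn] at this
  rcases Ph.lift_cases hok hx hcond with h | ⟨l, hl, h⟩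
  · refine In.lift hS hx (n0 := a + 2) (s := Sz S (x (a+1))) (u := none)
      (s' := sP S (x (a+1)) (x (a+2))) (fun n hn => ?_)
    have h1 : In S (x n) _ _ _ := (h n (by omega)).2
    rwa [hx.anc hn] at h1
  · exact In.lift hS hx (n0 := a + 1 + l) (s := sU S (x l)) (u := some (x l)) (s' := ∅)
      (fun n hn => h n (by omega) (by omega))

theorem idk_aux {p : Bool} {S : Set (G.CT J a).T} (hS : (G.CT J a).IsStrat p S) {C : G.T → Prop}
    (hC : ∀ t, G.len t ≤ a → (C t ↔ In S t ∅ none ∅)) (t : (G.CT J a).T) (ht : G.len t.1.1 ≤ a) :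
    t.1.1 ∈ phiOf C ↔ t ∈ S := by
  have h1 : t ∈ S ↔ In S t.1.1 t.1.2.1 t.1.2.2.1 t.1.2.2.2 := by
    conv_lhs => rw [CN.eta t]
    exact ⟨fun h => ⟨_, h⟩, fun ⟨_, h⟩ => h⟩
  rw [h1]
  constructor
  · intro h
    exact ((hC _ ht).1 (phiOf_self h)).low (by omega)
  · intro h n hn
    rw [hC _ (by rw [G.len_anc hn]; omega)]
    exact (h.anc hS n).low (by rw [G.len_anc hn]; omega)

noncomputable def closedCov (G : GT) (J : Set G.T) (a : ℕ) (ha : a % 2 = 0) :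
    Cov a (G.CT J a) G where
  f := fun ν => ν.1.1
  len_f := fun _ => rfl
  par_f := fun _ => rfl
  bij := fun t ht => by
    refine ⟨mkN t ∅ none ∅ (CV.low (by omega)), rfl, fun ν hν => ?_⟩
    subst hν
    exact (CN.eta ν).trans <| mkN_congr (fun (h : a + 1 ≤ G.len ν.1.1) => by omega) (fun (h : a + 2 ≤ G.len ν.1.1) => by omega)
  phi := fun p S => if p then phiOf (CI S) else phiOf (CII S)
  strat := fun p S hS => by
    cases p
    · simpa using CII_strat ha hS
    · simpa using CI_strat ha hS
  loc := fun p S S' n _ _ h t ht hm => by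
    cases p
    · simp only [Bool.false_eq_true, if_false] at hm ⊢
      exact fun m hm' => CII_loc h (by rw [G.len_anc hm']; omega) (hm m hm')
    · simp only [if_true] at hm ⊢
      exact fun m hm' => CI_loc h (by rw [G.len_anc hm']; omega) (hm m hm')
  idk := fun p S hS t ht => by
    have ht' : G.len t.1.1 ≤ a := ht
    cases p
    · simp only [Bool.false_eq_true, if_false]
      exact idk_aux hS (fun t ht => ⟨fun h => h.1 ht, fun h => ⟨fun _ => h, fun _ => by omega⟩⟩) t ht'
    · simp only [if_true]
      exact idk_aux hS (fun t ht => ⟨fun h => h.1 ht, fun h => ⟨fun _ => h, fun _ => by omega⟩⟩) t ht'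
  lift := fun p S hS x hx hxS => by
    cases p
    · simp only [Bool.false_eq_true, if_false] at hxS
      exact CII_lift ha hS hx hxS
    · simp only [if_true] at hxS
      exact CI_lift ha hS hx hxS

theorem closed_decided (hJ : ∀ t ∈ J, G.par t ∈ J) :
    (G.CT J a).Decided {x | ∀ n, (x n).1.1 ∈ J} := by
  have key : ∀ x, (G.CT J a).IsPlay x → ((∀ n, (x n).1.1 ∈ J) ↔ (x (a+2)).1.2.2.1 = none) := by
    intro x hx
    have hxq : G.IsPlay (fun n => (x n).1.1) := fun n => ⟨(hx n).1,
      congrArg (fun ν : G.CN J a => ν.1.1) (hx n).2⟩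
    have hd : ∀ n, a + 2 ≤ n → (x n).1.2.2.1 = (x (a+2)).1.2.2.1 ∧ (x n).1.2.2.2 = (x (a+2)).1.2.2.2 ∧
        (x n).1.2.1 = (x (a+2)).1.2.1 := by
      intro n hn
      induction n, hn using Nat.le_induction with
      | base => exact ⟨rfl, rfl, rfl⟩
      | succ n hn ih =>
        have h1 : (G.CT J a).par (x (n+1)) = x n := (hx n).2
        have h2 : G.len (x (n+1)).1.1 = n + 1 := (hx (n+1)).1
        rw [CN.eta (x (n+1)), CN.eta (x n)] at h1
        have h3 : mkN (G.par (x (n+1)).1.1) _ _ _ _ = _ := (par_mkN_aux _).symm.trans h1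
        obtain ⟨h4, h5, h6⟩ := mkN_eq h3
        rw [G.len_par, h2] at h5 h6
        obtain ⟨h7, h8⟩ := h6 (by omega)
        rw [h7, h8, h5 (by omega)]
        exact ih
    constructor
    · intro h
      have h1 : G.len (x (a+2)).1.1 = a + 2 := (hx (a+2)).1
      rcases (x (a+2)).2.1.2 h1.ge with ⟨v, h2, h3, h4, h5, h6, h7⟩ | ⟨h2, h3, h4⟩
      · exfalso
        have hlv : G.len (x (G.len v)).1.1 = G.len v := (hx (G.len v)).1
        rcases (x (G.len v)).2.1.2 (by rw [hlv]; exact h6) with ⟨v', g2, g3, g4, g5, g6, g7⟩ | ⟨g2, -⟩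
        · rw [(hd _ h6).1, h2] at g2
          simp only [Option.some.injEq] at g2
          subst g2
          have := g7 (G.len v) (by rw [hlv]) le_rfl
          rw [G.anc_ge (by rw [hlv]), G.anc_self] at this
          exact h5 (this ▸ h _)
        · rw [(hd _ h6).1, h2] at g2; simp at g2
      · exact h2
    · intro h n
      have h1 : (x (n + (a+2))).1.1 ∈ J := by
        have hl : G.len (x (n + (a+2))).1.1 = n + (a+2) := (hx (n + (a+2))).1
        rcases (x (n + (a+2))).2.1.2 (by rw [hl]; omega) with ⟨v', g2, g3, g4, g5, g6, g7⟩ | ⟨g2, g3, g4⟩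
        · rw [(hd _ (by omega)).1, h] at g2; simp at g2
        · exact g4.subJ g3
      have h5 : ∀ (q : ℕ → G.T), G.IsPlay q → ∀ m, q (n + m) ∈ J → q n ∈ J := by
        intro q hq m
        induction m with
        | zero => exact id
        | succ m ih =>
          intro h1
          apply ih
          have := hJ _ h1
          have h2 := (hq (n + m)).2
          rw [← h2]; exact this
      exact h5 _ hxq _ h1
  refine ⟨a + 2, fun x y hx hy hxy => ?_⟩
  simp only [mem_setOf_eq]
  rw [key x hx, key y hy, hxy]

end GT



namespace GT

variable {G : ℕ → GT} {k : ℕ} (c : ∀ n, Cov (k+n) (G (n+1)) (G n))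

/-- coherent sequences -/
def LT (c : ∀ n, Cov (k+n) (G (n+1)) (G n)) : Type :=
  {t : ∀ n, (G n).T // ∀ n, (c n).f (t (n+1)) = t n}

theorem exists_down (n : ℕ) (t : (G n).T) : ∃ s : ∀ i, (G i).T, s n = t ∧
    ∀ i < n, (c i).f (s (i+1)) = s i := by
  induction n with
  | zero =>
    exact ⟨Function.update (fun i => (G i).root) 0 t, by simp, fun i hi => by omega⟩
  | succ n ih =>
    obtain ⟨s, hs, hs'⟩ := ih ((c n).f t)
    refine ⟨Function.update s (n+1) t, by simp, fun i hi => ?_⟩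
    rcases Nat.lt_succ_iff_lt_or_eq.1 hi with h | rfl
    · rw [Function.update_of_ne (by omega), Function.update_of_ne (by omega)]
      exact hs' i h
    · rw [Function.update_self, Function.update_of_ne (by omega), hs]

theorem LT.len_eq (t : LT c) (n : ℕ) : (G n).len (t.1 n) = (G 0).len (t.1 0) := by
  induction n with
  | zero => rfl
  | succ n ih => rw [← ih, ← t.2 n, (c n).len_f]

theorem exists_lift (n : ℕ) (t : (G n).T) (ht : (G n).len t ≤ k + n) : ∃ s : LT c, s.1 n = t := by
  obtain ⟨s, hs, hs'⟩ := exists_down c n t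
  have : ∀ i, Nonempty (G i).T := fun i => ⟨(G i).root⟩
  choose! u hu using fun i (r : (G i).T) (h : (G i).len r ≤ k + i) => ((c i).bij r h).exists
  classical
  let s' : ∀ i, (G i).T := fun i => Nat.rec (s 0) (fun i r => if i + 1 ≤ n then s (i+1) else u i r) i
  have h0 : ∀ i, s' (i+1) = if i + 1 ≤ n then s (i+1) else u i (s' i) := fun i => rfl
  have h1 : ∀ i, i ≤ n → s' i = s i := by
    intro i hi
    cases i with
    | zero => rfl
    | succ i => rw [h0, if_pos hi]
  have h2 : ∀ i, n ≤ i → (G i).len (s' i) = (G n).len t := by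
    intro i hi
    induction i, hi using Nat.le_induction with
    | base => rw [h1 n le_rfl, hs]
    | succ i hi ih =>
      rw [h0, if_neg (by omega), ← (c i).len_f, hu _ _ (by omega), ih]
  refine ⟨⟨s', fun i => ?_⟩, by show s' n = t; rw [h1 n le_rfl, hs]⟩
  rcases lt_or_ge i n with hi | hi
  · rw [h1 _ hi.le, h1 _ hi, hs' i hi]
  · rw [h0, if_neg (by omega), hu _ _ (by rw [h2 i hi]; omega)]

theorem lift_uniq (n : ℕ) (s t : LT c) (h : s.1 n = t.1 n) (hs : (G n).len (s.1 n) ≤ k + n) : s = t := by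
  apply Subtype.ext
  funext i
  have hl := s.len_eq c
  have h1 : ∀ i, i ≤ n → s.1 i = t.1 i := by
    intro i hi
    induction hi using Nat.decreasingInduction with
    | self => exact h
    | of_succ i hi ih => rw [← s.2, ← t.2, ih]
  rcases le_total i n with hi | hi
  · exact h1 i hi
  · induction i, hi using Nat.le_induction with
    | base => exact h
    | succ i hi ih =>
      refine ((c i).bij (t.1 i) ?_).unique (by rw [s.2, ih]) (t.2 i)
      rw [← ih, hl, ← hl n]; omega

def limT (c : ∀ n, Cov (k+n) (G (n+1)) (G n)) : GT where
  T := LT c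
  len := fun t => (G 0).len (t.1 0)
  par := fun t => ⟨fun n => (G n).par (t.1 n), fun n => by rw [(c n).par_f, t.2]⟩
  root := ⟨fun n => (G n).root, fun n => (G n).root_uniq _ (by rw [(c n).len_f, (G (n+1)).len_root])⟩
  len_root := (G 0).len_root
  root_uniq := fun t ht => Subtype.ext (funext fun n => (G n).root_uniq _ (by rw [t.len_eq]; exact ht))
  len_par := fun t => (G 0).len_par _
  child := fun t => by
    obtain ⟨s, hs, hs'⟩ := (G ((G 0).len (t.1 0) + 1)).child (t.1 _)
    have hl := t.len_eq c ((G 0).len (t.1 0) + 1)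
    obtain ⟨r, hr⟩ := exists_lift c _ s (by omega)
    refine ⟨r, ?_, ?_⟩
    · rw [← r.len_eq c ((G 0).len (t.1 0) + 1), hr, hs, hl]
    · apply lift_uniq c ((G 0).len (t.1 0) + 1)
      · show (G _).par (r.1 _) = _
        rw [hr, hs']
      · show (G _).len ((G _).par (r.1 _)) ≤ _
        rw [hr, hs']; omega

/-- projection -/
def pr (n : ℕ) (t : (limT c).T) : (G n).T := t.1 n

theorem pr_f (n : ℕ) (t : (limT c).T) : (c n).f (pr c (n+1) t) = pr c n t := t.2 n
theorem pr_len (n : ℕ) (t : (limT c).T) : (G n).len (pr c n t) = (limT c).len t := LT.len_eq c t n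
theorem pr_par (n : ℕ) (t : (limT c).T) : pr c n ((limT c).par t) = (G n).par (pr c n t) := rfl
theorem pr_lift (n : ℕ) (t : (G n).T) (ht : (G n).len t ≤ k + n) : ∃ s, pr c n s = t :=
  exists_lift c n t ht
theorem pr_inj (n : ℕ) {s t : (limT c).T} (h : pr c n s = pr c n t) (hs : (limT c).len s ≤ k + n) :
    s = t := lift_uniq c n s t h ((LT.len_eq c s n).trans_le hs)

theorem pr_child {n : ℕ} {s t : (limT c).T} (h : (limT c).Child s t) :
    (G n).Child (pr c n s) (pr c n t) := ⟨by rw [pr_len, pr_len, h.1], by rw [← pr_par, h.2]⟩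

theorem pr_play (n : ℕ) {x : ℕ → (limT c).T} (h : (limT c).IsPlay x) :
    (G n).IsPlay (fun i => pr c n (x i)) :=
  fun i => ⟨by rw [pr_len, (h i).1], by rw [← pr_par, (h i).2]⟩

def L0 (S : Set (limT c).T) (n : ℕ) : Set (G n).T := {t | ∃ s ∈ S, pr c n s = (G n).anc (k+n) t}

variable {c}

theorem L0_low {S : Set (limT c).T} {n : ℕ} {s : (limT c).T} (h : (limT c).len s ≤ k + n) :
    pr c n s ∈ L0 c S n ↔ s ∈ S := by
  unfold L0
  rw [mem_ofPred_eq, (G n).anc_ge (by rw [pr_len]; exact h)]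
  constructor
  · rintro ⟨r, hr, hrs⟩
    rwa [pr_inj c n hrs.symm h]
  · exact fun h => ⟨s, h, rfl⟩

theorem L0_strat {p : Bool} {S : Set (limT c).T} (hS : (limT c).IsStrat p S) (n : ℕ) :
    (G n).IsStrat p (L0 c S n) where
  root := ⟨_, hS.root, by
    rw [(G n).anc_ge (by rw [(G n).len_root]; omega)]; rfl⟩
  par := by
    rintro t ⟨s, hs, hst⟩
    rcases lt_or_ge (k + n) ((G n).len t) with h | h
    · exact ⟨s, hs, by rw [(G n).anc_par h, hst]⟩
    · rw [(G n).anc_ge h] at hst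
      refine ⟨_, hS.par _ hs, ?_⟩
      rw [pr_par, hst, (G n).anc_ge (by rw [(G n).len_par]; omega)]
  mine := by
    rintro t ⟨s, hs, hst⟩ hturn
    rcases lt_or_ge ((G n).len t) (k + n) with h | h
    · rw [(G n).anc_ge h.le] at hst
      have hl := pr_len c n s
      rw [hst] at hl
      obtain ⟨r, hr, hrS⟩ := hS.mine s hs (by rw [← hl]; exact hturn)
      refine ⟨pr c n r, by rw [← hst]; exact pr_child c hr, r, hrS, ?_⟩
      rw [(G n).anc_ge]
      rw [pr_len, hr.1]; omega
    · obtain ⟨r, hr⟩ := (G n).child t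
      exact ⟨r, hr, s, hs, by rw [Child.anc hr h, hst]⟩
  opp := by
    rintro t ⟨s, hs, hst⟩ hturn r hr
    rcases lt_or_ge ((G n).len t) (k + n) with h | h
    · rw [(G n).anc_ge h.le] at hst
      have hl := pr_len c n s
      rw [hst] at hl
      have hr1 := hr.1
      obtain ⟨r', rfl⟩ := pr_lift c n r (by omega)
      have : (limT c).par r' = s := by
        apply pr_inj c n
        · rw [pr_par, hr.2, hst]
        · rw [(limT c).len_par, ← pr_len c n]; omega
      rw [L0_low (by rw [← pr_len c n]; omega)]
      refine hS.opp s hs (by rw [← hl]; exact hturn) r' ⟨?_, this⟩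
      rw [← pr_len c n, hr1, hl]
    · exact ⟨s, hs, by rw [Child.anc hr h, hst]⟩

def LF (c : ∀ n, Cov (k+n) (G (n+1)) (G n)) (p : Bool) (S : Set (limT c).T) : ℕ → ∀ n, Set (G n).T
  | 0, n => L0 c S n
  | j+1, n => (c n).phi p (LF c p S j (n+1))

theorem LF_strat {p : Bool} {S : Set (limT c).T} (hS : (limT c).IsStrat p S) (j n : ℕ) :
    (G n).IsStrat p (LF c p S j n) := by
  induction j generalizing n with
  | zero => exact L0_strat hS n
  | succ j ih => exact (c n).strat p _ (ih (n+1))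

theorem LF_agree {p : Bool} {S : Set (limT c).T} (hS : (limT c).IsStrat p S) (j n : ℕ) (t : (G n).T)
    (ht : (G n).len t ≤ k + n + j) : t ∈ LF c p S (j+1) n ↔ t ∈ LF c p S j n := by
  induction j generalizing n with
  | zero =>
    obtain ⟨s, rfl⟩ := pr_lift c n t (by omega)
    have hs : (limT c).len s ≤ k + n := by rw [← pr_len c n]; omega
    show pr c n s ∈ (c n).phi p (L0 c S (n+1)) ↔ pr c n s ∈ L0 c S n
    rw [L0_low hs, ← pr_f, (c n).idk p _ (L0_strat hS (n+1)) _ (by rw [pr_len]; exact hs),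
      L0_low (by omega)]
  | succ j ih =>
    constructor
    · exact (c n).loc p _ _ (k + n + (j+1)) (LF_strat hS (j+1) (n+1)) (LF_strat hS j (n+1))
        (fun t ht => ih (n+1) t (by omega)) t ht
    · exact (c n).loc p _ _ (k + n + (j+1)) (LF_strat hS j (n+1)) (LF_strat hS (j+1) (n+1))
        (fun t ht => (ih (n+1) t (by omega)).symm) t ht

theorem LF_agree' {p : Bool} {S : Set (limT c).T} (hS : (limT c).IsStrat p S) (j d n : ℕ) (t : (G n).T)
    (ht : (G n).len t ≤ k + n + j) : t ∈ LF c p S (j+d) n ↔ t ∈ LF c p S j n := by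
  induction d with
  | zero => rfl
  | succ d ih => rw [← add_assoc, LF_agree hS _ _ _ (by omega), ih]

def LS (c : ∀ n, Cov (k+n) (G (n+1)) (G n)) (p : Bool) (S : Set (limT c).T) (n : ℕ) : Set (G n).T :=
  {t | t ∈ LF c p S ((G n).len t) n}

theorem LS_iff {p : Bool} {S : Set (limT c).T} (hS : (limT c).IsStrat p S) {j n : ℕ} {t : (G n).T}
    (ht : (G n).len t ≤ j) : t ∈ LS c p S n ↔ t ∈ LF c p S j n := by
  obtain ⟨d, rfl⟩ := Nat.exists_eq_add_of_le ht
  rw [LF_agree' hS _ _ _ _ (by omega)]; rfl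

theorem LS_strat {p : Bool} {S : Set (limT c).T} (hS : (limT c).IsStrat p S) (n : ℕ) :
    (G n).IsStrat p (LS c p S n) where
  root := (LS_iff hS le_rfl).2 (LF_strat hS _ n).root
  par := fun t ht => by
    rw [LS_iff hS (j := (G n).len t) (by rw [(G n).len_par]; omega)]
    exact (LF_strat hS _ n).par _ ht
  mine := fun t ht hturn => by
    rw [LS_iff hS (j := (G n).len t + 1) (by omega)] at ht
    obtain ⟨s, hs, hs'⟩ := (LF_strat hS _ n).mine t ht hturn
    exact ⟨s, hs, (LS_iff hS hs.1.le).2 hs'⟩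
  opp := fun t ht hturn s hs => by
    rw [LS_iff hS (j := (G n).len t + 1) (by omega)] at ht
    exact (LS_iff hS hs.1.le).2 ((LF_strat hS _ n).opp t ht hturn s hs)

theorem LS_phi {p : Bool} {S : Set (limT c).T} (hS : (limT c).IsStrat p S) (n : ℕ) (t : (G n).T)
    (ht : t ∈ LS c p S n) : t ∈ (c n).phi p (LS c p S (n+1)) := by
  rw [LS_iff hS (j := (G n).len t + 1) (by omega)] at ht
  exact (c n).loc p _ _ ((G n).len t) (LF_strat hS _ (n+1)) (LS_strat hS (n+1))
    (fun s hs => (LS_iff hS hs).symm) t le_rfl ht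

theorem LS_low {p : Bool} {S : Set (limT c).T} (hS : (limT c).IsStrat p S) {n : ℕ} {s : (limT c).T}
    (h : (limT c).len s ≤ k + n) : pr c n s ∈ LS c p S n ↔ s ∈ S := by
  rw [← L0_low h]
  have := LF_agree' hS 0 ((G n).len (pr c n s)) n (pr c n s) (by rw [pr_len]; omega)
  rw [zero_add] at this
  exact this

theorem LF_loc {p : Bool} {S S' : Set (limT c).T} (hS : (limT c).IsStrat p S)
    (hS' : (limT c).IsStrat p S') {m : ℕ} (h : ∀ t, (limT c).len t ≤ m → (t ∈ S → t ∈ S'))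
    (h' : ∀ t, (limT c).len t ≤ m → (t ∈ S' → t ∈ S))
    (j n : ℕ) (t : (G n).T) (ht : (G n).len t ≤ m) : t ∈ LF c p S j n ↔ t ∈ LF c p S' j n := by
  induction j generalizing n with
  | zero =>
    have hl : (G n).len ((G n).anc (k+n) t) ≤ m := by
      rcases le_total ((G n).len t) (k+n) with h | h
      · rwa [(G n).anc_ge h]
      · rw [(G n).len_anc h]; omega
    constructor
    · rintro ⟨s, hs, hst⟩
      exact ⟨s, h s (by rw [← pr_len c n, hst]; exact hl) hs, hst⟩
    · rintro ⟨s, hs, hst⟩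
      exact ⟨s, h' s (by rw [← pr_len c n, hst]; exact hl) hs, hst⟩
  | succ j ih =>
    constructor
    · exact (c n).loc p _ _ m (LF_strat hS j (n+1)) (LF_strat hS' j (n+1))
        (fun t ht => ih (n+1) t ht) t ht
    · exact (c n).loc p _ _ m (LF_strat hS' j (n+1)) (LF_strat hS j (n+1))
        (fun t ht => (ih (n+1) t ht).symm) t ht

variable (c)

/-- The limit covering. -/
def limCov : Cov k (limT c) (G 0) where
  f := pr c 0
  len_f := pr_len c 0
  par_f := pr_par c 0
  bij := fun t ht => by
    obtain ⟨s, hs⟩ := pr_lift c 0 t ht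
    refine ⟨s, hs, fun r hr => pr_inj c 0 (hr.trans hs.symm) ?_⟩
    rw [← pr_len c 0, hr]; exact ht
  phi := fun p S => LS c p S 0
  strat := fun p S hS => LS_strat hS 0
  loc := fun p S S' n hS hS' h t ht hm => by
    rw [LS_iff hS' ht, ← LF_loc hS hS' (fun t ht => (h t ht).1) (fun t ht => (h t ht).2) _ _ _ ht,
      ← LS_iff hS ht]
    exact hm
  idk := fun p S hS t ht => LS_low hS ht
  lift := fun p S hS x hx hxS => by
    have : ∀ i, Nonempty (G i).T := fun i => ⟨(G i).root⟩
    choose! L hL1 hL2 hL3 using fun n (y : ℕ → (G n).T) (h : (G n).IsPlay y ∧ ∀ i, y i ∈ LS c p S n) =>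
      (c n).lift p _ (LS_strat hS (n+1)) y h.1 (fun i => LS_phi hS n _ (h.2 i))
    let y : ∀ n, ℕ → (G n).T := fun n => Nat.rec x (fun n r => L n r) n
    have hy : ∀ n, (G n).IsPlay (y n) ∧ ∀ i, y n i ∈ LS c p S n := by
      intro n
      induction n with
      | zero => exact ⟨hx, hxS⟩
      | succ n ih => exact ⟨hL1 n _ ih, hL2 n _ ih⟩
    let z : ℕ → (limT c).T := fun m => ⟨fun n => y n m, fun n => hL3 n _ (hy n) m⟩
    refine ⟨z, fun m => ⟨(hx m).1, ?_⟩,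
      fun m => ?_, fun m => rfl⟩
    · exact Subtype.ext (funext fun n => ((hy n).1 m).2)
    · have h1 : (limT c).len (z m) = m := (hx m).1
      refine (LS_low hS (n := m) (s := z m) (by omega)).1 ?_
      exact (hy m).2 m

end GT



namespace GT

/-- Unravelable sets of plays. -/
def Unr (G : GT) (A : Set (ℕ → G.T)) : Prop :=
  ∀ (H : GT) (f : H.T → G.T), (∀ t, G.len (f t) = H.len t) → (∀ t, f (H.par t) = G.par (f t)) →
    ∀ k, ∃ K, ∃ c : Cov k K H, K.Decided {x | (fun n => f (c.f (x n))) ∈ A}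

variable {G : GT}

theorem Decided.compl {A : Set (ℕ → G.T)} (h : G.Decided A) : G.Decided Aᶜ := by
  obtain ⟨N, hN⟩ := h
  exact ⟨N, fun x y hx hy hxy => not_congr (hN x y hx hy hxy)⟩

theorem Unr.compl {A : Set (ℕ → G.T)} (h : Unr G A) : Unr G Aᶜ := by
  intro H f hf hf' k
  obtain ⟨K, c, hc⟩ := h H f hf hf' k
  exact ⟨K, c, hc.compl⟩

structure Mor (G : GT) where
  H : GT
  f : H.T → G.T
  hf : ∀ t, G.len (f t) = H.len t
  hf' : ∀ t, f (H.par t) = G.par (f t)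

theorem Unr.iUnion {A : ℕ → Set (ℕ → G.T)} (h : ∀ n, Unr G (A n)) : Unr G (⋃ n, A n) := by
  intro H f hf hf' k
  have step : ∀ (n : ℕ) (s : Mor G), ∃ s' : Mor G, ∃ c : Cov (k+n) s'.H s.H,
      (∀ t, s'.f t = s.f (c.f t)) ∧ s'.H.Decided {x | (fun i => s'.f (x i)) ∈ A n} := by
    intro n s
    obtain ⟨K, c, hc⟩ := h n s.H s.f s.hf s.hf' (k+n)
    exact ⟨⟨K, fun t => s.f (c.f t), fun t => by rw [s.hf, c.len_f],
      fun t => by rw [c.par_f, s.hf']⟩, c, fun _ => rfl, hc⟩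
  choose N c hc hd using step
  let s : ℕ → Mor G := fun n => Nat.rec ⟨H, f, hf, hf'⟩ (fun n r => N n r) n
  let C : ∀ n, Cov (k+n) (s (n+1)).H (s n).H := fun n => c n (s n)
  let L := limT (G := fun n => (s n).H) C
  have hpr : ∀ n t, (s n).f (pr (G := fun n => (s n).H) C n t) = f (pr (G := fun n => (s n).H) C 0 t) := by
    intro n t
    induction n with
    | zero => rfl
    | succ n ih =>
      rw [← ih, ← pr_f (G := fun n => (s n).H) C n]
      exact hc n (s n) _
  have hL : ∀ n, L.Decided {x | (fun i => f (pr (G := fun n => (s n).H) C 0 (x i))) ∈ A n} := by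
    intro n
    obtain ⟨M, hM⟩ := hd n (s n)
    refine ⟨M, fun x y hx hy hxy => ?_⟩
    have := hM _ _ (pr_play (G := fun n => (s n).H) C (n+1) hx) (pr_play (G := fun n => (s n).H) C (n+1) hy)
      (by simp only [hxy])
    simp only [mem_ofPred_eq] at this ⊢
    simp only [← hpr (n+1)]
    exact this
  let J : Set L.T := {t | ∃ y, L.IsPlay y ∧ y (L.len t) = t ∧
    ∀ n, (fun i => f (pr (G := fun n => (s n).H) C 0 (y i))) ∉ A n}
  have hJ : ∀ t ∈ J, L.par t ∈ J := by
    rintro t ⟨y, hy, hyt, hyA⟩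
    refine ⟨y, hy, ?_, hyA⟩
    rw [L.len_par]
    generalize hl : L.len t = l at hyt
    cases l with
    | zero => 
      have h1 : L.par t = t := by
        rw [L.root_uniq t hl]; apply L.root_uniq; rw [L.len_par, L.len_root]
      rw [h1]; exact hyt
    | succ l =>
      rw [← hyt]; exact (hy l).2.symm
  refine ⟨L.CT J (2*k), ((closedCov L J (2*k) (by omega)).mono (by omega)).comp (limCov (G := fun n => (s n).H) C), ?_⟩
  obtain ⟨M, hM⟩ := (closed_decided (a := 2*k) hJ).compl
  refine ⟨M, fun x y hx hy hxy => ?_⟩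
  have key : ∀ x, (L.CT J (2*k)).IsPlay x → (x ∈ {x : ℕ → (L.CT J (2*k)).T | ∀ n, (x n).1.1 ∈ J}ᶜ ↔
      (fun i => f (pr (G := fun n => (s n).H) C 0 (x i).1.1)) ∈ ⋃ n, A n) := by
    intro x hx
    have hx' : L.IsPlay (fun n => (x n).1.1) := (closedCov L J (2*k) (by omega)).isPlay hx
    rw [mem_compl_iff, mem_ofPred_eq, mem_iUnion, ← not_iff_not, not_not]
    push Not
    constructor
    · intro h1 n hn
      obtain ⟨R, hR⟩ := hL n
      obtain ⟨y, hy, hyt, hyA⟩ := h1 R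
      have hl : L.len (x R).1.1 = R := (hx' R).1
      rw [hl] at hyt
      exact hyA n ((hR _ _ hy hx' hyt).2 hn)
    · intro h1 n
      exact ⟨_, hx', by rw [show L.len (x n).1.1 = n from (hx' n).1], h1⟩
  exact (key x hx).symm.trans ((hM x y hx hy hxy).trans (key y hy))

theorem Unr.det {A : Set (ℕ → G.T)} (h : Unr G A) :
    (∃ S, G.IsStrat true S ∧ ∀ x, G.IsPlay x → (∀ n, x n ∈ S) → x ∈ A) ∨
    (∃ S, G.IsStrat false S ∧ ∀ x, G.IsPlay x → (∀ n, x n ∈ S) → x ∉ A) := by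
  obtain ⟨K, c, hc⟩ := h G (fun t => t) (fun _ => rfl) (fun _ => rfl) 0
  rcases clopen_det _ hc with ⟨S, hS, h1⟩ | ⟨S, hS, h1⟩
  · left
    refine ⟨c.phi true S, c.strat _ _ hS, fun x hx hxS => ?_⟩
    obtain ⟨y, hy, hyS, hyx⟩ := c.lift _ _ hS x hx hxS
    have := h1 y hy hyS
    simp only [mem_ofPred_eq, hyx] at this
    exact this
  · right
    refine ⟨c.phi false S, c.strat _ _ hS, fun x hx hxS => ?_⟩
    obtain ⟨y, hy, hyS, hyx⟩ := c.lift _ _ hS x hx hxS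
    have := h1 y hy hyS
    simp only [mem_ofPred_eq, hyx] at this
    exact this

/-- The tree of finite sequences. -/
def LG : GT where
  T := List ℕ
  len := List.length
  par := List.tail
  root := []
  len_root := rfl
  root_uniq := fun t h => List.length_eq_zero_iff.1 h
  len_par := fun t => List.length_tail
  child := fun t => ⟨0 :: t, rfl, rfl⟩

def brn (x : ℕ → LG.T) : ℕ → ℕ := fun n => List.headI (x (n+1) : List ℕ)

theorem unr_borel {B : Set (ℕ → ℕ)} (hB : MeasurableSet B) : Unr LG {x | brn x ∈ B} := by
  let M : MeasurableSpace (ℕ → ℕ) :=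
    { MeasurableSet' := fun B => Unr LG {x | brn x ∈ B}
      measurableSet_empty := fun H f _ _ k => ⟨H, Cov.id k H, 0, fun x y _ _ _ => Iff.rfl⟩
      measurableSet_compl := fun s hs => hs.compl
      measurableSet_iUnion := fun s hs => by
        have := Unr.iUnion hs
        convert this using 1
        ext x; simp }
  have : (MeasurableSpace.pi : MeasurableSpace (ℕ → ℕ)) ≤ M := by
    refine iSup_le fun n => ?_
    rintro s ⟨t, -, rfl⟩ H f _ _ k
    refine ⟨H, Cov.id k H, n + 1, fun x y _ _ h => ?_⟩
    simp only [mem_ofPred_eq, brn, mem_preimage, Cov.id, h]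
  exact this _ hB

/-- the play -/
def ply (p : Bool) (m : List ℕ → ℕ) (α : ℕ → ℕ) : ℕ → List ℕ
  | 0 => []
  | n+1 => (bif p == decide (n % 2 = 0) then m (ply p m α n) else α (n/2)) :: ply p m α n

theorem ply_play (p : Bool) (m : List ℕ → ℕ) (α : ℕ → ℕ) : LG.IsPlay (ply p m α) := by
  intro n
  refine ⟨?_, rfl⟩
  show (ply p m α n).length = n
  induction n with
  | zero => rfl
  | succ n ih => simp [ply, ih]

theorem ply_loc (p : Bool) (m : List ℕ → ℕ) (n : ℕ) : IsLocallyConstant (fun α => ply p m α n) := by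
  induction n with
  | zero => exact IsLocallyConstant.const _
  | succ n ih =>
    have h1 : IsLocallyConstant (fun α : ℕ → ℕ => α (n/2)) :=
      (IsLocallyConstant.iff_continuous _).2 (continuous_apply _)
    exact IsLocallyConstant.comp₂ ih h1
      (fun l a => (bif p == decide (n % 2 = 0) then m l else a) :: l)

theorem exists_ply {p : Bool} {S : Set LG.T} (hS : LG.IsStrat p S) :
    ∃ m : List ℕ → ℕ, ∀ α n, (ply p m α n : LG.T) ∈ S := by
  have : ∀ t : List ℕ, ∃ a : ℕ, t ∈ (S : Set LG.T) → turn p t.length → (a :: t : List ℕ) ∈ (S : Set LG.T) := by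
    intro t
    by_cases h : (t : LG.T) ∈ S ∧ turn p t.length
    · obtain ⟨s, ⟨hs, hs'⟩, hsS⟩ := hS.mine t h.1 h.2
      cases s with
      | nil => cases hs
      | cons a s =>
        have : s = t := hs'
        subst this
        exact ⟨a, fun _ _ => hsS⟩
    · exact ⟨0, fun h1 h2 => absurd ⟨h1, h2⟩ h⟩
  choose m hm using this
  refine ⟨m, fun α n => ?_⟩
  induction n with
  | zero => exact hS.root
  | succ n ih =>
    have hl : (ply p m α n).length = n := (ply_play p m α n).1
    by_cases ht : turn p n
    · have := hm _ ih (by rw [hl]; exact ht)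
      have h2 : (p == decide (n % 2 = 0)) = true := by
        cases p <;> simp [turn] at ht ⊢ <;> exact ht
      simp only [ply, h2, cond_true]; exact this
    · exact hS.opp _ ih (by show ¬ turn p (ply p m α n).length; rw [hl]; exact ht) _ ⟨rfl, rfl⟩

/-- Borel determinacy, in the form of Lipschitz-type uniformization. -/
theorem borel_det {P : Set ((ℕ → ℕ) × (ℕ → ℕ))} (hP : MeasurableSet P) :
    (∃ g : (ℕ → ℕ) → (ℕ → ℕ), Continuous g ∧ ∀ α, (α, g α) ∈ P) ∨
    (∃ g : (ℕ → ℕ) → (ℕ → ℕ), Continuous g ∧ ∀ β, (g β, β) ∉ P) := by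
  let e : (ℕ → ℕ) → (ℕ → ℕ) × (ℕ → ℕ) := fun γ => (fun i => γ (2*i), fun i => γ (2*i+1))
  have he : Measurable e := by fun_prop
  have hcont : ∀ p m j, Continuous (fun α : ℕ → ℕ => fun i => brn (ply p m α) (2*i+j)) := by
    intro p m j
    refine continuous_pi fun i => ?_
    exact ((ply_loc p m (2*i+j+1)).comp List.headI).continuous
  rcases (unr_borel (he hP.compl)).det with ⟨S, hS, h⟩ | ⟨S, hS, h⟩
  · right
    obtain ⟨m, hm⟩ := exists_ply hS
    refine ⟨_, hcont true m 0, fun β => ?_⟩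
    have := h _ (ply_play true m β) (hm β)
    have h2 : e (brn (ply true m β)) = (fun i => brn (ply true m β) (2*i+0), β) := by
      refine Prod.ext rfl (funext fun i => ?_)
      simp only [e, brn, ply]
      have h3 : (2 * i + 1) % 2 = 1 := by omega
      have h4 : (2 * i + 1) / 2 = i := by omega
      simp [h3, h4]
    rw [← h2]; exact this
  · left
    obtain ⟨m, hm⟩ := exists_ply hS
    refine ⟨_, hcont false m 1, fun α => ?_⟩
    have := h _ (ply_play false m α) (hm α)
    have h2 : e (brn (ply false m α)) = (α, fun i => brn (ply false m α) (2*i+1)) := by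
      refine Prod.ext (funext fun i => ?_) rfl
      simp only [e, brn, ply]
      have h3 : (2 * i) % 2 = 0 := by omega
      have h4 : (2 * i) / 2 = i := by omega
      simp [h3, h4]
    rw [← h2]; exact not_not.1 this

end GT



namespace HS

open Topology Filter

/-- basic clopen neighborhoods -/
def Cy (x : Cantor) (n : ℕ) : Set Cantor := {y | ∀ i < n, y i = x i}

theorem mem_Cy_self (x : Cantor) (n : ℕ) : x ∈ Cy x n := fun _ _ => rfl

theorem isOpen_Cy (x : Cantor) (n : ℕ) : IsOpen (Cy x n) :=
  PiNat.isOpen_cylinder (fun _ => Bool) x n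

theorem Cy_eq {x y : Cantor} {n : ℕ} (h : y ∈ Cy x n) : Cy y n = Cy x n := by
  ext z
  exact ⟨fun hz i hi => (hz i hi).trans (h i hi), fun hz i hi => (hz i hi).trans (h i hi).symm⟩

theorem Cy_symm {x y : Cantor} {n : ℕ} (h : y ∈ Cy x n) : x ∈ Cy y n := fun i hi => (h i hi).symm

theorem Cy_anti (x : Cantor) {m n : ℕ} (h : m ≤ n) : Cy x n ⊆ Cy x m :=
  fun _ hy i hi => hy i (hi.trans_le h)

/-- a set which depends on finitely many coordinates is clopen -/
theorem isClopen_of_Cy {K : Set Cantor} {n : ℕ} (h : ∀ x y, y ∈ Cy x n → x ∈ K → y ∈ K) :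
    IsClopen K := by
  constructor
  · rw [← isOpen_compl_iff, isOpen_iff_mem_nhds]
    intro x hx
    filter_upwards [(isOpen_Cy x n).mem_nhds (mem_Cy_self x n)] with y hy hyK
    exact hx (h y x (Cy_symm hy) hyK)
  · rw [isOpen_iff_mem_nhds]
    intro x hx
    filter_upwards [(isOpen_Cy x n).mem_nhds (mem_Cy_self x n)] with y hy
    exact h x y hy hx

theorem isClopen_Cy (x : Cantor) (n : ℕ) : IsClopen (Cy x n) :=
  isClopen_of_Cy (n := n) (fun a b hb ha i hi => (hb i hi).trans (ha i hi))

theorem exists_Cy_subset {x : Cantor} {U : Set Cantor} (hU : U ∈ 𝓝 x) : ∃ n, Cy x n ⊆ U := by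
  obtain ⟨V, ⟨y, n, rfl⟩, hxV, hVU⟩ :=
    (PiNat.isTopologicalBasis_cylinders (fun _ => Bool)).mem_nhds_iff.1 hU
  refine ⟨n, fun z hz => hVU ?_⟩
  exact fun i hi => (hz i hi).trans (hxV i hi)

theorem nhds_Cy (x : Cantor) : (𝓝 x).HasBasis (fun _ : ℕ => True) (Cy x) :=
  ⟨fun U => ⟨fun h => by obtain ⟨n, hn⟩ := exists_Cy_subset h; exact ⟨n, trivial, hn⟩,
    fun ⟨n, _, hn⟩ => mem_of_superset ((isOpen_Cy x n).mem_nhds (mem_Cy_self x n)) hn⟩⟩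

/-- Reductions between pairs. -/
def Red (Z B Z' B' : Set Cantor) : Prop :=
  ∃ f : Cantor → Cantor, ContinuousOn f Z ∧ MapsTo f Z Z' ∧ ∀ x ∈ Z, (x ∈ B ↔ f x ∈ B')

theorem Red.refl (Z B : Set Cantor) : Red Z B Z B :=
  ⟨id, continuousOn_id, fun _ h => h, fun _ _ => Iff.rfl⟩

theorem Red.trans {Z B Z' B' Z'' B'' : Set Cantor} (h : Red Z B Z' B') (h' : Red Z' B' Z'' B'') :
    Red Z B Z'' B'' := by
  obtain ⟨f, hf, hfm, hfB⟩ := h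
  obtain ⟨g, hg, hgm, hgB⟩ := h'
  exact ⟨g ∘ f, hg.comp hf hfm, hgm.comp hfm, fun x hx => (hfB x hx).trans (hgB _ (hfm hx))⟩

theorem Red.sub {Z Z' : Set Cantor} (B : Set Cantor) (h : Z ⊆ Z') : Red Z B Z' B :=
  ⟨id, continuousOn_id, h, fun _ _ => Iff.rfl⟩

theorem Red.compl {Z B Z' B' : Set Cantor} (h : Red Z B Z' B') : Red Z Bᶜ Z' B'ᶜ := by
  obtain ⟨f, hf, hfm, hfB⟩ := h
  exact ⟨f, hf, hfm, fun x hx => not_congr (hfB x hx)⟩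

theorem Red.compl' {Z B Z' B' : Set Cantor} (h : Red Z Bᶜ Z' B') : Red Z B Z' B'ᶜ := by
  simpa using h.compl

theorem Red.of_compl {Z B Z' B' : Set Cantor} (h : Red Z Bᶜ Z' B'ᶜ) : Red Z B Z' B' := by
  simpa using h.compl

theorem Red.congr {Z B Z' B' C C' : Set Cantor} (h : Red Z B Z' B') (hC : ∀ x ∈ Z, x ∈ C ↔ x ∈ B)
    (hC' : ∀ x ∈ Z', x ∈ C' ↔ x ∈ B') : Red Z C Z' C' := by
  obtain ⟨f, hf, hfm, hfB⟩ := h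
  exact ⟨f, hf, hfm, fun x hx => by rw [hC x hx, hfB x hx, hC' _ (hfm hx)]⟩

/-- Polish parametrization. -/
theorem exists_param {Z : Set Cantor} (hZ : IsGδ Z) (hne : Z.Nonempty) :
    ∃ (ρ : (ℕ → ℕ) → Cantor) (s : Cantor → ℕ → ℕ), Continuous ρ ∧ (∀ α, ρ α ∈ Z) ∧
      ContinuousOn s Z ∧ ∀ z ∈ Z, ρ (s z) = z := by
  classical
  obtain ⟨O, hO, rfl⟩ := isGδ_iff_eq_iInter_nat.1 hZ
  let K : ℕ → ℕ → Set Cantor := fun n m => {x | Cy x m ⊆ O n}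
  have hK : ∀ n m, IsClopen (K n m) := fun n m => isClopen_of_Cy (n := m) (fun x y hy hx => by
    show Cy y m ⊆ O n
    rw [Cy_eq hy]; exact hx)
  let b : (ℕ → ℕ) → Cantor := fun γ n => decide ((Nat.unpair (γ n)).1 = 1)
  have hb : Continuous b := by
    refine continuous_pi fun n => ?_
    exact (continuous_of_discreteTopology (f := fun i : ℕ => decide ((Nat.unpair i).1 = 1))).comp
      (continuous_apply n)
  let E : Set (ℕ → ℕ) := {γ | ∀ n, ∀ m, (Nat.unpair (γ n)).2 = m → b γ ∈ K n m}
  have hE : IsClosed E := by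
    have : E = ⋂ n, ⋂ m, ({γ : ℕ → ℕ | (Nat.unpair (γ n)).2 = m}ᶜ ∪ b ⁻¹' (K n m)) := by
      ext γ
      simp only [E, mem_ofPred_eq, mem_iInter, mem_union, mem_compl_iff, mem_preimage, imp_iff_not_or]
    rw [this]
    refine isClosed_iInter fun n => isClosed_iInter fun m => IsClosed.union ?_ ((hK n m).1.preimage hb)
    rw [isClosed_compl_iff]
    exact (isOpen_discrete {i : ℕ | (Nat.unpair i).2 = m}).preimage (continuous_apply (A := fun _ : ℕ => ℕ) n)
  let s : Cantor → ℕ → ℕ := fun x n => Nat.pair (if x n then 1 else 0) (sInf {m | x ∈ K n m})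
  have hs : ∀ z ∈ ⋂ n, O n, ∀ n, z ∈ K n (sInf {m | z ∈ K n m}) := by
    intro z hz n
    have : {m | z ∈ K n m}.Nonempty := by
      obtain ⟨m, hm⟩ := exists_Cy_subset ((hO n).mem_nhds (mem_iInter.1 hz n))
      exact ⟨m, hm⟩
    exact Nat.sInf_mem this
  have hbs : ∀ z, b (s z) = z := by
    intro z
    funext n
    simp only [b, s, Nat.unpair_pair]
    cases z n <;> simp
  have hsE : ∀ z ∈ ⋂ n, O n, s z ∈ E := by
    intro z hz n m hm
    rw [hbs, ← hm]
    simp only [s, Nat.unpair_pair]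
    exact hs z hz n
  have hbE : ∀ γ ∈ E, b γ ∈ ⋂ n, O n := by
    intro γ hγ
    refine mem_iInter.2 fun n => ?_
    exact hγ n _ rfl (mem_Cy_self _ _)
  obtain ⟨z0, hz0⟩ := hne
  obtain ⟨r, hr1, hr2, hr3⟩ := PiNat.exists_retraction_of_isClosed hE ⟨_, hsE z0 hz0⟩
  refine ⟨fun α => b (r α), s, hb.comp hr3, fun α => hbE _ (hr2 ▸ mem_range_self α), ?_, fun z hz => ?_⟩
  · rw [continuousOn_pi]
    intro n z hz
    have h1 : (⋂ m ∈ Iio (sInf {m | z ∈ K n m}), (K n m)ᶜ) ∩ K n (sInf {m | z ∈ K n m}) ∩ Cy z (n+1) ∈ 𝓝 z := by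
      refine IsOpen.mem_nhds ?_ ⟨⟨?_, hs z hz n⟩, mem_Cy_self _ _⟩
      · refine IsOpen.inter (IsOpen.inter ?_ (hK _ _).2) (isOpen_Cy _ _)
        exact (finite_Iio _).isOpen_biInter fun m _ => (hK n m).1.isOpen_compl
      · refine mem_iInter₂.2 fun m hm => ?_
        exact Nat.notMem_of_lt_sInf hm
    have h2 : ∀ᶠ y in 𝓝[⋂ n, O n] z, s y n = s z n := by
      filter_upwards [mem_nhdsWithin_of_mem_nhds h1] with y hy
      simp only [s]
      rw [hy.2 n (by omega)]
      congr 1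
      apply le_antisymm
      · exact Nat.sInf_le hy.1.2
      · by_contra hlt
        push Not at hlt
        have h3 : y ∈ K n (sInf {m | y ∈ K n m}) := Nat.sInf_mem (s := {m | y ∈ K n m}) ⟨_, hy.1.2⟩
        exact mem_iInter₂.1 hy.1.1 _ hlt h3
    exact (continuousWithinAt_const (b := s z n)).congr_of_eventuallyEq h2 rfl
  · show b (r (s z)) = z
    rw [hr1 _ (hsE z hz), hbs]

/-- Wadge's lemma. -/
theorem wadge {Z B Z' B' : Set Cantor} (hZ : IsGδ Z) (hne : Z.Nonempty) (hZ' : IsGδ Z')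
    (hne' : Z'.Nonempty) (hB : MeasurableSet B) (hB' : MeasurableSet B') :
    Red Z B Z' B' ∨ Red Z' B'ᶜ Z B := by
  obtain ⟨ρ, s, hρ, hρZ, hs, hsρ⟩ := exists_param hZ hne
  obtain ⟨ρ', s', hρ', hρZ', hs', hsρ'⟩ := exists_param hZ' hne'
  have hP : MeasurableSet {p : (ℕ → ℕ) × (ℕ → ℕ) | ρ p.1 ∈ B ↔ ρ' p.2 ∈ B'} := by
    have h1 : MeasurableSet {p : (ℕ → ℕ) × (ℕ → ℕ) | ρ p.1 ∈ B} :=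
      (hρ.measurable.comp measurable_fst) hB
    have h2 : MeasurableSet {p : (ℕ → ℕ) × (ℕ → ℕ) | ρ' p.2 ∈ B'} :=
      (hρ'.measurable.comp measurable_snd) hB'
    exact h1.iff h2
  rcases GT.borel_det hP with ⟨g, hg, h⟩ | ⟨g, hg, h⟩
  · left
    refine ⟨fun x => ρ' (g (s x)), (hρ'.comp hg).comp_continuousOn hs, fun x _ => hρZ' _, fun x hx => ?_⟩
    have := h (s x)
    simp only [mem_ofPred_eq, hsρ x hx] at this
    exact this
  · right
    refine ⟨fun x => ρ (g (s' x)), (hρ.comp hg).comp_continuousOn hs', fun x _ => hρZ _, fun x hx => ?_⟩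
    have := h (s' x)
    simp only [mem_ofPred_eq, hsρ' x hx] at this
    rw [mem_compl_iff]; tauto

end HS



namespace HS

open Topology Filter

/-- flip of one bit -/
def flipAt (m : ℕ) (b : Cantor) : Cantor := Function.update b m (!b m)

theorem flipAt_flipAt (m : ℕ) (b : Cantor) : flipAt m (flipAt m b) = b := by
  funext i
  by_cases h : i = m
  · subst h; simp [flipAt]
  · simp [flipAt, Function.update_of_ne h]

theorem continuous_flipAt (m : ℕ) : Continuous (flipAt m) := by
  refine continuous_id.update m ?_
  exact (continuous_of_discreteTopology (f := not)).comp (continuous_apply m)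

def flipH (m : ℕ) : Cantor ≃ₜ Cantor where
  toFun := flipAt m
  invFun := flipAt m
  left_inv := flipAt_flipAt m
  right_inv := flipAt_flipAt m
  continuous_toFun := continuous_flipAt m
  continuous_invFun := continuous_flipAt m

/-- No Borel flip set. -/
theorem no_flip_set {M : Set Cantor} (hM : MeasurableSet M)
    (h : ∀ m b, b ∈ M ↔ flipAt m b ∉ M) : False := by
  obtain ⟨U, hU, hMU⟩ := hM.residualEq_isOpen
  have hflip : ∀ m, ∀ᶠ b in residual Cantor, (flipAt m b ∈ M ↔ flipAt m b ∈ U) := by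
    intro m
    have h1 := tendsto_residual_of_isOpenMap (continuous_flipAt m) (flipH m).isOpenMap
    have h2 : ∀ᶠ b in residual Cantor, (b ∈ M ↔ b ∈ U) := by
      filter_upwards [hMU] with b hb
      exact iff_of_eq hb
    exact h1.eventually h2
  have hM' : ∀ᶠ b in residual Cantor, (b ∈ M ↔ b ∈ U) := by
    filter_upwards [hMU] with b hb
    exact iff_of_eq hb
  rcases U.eq_empty_or_nonempty with rfl | ⟨u, hu⟩
  · obtain ⟨b, hb⟩ := (dense_of_mem_residual ((hflip 0).and hM')).nonempty
    rw [mem_ofPred_eq] at hb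
    have := h 0 b
    simp only [mem_empty_iff_false, iff_false] at hb
    tauto
  · obtain ⟨n, hn⟩ := exists_Cy_subset (hU.mem_nhds hu)
    obtain ⟨b, hbU, hb⟩ := (dense_of_mem_residual ((hflip n).and hM')).exists_mem_open (isOpen_Cy u n)
      ⟨u, mem_Cy_self u n⟩
    have h1 : flipAt n b ∈ Cy u n := by
      intro i hi
      rw [flipAt, Function.update_of_ne (by omega)]
      exact hb i hi
    have := h n b
    have h2 := hn hb
    have h3 := hn h1
    have := hbU.1; have := hbU.2
    tauto

structure MS (𝒵 : Set (Set Cantor)) where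
  Z : Set Cantor
  O : ℕ → Set Cantor
  L : List ((Cantor → Cantor) × (ℕ → Set Cantor))
  hZ : Z ∈ 𝒵
  hO : (⋂ j, O j) = Z
  hid : (id, O) ∈ L
  hL : ∀ p ∈ L, ContinuousOn p.1 Z ∧ (∀ j, IsOpen (p.2 j)) ∧ ∀ x ∈ Z, ∀ j, p.1 x ∈ p.2 j

theorem monk_step {X : Set Cantor} {𝒵 : Set (Set Cantor)}
    (hG : ∀ Z ∈ 𝒵, IsGδ Z ∧ Z.Nonempty)
    (hV : ∀ Z ∈ 𝒵, ∀ V, IsClopen V → (V ∩ Z).Nonempty → V ∩ Z ∈ 𝒵)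
    (hstep : ∀ Z ∈ 𝒵, ∃ Z' ∈ 𝒵, Red Z' X Z X ∧ Red Z' Xᶜ Z X) (n : ℕ) (s : MS 𝒵) :
    ∃ s' : MS 𝒵, ∃ h : Bool → Cantor → Cantor, (∀ b, ContinuousOn (h b) s'.Z) ∧
      (∀ b, MapsTo (h b) s'.Z s.Z) ∧ (∀ x ∈ s'.Z, (x ∈ X ↔ h false x ∈ X)) ∧
      (∀ x ∈ s'.Z, (x ∉ X ↔ h true x ∈ X)) ∧
      ∀ p ∈ s.L, ∀ b, (p.1 ∘ h b, p.2) ∈ s'.L ∧ ∃ d, n ≤ d ∧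
        ∀ x ∈ s'.Z, ∀ x' ∈ s'.Z, p.1 (h b x) ∈ Cy (p.1 (h b x')) d ∧
          ∀ j ≤ n, Cy (p.1 (h b x')) d ⊆ p.2 j := by
  obtain ⟨Z', hZ', ⟨f0, hf0, hm0, hX0⟩, ⟨f1, hf1, hm1, hX1⟩⟩ := hstep s.Z s.hZ
  let h : Bool → Cantor → Cantor := fun b => cond b f1 f0
  have hc : ∀ b, ContinuousOn (h b) Z' := fun b => by cases b <;> assumption
  have hm : ∀ b, MapsTo (h b) Z' s.Z := fun b => by cases b <;> assumption
  obtain ⟨q, hq⟩ := (hG Z' hZ').2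
  have hnb : ∀ p ∈ s.L, ∀ b, ∃ V, IsClopen V ∧ q ∈ V ∧ ∃ d, n ≤ d ∧
      ∀ x ∈ V ∩ Z', p.1 (h b x) ∈ Cy (p.1 (h b q)) d ∧
          ∀ j ≤ n, Cy (p.1 (h b q)) d ⊆ p.2 j := by
    intro p hp b
    obtain ⟨hp1, hp2, hp3⟩ := s.hL p hp
    have hcont : ContinuousOn (p.1 ∘ h b) Z' := hp1.comp (hc b) (hm b)
    have hopen : (⋂ j ∈ Iic n, p.2 j) ∈ 𝓝 (p.1 (h b q)) := by
      refine IsOpen.mem_nhds ((finite_Iic n).isOpen_biInter fun j _ => hp2 j) ?_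
      exact mem_iInter₂.2 fun j _ => hp3 _ (hm b hq) j
    obtain ⟨d, hd⟩ := exists_Cy_subset hopen
    have h1 : Cy (p.1 (h b q)) (max d n) ∈ 𝓝 (p.1 (h b q)) :=
      (isOpen_Cy _ _).mem_nhds (mem_Cy_self _ _)
    have h2 := hcont q hq h1
    rw [mem_map, mem_nhdsWithin_iff_exists_mem_nhds_inter] at h2
    obtain ⟨u, hu, hu'⟩ := h2
    obtain ⟨e, he⟩ := exists_Cy_subset hu
    refine ⟨Cy q e, isClopen_Cy _ _, mem_Cy_self _ _, max d n, le_max_right _ _, fun x hx => ⟨?_, ?_⟩⟩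
    · exact hu' ⟨he hx.1, hx.2⟩
    · intro j hj
      exact ((Cy_anti _ (le_max_left d n)).trans hd).trans (biInter_subset_of_mem hj)
  choose! V hVc hqV d hd hVd using hnb
  let W : Set Cantor := ⋂ p ∈ {p | p ∈ s.L}, V p false ∩ V p true
  have hW : IsClopen W := (List.finite_toSet s.L).isClopen_biInter
    (fun p hp => (hVc p hp false).inter (hVc p hp true))
  have hWV : ∀ p ∈ s.L, ∀ b, W ⊆ V p b := by
    intro p hp b x hx
    have := mem_iInter₂.1 hx p hp
    cases b
    · exact this.1
    · exact this.2
  have hqW : q ∈ W := mem_iInter₂.2 fun p hp => ⟨hqV p hp false, hqV p hp true⟩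
  have hWZ := hV Z' hZ' W hW ⟨q, hqW, hq⟩
  obtain ⟨O, hO, hOe⟩ := isGδ_iff_eq_iInter_nat.1 (hG _ hWZ).1
  refine ⟨⟨W ∩ Z', O, (id, O) :: (s.L.map (fun p => (p.1 ∘ h false, p.2)) ++
    s.L.map (fun p => (p.1 ∘ h true, p.2))), hWZ, hOe.symm, by simp, ?_⟩, h,
    fun b => (hc b).mono inter_subset_right, fun b x hx => hm b hx.2, fun x hx => hX0 x hx.2,
    fun x hx => hX1 x hx.2, ?_⟩
  · have : ∀ p ∈ s.L, ∀ b, ContinuousOn (p.1 ∘ h b) (W ∩ Z') ∧ (∀ j, IsOpen (p.2 j)) ∧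
        ∀ x ∈ W ∩ Z', ∀ j, p.1 (h b x) ∈ p.2 j := by
      intro p hp b
      obtain ⟨hp1, hp2, hp3⟩ := s.hL p hp
      exact ⟨(hp1.comp (hc b) (hm b)).mono inter_subset_right, hp2, fun x hx j => hp3 _ (hm b hx.2) j⟩
    intro p hp
    simp only [List.mem_cons, List.mem_append, List.mem_map] at hp
    rcases hp with rfl | ⟨p, hp, rfl⟩ | ⟨p, hp, rfl⟩
    · exact ⟨continuousOn_id, hO, fun x hx j => mem_iInter.1 (hOe ▸ hx) j⟩
    · exact this p hp false
    · exact this p hp true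
  · intro p hp b
    refine ⟨?_, d p b, hd p hp b, fun x hx x' hx' => ?_⟩
    · simp only [List.mem_cons, List.mem_append, List.mem_map]
      right
      cases b
      · left; exact ⟨p, hp, rfl⟩
      · right; exact ⟨p, hp, rfl⟩
    · obtain ⟨h1, -⟩ := hVd p hp b x ⟨hWV p hp b hx.1, hx.2⟩
      obtain ⟨h3, h4⟩ := hVd p hp b x' ⟨hWV p hp b hx'.1, hx'.2⟩
      rw [Cy_eq h3]
      exact ⟨h1, h4⟩

/-- compositions -/
def cmp (h : ℕ → Bool → Cantor → Cantor) (b : Cantor) (m : ℕ) : ℕ → Cantor → Cantor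
  | 0 => id
  | k+1 => cmp h b m k ∘ h (m+k) (b (m+k))

theorem cmp_succ (h : ℕ → Bool → Cantor → Cantor) (b : Cantor) (m k : ℕ) :
    cmp h b m (k+1) = h m (b m) ∘ cmp h b (m+1) k := by
  induction k with
  | zero => rfl
  | succ k ih =>
    rw [cmp, ih, cmp, show m + (k+1) = m + 1 + k by omega]; rfl

theorem cmp_congr (h : ℕ → Bool → Cantor → Cantor) {b b' : Cantor} {m k : ℕ}
    (hb : ∀ i, m ≤ i → i < m + k → b i = b' i) : cmp h b m k = cmp h b' m k := by
  induction k with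
  | zero => rfl
  | succ k ih =>
    rw [cmp, cmp, ih (fun i h1 h2 => hb i h1 (by omega)), hb (m+k) (by omega) (by omega)]

theorem monk {X : Set Cantor} (hX : MeasurableSet X) {𝒵 : Set (Set Cantor)}
    (hG : ∀ Z ∈ 𝒵, IsGδ Z ∧ Z.Nonempty)
    (hV : ∀ Z ∈ 𝒵, ∀ V, IsClopen V → (V ∩ Z).Nonempty → V ∩ Z ∈ 𝒵)
    (hstep : ∀ Z ∈ 𝒵, ∃ Z' ∈ 𝒵, Red Z' X Z X ∧ Red Z' Xᶜ Z X) {Z0 : Set Cantor} (hZ0 : Z0 ∈ 𝒵) :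
    False := by
  choose N h hc hm hX0 hX1 hL using monk_step hG hV hstep
  obtain ⟨O0, hO0, hO0e⟩ := isGδ_iff_eq_iInter_nat.1 (hG _ hZ0).1
  let s0 : MS 𝒵 := ⟨Z0, O0, [(id, O0)], hZ0, hO0e.symm, by simp, by
    intro p hp
    simp only [List.mem_singleton] at hp
    subst hp
    exact ⟨continuousOn_id, hO0, fun x hx j => mem_iInter.1 (hO0e ▸ hx) j⟩⟩
  let s : ℕ → MS 𝒵 := fun n => Nat.rec s0 (fun n r => N n r) n
  have hs : ∀ n, s (n+1) = N n (s n) := fun n => rfl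
  let H : ℕ → Bool → Cantor → Cantor := fun n => h n (s n)
  have Hc : ∀ n b, ContinuousOn (H n b) (s (n+1)).Z := fun n b => hc n (s n) b
  have Hm : ∀ n b, MapsTo (H n b) (s (n+1)).Z (s n).Z := fun n b => hm n (s n) b
  have HX : ∀ n b, ∀ x ∈ (s (n+1)).Z, (H n b x ∈ X ↔ (x ∈ X ↔ b = false)) := by
    intro n b x hx
    cases b
    · simpa using (hX0 n (s n) x hx).symm
    · simpa using (hX1 n (s n) x hx).symm
  have HL : ∀ b m k, (cmp H b m k, (s m).O) ∈ (s (m+k)).L := by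
    intro b m k
    induction k with
    | zero => exact (s m).hid
    | succ k ih => exact (hL (m+k) (s (m+k)) _ ih (b (m+k))).1
  have Hd : ∀ b m k, ∃ d, m + k ≤ d ∧ ∀ x ∈ (s (m+(k+1))).Z, ∀ x' ∈ (s (m+(k+1))).Z,
      cmp H b m (k+1) x ∈ Cy (cmp H b m (k+1) x') d ∧ ∀ j ≤ m + k, Cy (cmp H b m (k+1) x') d ⊆ (s m).O j :=
    fun b m k => (hL (m+k) (s (m+k)) _ (HL b m k) (b (m+k))).2
  choose P hP using fun n => (hG _ (s n).hZ).2
  let q : Cantor → ℕ → ℕ → Cantor := fun b m k => cmp H b m k (P (m+k))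
  have hback : ∀ b m k k', k ≤ k' → ∀ x ∈ (s (m+k')).Z, ∃ r ∈ (s (m+k)).Z, cmp H b m k' x = cmp H b m k r := by
    intro b m k k' hk
    induction k', hk using Nat.le_induction with
    | base => exact fun x hx => ⟨x, hx, rfl⟩
    | succ k' hk ih =>
      intro x hx
      exact ih _ (Hm (m+k') (b (m+k')) hx)
  have hmaps : ∀ b m k, ∀ x ∈ (s (m+k)).Z, cmp H b m k x ∈ (s m).Z := by
    intro b m k x hx
    obtain ⟨r, hr, hr'⟩ := hback b m 0 k (Nat.zero_le _) x hx
    rw [hr']; exact hr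
  have hqd : ∀ b m k, ∃ d, m + k ≤ d ∧ (∀ k' ≥ k + 1, q b m k' ∈ Cy (q b m (k+1)) d) ∧
      ∀ j ≤ m + k, Cy (q b m (k+1)) d ⊆ (s m).O j := by
    intro b m k
    obtain ⟨d, hd, hd'⟩ := Hd b m k
    refine ⟨d, hd, fun k' hk' => ?_, (hd' _ (hP (m+(k+1))) _ (hP (m+(k+1)))).2⟩
    obtain ⟨r, hr, hr'⟩ := hback b m (k+1) k' hk' _ (hP (m+k'))
    show cmp H b m k' _ ∈ _
    rw [hr']
    exact (hd' r hr _ (hP (m+(k+1)))).1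
  let y : Cantor → ℕ → Cantor := fun b m i => q b m (i+2) i
  have hyq : ∀ b m i k, i + 2 ≤ k → q b m k i = y b m i := by
    intro b m i k hk
    obtain ⟨d, hd, hd', -⟩ := hqd b m (i+1)
    exact hd' k hk i (by omega)
  have hylim : ∀ b m, Tendsto (q b m) atTop (𝓝 (y b m)) := by
    intro b m
    rw [tendsto_pi_nhds]
    intro i
    refine tendsto_const_nhds.congr' ?_
    filter_upwards [eventually_ge_atTop (i+2)] with k hk
    exact (hyq b m i k hk).symm
  have hyZ : ∀ b m, y b m ∈ (s m).Z := by
    intro b m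
    rw [← (s m).hO]
    refine mem_iInter.2 fun j => ?_
    obtain ⟨d, hd, hd1, hd2⟩ := hqd b m j
    apply hd2 j (by omega)
    intro i hi
    rw [← hyq b m i (max (i+2) (j+1)) (le_max_left _ _)]
    exact hd1 _ (le_max_right _ _) i hi
  have hyH : ∀ b m, H m (b m) (y b (m+1)) = y b m := by
    intro b m
    have h1 : Tendsto (fun k => q b m (k+1)) atTop (𝓝 (y b m)) := (hylim b m).comp (tendsto_add_atTop_nat 1)
    have h2 : ∀ k, q b m (k+1) = H m (b m) (q b (m+1) k) := by
      intro k
      show cmp H b m (k+1) (P (m+(k+1))) = H m (b m) (cmp H b (m+1) k (P (m+1+k)))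
      rw [cmp_succ, show m + (k+1) = m + 1 + k by omega]; rfl
    have h3 : Tendsto (fun k => H m (b m) (q b (m+1) k)) atTop (𝓝 (H m (b m) (y b (m+1)))) := by
      have := Hc m (b m) _ (hyZ b (m+1))
      refine this.tendsto.comp ?_
      refine tendsto_nhdsWithin_iff.2 ⟨hylim b (m+1), Eventually.of_forall fun k => ?_⟩
      exact hmaps b (m+1) k _ (hP _)
    simp only [h2] at h1
    exact tendsto_nhds_unique h3 h1
  have hycongr : ∀ b b' m, (∀ i ≥ m, b i = b' i) → y b m = y b' m := by
    intro b b' m hb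
    funext i
    show cmp H b m (i+2) _ i = cmp H b' m (i+2) _ i
    rw [cmp_congr H (fun i h1 _ => hb i h1)]
  have hycont : Continuous (fun b => y b 0) := by
    refine continuous_pi fun i => ?_
    rw [continuous_iff_continuousAt]
    intro b
    refine (continuousAt_const (y := y b 0 i)).congr ?_
    filter_upwards [(isOpen_Cy b (i+2)).mem_nhds (mem_Cy_self _ _)] with b' hb'
    show cmp H b 0 (i+2) _ i = cmp H b' 0 (i+2) _ i
    rw [cmp_congr H (fun j _ h2 => (hb' j (by omega)).symm)]
  refine no_flip_set (hycont.measurable hX) fun m b => ?_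
  have key : ∀ i ≤ m, (y b i ∈ X ↔ y (flipAt m b) i ∉ X) := by
    intro i hi
    induction hi using Nat.decreasingInduction with
    | self =>
      rw [← hyH b m, ← hyH (flipAt m b) m, hycongr (flipAt m b) b (m+1), HX m _ _ (hyZ _ (m+1)),
        HX m _ _ (hyZ _ (m+1))]
      · simp only [flipAt, Function.update_self]
        cases b m <;> simp
      · intro i hi
        rw [flipAt, Function.update_of_ne (by omega)]
    | of_succ i hi ih =>
      rw [← hyH b i, ← hyH (flipAt m b) i, HX i _ _ (hyZ _ (i+1)), HX i _ _ (hyZ _ (i+1)), ih,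
        flipAt, Function.update_of_ne (by omega)]
      tauto
  exact key 0 (Nat.zero_le _)

end HS



namespace HS

open Topology Filter

/-! ### Fσ sets -/

theorem IsFs.closed {F : Set Cantor} (h : IsClosed F) : IsFsigma F :=
  ⟨fun _ => F, fun _ => h, (iUnion_const F).symm⟩

theorem IsFs.iUnion {F : ℕ → Set Cantor} (h : ∀ n, IsFsigma (F n)) : IsFsigma (⋃ n, F n) := by
  choose C hC hF using h
  refine ⟨fun k => C k.unpair.1 k.unpair.2, fun k => hC _ _, ?_⟩
  ext x
  simp only [mem_iUnion]
  constructor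
  · rintro ⟨n, hn⟩
    rw [hF n] at hn
    obtain ⟨m, hm⟩ := mem_iUnion.1 hn
    exact ⟨Nat.pair n m, by simpa using hm⟩
  · rintro ⟨k, hk⟩
    exact ⟨k.unpair.1, by rw [hF]; exact mem_iUnion.2 ⟨_, hk⟩⟩

theorem IsFs.union {F F' : Set Cantor} (h : IsFsigma F) (h' : IsFsigma F') : IsFsigma (F ∪ F') := by
  have : F ∪ F' = ⋃ n : ℕ, (if n = 0 then F else F') := by
    ext x
    simp only [mem_union, mem_iUnion]
    constructor
    · rintro (h | h)
      · exact ⟨0, by simpa using h⟩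
      · exact ⟨1, by simpa using h⟩
    · rintro ⟨n, hn⟩
      split_ifs at hn
      · exact Or.inl hn
      · exact Or.inr hn
  rw [this]
  exact IsFs.iUnion fun n => by split_ifs <;> assumption

theorem IsFs.inter {F F' : Set Cantor} (h : IsFsigma F) (h' : IsFsigma F') : IsFsigma (F ∩ F') := by
  obtain ⟨C, hC, rfl⟩ := h
  obtain ⟨C', hC', rfl⟩ := h'
  rw [iUnion_inter_iUnion]
  refine ⟨fun k => C k.unpair.1 ∩ C' k.unpair.2, fun k => (hC _).inter (hC' _), ?_⟩
  ext x
  simp only [mem_iUnion, Prod.exists]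
  constructor
  · rintro ⟨n, m, h⟩
    exact ⟨Nat.pair n m, by simpa using h⟩
  · rintro ⟨k, hk⟩
    exact ⟨_, _, hk⟩

theorem IsFs.isGδ_compl {F : Set Cantor} (h : IsFsigma F) : IsGδ Fᶜ := by
  obtain ⟨C, hC, rfl⟩ := h
  rw [compl_iUnion]
  exact IsGδ.iInter_of_isOpen fun n => (hC n).isOpen_compl

theorem IsFs.of_isGδ {Z : Set Cantor} (h : IsGδ Z) : IsFsigma Zᶜ := by
  obtain ⟨O, hO, rfl⟩ := isGδ_iff_eq_iInter_nat.1 h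
  exact ⟨fun n => (O n)ᶜ, fun n => (hO n).isClosed_compl, by rw [compl_iInter]⟩

theorem IsFs.open {U : Set Cantor} (h : IsOpen U) : IsFsigma U := by
  have := IsFs.of_isGδ h.isClosed_compl.isGδ
  rwa [compl_compl] at this

theorem IsFs.empty : IsFsigma ∅ := IsFs.closed isClosed_empty

theorem IsFs.meas {F : Set Cantor} (h : IsFsigma F) : MeasurableSet F := by
  obtain ⟨C, hC, rfl⟩ := h
  exact MeasurableSet.iUnion fun n => (hC n).measurableSet

theorem gdiff {Z F : Set Cantor} (hZ : IsGδ Z) (h : IsFsigma F) : IsGδ (Z \ F) :=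
  hZ.inter (IsFs.isGδ_compl h)

theorem clopen_gd {V Z : Set Cantor} (hV : IsClopen V) (hZ : IsGδ Z) : IsGδ (V ∩ Z) :=
  hV.2.isGδ.inter hZ

/-- pulling back closed sets -/
theorem pull_closed {f : Cantor → Cantor} {Z F : Set Cantor} (hf : ContinuousOn f Z) (hF : IsClosed F) :
    ∃ F', IsClosed F' ∧ ∀ x ∈ Z, (x ∈ F' ↔ f x ∈ F) := by
  obtain ⟨u, hu, hu'⟩ := continuousOn_iff_isClosed.1 hf F hF
  refine ⟨u, hu, fun x hx => ?_⟩
  have := congrArg (fun s => x ∈ s) hu'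
  simp only [mem_inter_iff, hx, and_true, mem_preimage, eq_iff_iff] at this
  exact this.symm

theorem pull_fs {f : Cantor → Cantor} {Z F : Set Cantor} (hf : ContinuousOn f Z) (hF : IsFsigma F) :
    ∃ F', IsFsigma F' ∧ ∀ x ∈ Z, (x ∈ F' ↔ f x ∈ F) := by
  obtain ⟨C, hC, rfl⟩ := hF
  choose C' hC' h using fun n => pull_closed hf (hC n)
  exact ⟨⋃ n, C' n, ⟨C', hC', rfl⟩, fun x hx => by simp only [mem_iUnion, h _ x hx]⟩

/-! ### Decomposition into Fσ and a rest -/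

def StarDec (Z B Z' B' : Set Cantor) : Prop :=
  ∃ F0 F1, IsFsigma F0 ∧ IsFsigma F1 ∧ (∀ x ∈ Z, x ∈ F0 → x ∉ B) ∧ (∀ x ∈ Z, x ∈ F1 → x ∈ B) ∧
    Red (Z \ (F0 ∪ F1)) B Z' B'

def DD : ℕ → Set Cantor → Set Cantor → Prop
  | 0, Z, B => (∀ x ∈ Z, x ∈ B) ∨ (∀ x ∈ Z, x ∉ B)
  | n+1, Z, B => ∃ F0 F1, IsFsigma F0 ∧ IsFsigma F1 ∧ (∀ x ∈ Z, x ∈ F0 → x ∉ B) ∧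
      (∀ x ∈ Z, x ∈ F1 → x ∈ B) ∧ DD n (Z \ (F0 ∪ F1)) B

theorem Red.of_empty (B Z' B' : Set Cantor) : Red ∅ B Z' B' :=
  ⟨id, continuousOn_id, fun _ h => h.elim, fun _ h => h.elim⟩

theorem Red.const {Z B Z' B' : Set Cantor} {z : Cantor} (hz : z ∈ Z') (h : ∀ x ∈ Z, (x ∈ B ↔ z ∈ B')) :
    Red Z B Z' B' := ⟨fun _ => z, continuousOn_const, fun _ _ => hz, h⟩

theorem Red.restrict {Z B B' W W' : Set Cantor} {f : Cantor → Cantor} (hf : ContinuousOn f Z)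
    (hB : ∀ x ∈ Z, (x ∈ B ↔ f x ∈ B')) (hW : W ⊆ Z) (hW' : ∀ x ∈ W, f x ∈ W') : Red W B W' B' :=
  ⟨f, hf.mono hW, hW', fun x hx => hB x (hW hx)⟩

theorem StarDec.of_red {Z B Z' B' : Set Cantor} (h : Red Z B Z' B') : StarDec Z B Z' B' :=
  ⟨∅, ∅, IsFs.empty, IsFs.empty, by simp, by simp, (Red.sub B diff_subset).trans h⟩

theorem StarDec.pull {Z B Z' B' Z'' B'' : Set Cantor} (h : Red Z B Z' B') (h' : StarDec Z' B' Z'' B'') :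
    StarDec Z B Z'' B'' := by
  obtain ⟨f, hf, hfm, hfB⟩ := h
  obtain ⟨F0, F1, h0, h1, hF0, hF1, hR⟩ := h'
  obtain ⟨G0, hG0, hG0'⟩ := pull_fs hf h0
  obtain ⟨G1, hG1, hG1'⟩ := pull_fs hf h1
  refine ⟨G0, G1, hG0, hG1, fun x hx hxG => ?_, fun x hx hxG => ?_, Red.trans ?_ hR⟩
  · rw [hfB x hx]; exact hF0 _ (hfm hx) ((hG0' x hx).1 hxG)
  · rw [hfB x hx]; exact hF1 _ (hfm hx) ((hG1' x hx).1 hxG)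
  · refine Red.restrict hf hfB diff_subset fun x hx => ⟨hfm hx.1, ?_⟩
    have := hx.2
    simp only [mem_union, hG0' x hx.1, hG1' x hx.1] at this ⊢
    exact this

theorem StarDec.push {Z B Z' B' Z'' B'' : Set Cantor} (h : StarDec Z B Z' B') (h' : Red Z' B' Z'' B'') :
    StarDec Z B Z'' B'' := by
  obtain ⟨F0, F1, h0, h1, hF0, hF1, hR⟩ := h
  exact ⟨F0, F1, h0, h1, hF0, hF1, hR.trans h'⟩

theorem StarDec.compl {Z B Z' B' : Set Cantor} (h : StarDec Z B Z' B') : StarDec Z Bᶜ Z' B'ᶜ := by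
  obtain ⟨F0, F1, h0, h1, hF0, hF1, hR⟩ := h
  exact ⟨F1, F0, h1, h0, fun x hx hxF => not_not.2 (hF1 x hx hxF), hF0, by
    rw [union_comm]; exact hR.compl⟩

theorem DD.pull {n : ℕ} {Z B Z' B' : Set Cantor} (h : Red Z B Z' B') (h' : DD n Z' B') : DD n Z B := by
  induction n generalizing Z Z' with
  | zero =>
    obtain ⟨f, hf, hfm, hfB⟩ := h
    rcases h' with h' | h'
    · exact Or.inl fun x hx => (hfB x hx).2 (h' _ (hfm hx))
    · exact Or.inr fun x hx => fun hb => h' _ (hfm hx) ((hfB x hx).1 hb)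
  | succ n ih =>
    obtain ⟨F0, F1, h0, h1, hF0, hF1, hR⟩ := h'
    have h2 : StarDec Z' B' (Z' \ (F0 ∪ F1)) B' := ⟨F0, F1, h0, h1, hF0, hF1, Red.refl _ _⟩
    obtain ⟨G0, G1, g0, g1, hG0, hG1, hR'⟩ := StarDec.pull h h2
    exact ⟨G0, G1, g0, g1, hG0, hG1, ih hR' hR⟩

theorem DD.of_starDec {n : ℕ} {Z B Z' B' : Set Cantor} (h : StarDec Z B Z' B') (h' : DD n Z' B') :
    DD (n+1) Z B := by
  obtain ⟨F0, F1, h0, h1, hF0, hF1, hR⟩ := h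
  exact ⟨F0, F1, h0, h1, hF0, hF1, DD.pull hR h'⟩

theorem DD.compl {n : ℕ} {Z B : Set Cantor} (h : DD n Z B) : DD n Z Bᶜ := by
  induction n generalizing Z with
  | zero =>
    rcases h with h | h
    · exact Or.inr fun x hx => not_not.2 (h x hx)
    · exact Or.inl h
  | succ n ih =>
    obtain ⟨F0, F1, h0, h1, hF0, hF1, hR⟩ := h
    exact ⟨F1, F0, h1, h0, fun x hx hxF => not_not.2 (hF1 x hx hxF), hF0, by
      rw [union_comm]; exact ih hR⟩

/-! ### Uniform sets -/

structure Unif (X K : Set Cantor) : Prop where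
  gd : IsGδ K
  ne : K.Nonempty
  red : ∀ V, IsClopen V → (V ∩ K).Nonempty → Red K X (V ∩ K) X

theorem Unif.shrink {X K V : Set Cantor} (h : Unif X K) (hV : IsClopen V) (hne : (V ∩ K).Nonempty) :
    Unif X (V ∩ K) where
  gd := clopen_gd hV h.gd
  ne := hne
  red := fun W hW hWne => (Red.sub X inter_subset_right).trans (by
    rw [← inter_assoc] at hWne ⊢
    exact h.red _ (hW.inter hV) hWne)

theorem Unif.compl {X K : Set Cantor} (h : Unif X K) : Unif Xᶜ K :=
  ⟨h.gd, h.ne, fun V hV hne => (h.red V hV hne).compl⟩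

theorem Unif.not_self_dual {X K : Set Cantor} (hX : MeasurableSet X) (h : Unif X K) :
    ¬ Red K Xᶜ K X := by
  intro hr
  refine monk hX (𝒵 := {Z | ∃ V, IsClopen V ∧ Z = V ∩ K ∧ Z.Nonempty}) ?_ ?_ ?_
    (Z0 := K) ⟨univ, isClopen_univ, by simp, h.ne⟩
  · rintro _ ⟨V, hV, rfl, hne⟩
    exact ⟨clopen_gd hV h.gd, hne⟩
  · rintro _ ⟨V, hV, rfl, hne⟩ W hW hWne
    exact ⟨W ∩ V, hW.inter hV, by rw [inter_assoc], hWne⟩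
  · rintro _ ⟨V, hV, rfl, hne⟩
    refine ⟨V ∩ K, ⟨V, hV, rfl, hne⟩, Red.refl _ _, ?_⟩
    exact (Red.sub _ inter_subset_right).trans (hr.trans (h.red V hV hne))

theorem exists_unif {X K : Set Cantor} (hX : MeasurableSet X) (hK : IsGδ K) (hne : K.Nonempty) :
    ∃ V, IsClopen V ∧ Unif X (V ∩ K) := by
  by_contra hcon
  push Not at hcon
  refine monk hX (𝒵 := {Z | ∃ V, IsClopen V ∧ Z = V ∩ K ∧ Z.Nonempty}) ?_ ?_ ?_
    (Z0 := K) ⟨univ, isClopen_univ, by simp, hne⟩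
  · rintro _ ⟨V, hV, rfl, hne⟩
    exact ⟨clopen_gd hV hK, hne⟩
  · rintro _ ⟨V, hV, rfl, hne⟩ W hW hWne
    exact ⟨W ∩ V, hW.inter hV, by rw [inter_assoc], hWne⟩
  · rintro _ ⟨V, hV, rfl, hne⟩
    have h1 : ∃ W, IsClopen W ∧ (W ∩ (V ∩ K)).Nonempty ∧ ¬ Red (V ∩ K) X (W ∩ (V ∩ K)) X := by
      by_contra hc
      push Not at hc
      exact hcon V hV ⟨clopen_gd hV hK, hne, hc⟩
    obtain ⟨W, hW, hWne, hWr⟩ := h1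
    refine ⟨W ∩ (V ∩ K), ⟨W ∩ V, hW.inter hV, by rw [inter_assoc], hWne⟩, Red.sub _ inter_subset_right, ?_⟩
    exact (wadge (clopen_gd hV hK) hne (clopen_gd hW (clopen_gd hV hK)) hWne hX hX).resolve_left hWr

/-! ### Absorption -/

def Abs (X K : Set Cantor) : Prop :=
  ∀ Z B, IsGδ Z → MeasurableSet B → StarDec Z B K X → Red Z B K X

theorem Abs.compl {X K : Set Cantor} (h : Abs X K) : Abs Xᶜ K := by
  intro Z B hZ hB hs
  have := h Z Bᶜ hZ hB.compl (by simpa using hs.compl)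
  exact Red.compl' this

theorem Abs.of_equiv {X K K' : Set Cantor} (h : Abs X K) (h1 : Red K X K' X) (h2 : Red K' X K X) :
    Abs X K' := fun Z B hZ hB hs => (h Z B hZ hB (hs.push h2)).trans h1

/-- If not reducible then the complement is. -/
theorem wadge' {X K Z B : Set Cantor} (hX : MeasurableSet X) (hK : IsGδ K) (hne : K.Nonempty)
    (hZ : IsGδ Z) (hB : MeasurableSet B) (h : ¬ Red Z B K X) : Red K Xᶜ Z B := by
  rcases Z.eq_empty_or_nonempty with rfl | hZne
  · exact absurd (Red.of_empty _ _ _) h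
  · exact (wadge hZ hZne hK hne hB hX).resolve_left h

theorem abs_or_dd {X K : Set Cantor} (hX : MeasurableSet X) (hK : Unif X K) (hdd : ∀ n, ¬ DD n K X) :
    Abs X K := by
  by_contra habs
  refine monk hX (𝒵 := {Z | Unif X Z ∧ ¬ Abs X Z ∧ ∀ n, ¬ DD n Z X}) ?_ ?_ ?_
    (Z0 := K) ⟨hK, habs, hdd⟩
  · rintro Z ⟨h, -⟩
    exact ⟨h.gd, h.ne⟩
  · rintro Z ⟨h, h1, h2⟩ V hV hne
    refine ⟨h.shrink hV hne, fun h3 => h1 (h3.of_equiv (Red.sub _ inter_subset_right) (h.red V hV hne)),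
      fun n h3 => h2 n (DD.pull (h.red V hV hne) h3)⟩
  · rintro K ⟨hK, habs, hdd⟩
    unfold Abs at habs
    push Not at habs
    obtain ⟨Z, B, hZ, hB, hs, hr⟩ := habs
    have h1 := wadge' hX hK.gd hK.ne hZ hB hr
    obtain ⟨F0, F1, h0, h1, hF0, hF1, hR⟩ := StarDec.pull h1 hs
    have hRg : IsGδ (K \ (F0 ∪ F1)) := gdiff hK.gd (IsFs.union h0 h1)
    have hRne : (K \ (F0 ∪ F1)).Nonempty := by
      rw [nonempty_iff_ne_empty]
      intro he
      refine hdd 1 ⟨F1, F0, h1, h0, hF1, fun x hx hxF => not_not.1 (hF0 x hx hxF), Or.inl ?_⟩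
      rw [union_comm, he]; simp
    obtain ⟨V, hV, hVR⟩ := exists_unif hX hRg hRne
    have hVK : (V ∩ K).Nonempty := hVR.ne.mono (inter_subset_inter_right _ diff_subset)
    have hsd : StarDec (V ∩ K) X (V ∩ (K \ (F0 ∪ F1))) X := by
      refine ⟨F1, F0, h1, h0, fun x hx => hF1 x hx.2, fun x hx hxF => not_not.1 (hF0 x hx.2 hxF), ?_⟩
      rw [union_comm, inter_sdiff_assoc]
      exact Red.refl _ _
    have hflip : Red (V ∩ (K \ (F0 ∪ F1))) Xᶜ K X := (Red.sub _ inter_subset_right).trans hR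
    refine ⟨V ∩ (K \ (F0 ∪ F1)), ⟨hVR, fun h3 => ?_, fun n h3 => ?_⟩,
      Red.sub _ (inter_subset_right.trans diff_subset), hflip⟩
    · have h4 := (hK.red V hV hVK).trans (h3 _ _ (clopen_gd hV hK.gd) hX hsd)
      exact hK.not_self_dual hX (h4.compl.trans hflip)
    · exact hdd (n+1) (DD.pull (hK.red V hV hVK) (DD.of_starDec hsd h3))

end HS



namespace HS

open Topology Filter

/-! ### Upward closed tail sets and their combinators -/

structure Sfl (S : Set Cantor) : Prop where
  up : UpwardClosed S
  fm : ClosedUnderFinMod S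
  ms : MeasurableSet S

def row (n : ℕ) (z : Cantor) : Cantor := fun i => z (Nat.pair n i)

def tup (w : ℕ → Cantor) : Cantor := fun k => w k.unpair.1 k.unpair.2

@[simp] theorem row_tup (w : ℕ → Cantor) (n : ℕ) : row n (tup w) = w n := by
  ext i; simp [row, tup]

theorem continuous_row (n : ℕ) : Continuous (row n) :=
  continuous_pi fun i => continuous_apply _

theorem continuousOn_tup {Z : Set Cantor} {f : ℕ → Cantor → Cantor} (h : ∀ n, ContinuousOn (f n) Z) :
    ContinuousOn (fun x => tup (fun n => f n x)) Z := by
  rw [continuousOn_pi]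
  intro k
  exact (continuous_apply (A := fun _ : ℕ => Bool) _).comp_continuousOn (h _)

theorem isOpenMap_row (n : ℕ) : IsOpenMap (row n) := by
  intro U hU
  rw [isOpen_iff_mem_nhds]
  rintro _ ⟨z, hz, rfl⟩
  -- section through z
  let s : Cantor → Cantor := fun y k => if k.unpair.1 = n then y k.unpair.2 else z k
  have hs : Continuous s := by
    refine continuous_pi fun k => ?_
    by_cases hk : k.unpair.1 = n
    · simpa [s, hk] using continuous_apply (A := fun _ : ℕ => Bool) _
    · simpa [s, hk] using continuous_const
  have hsz : s (row n z) = z := by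
    ext k
    by_cases hk : k.unpair.1 = n
    · simp only [s, hk, if_true, row]
      rw [← hk, Nat.pair_unpair]
    · simp [s, hk]
  have hrs : ∀ y, row n (s y) = y := by
    intro y; ext i; simp [s, row]
  have : s ⁻¹' U ∈ 𝓝 (row n z) := hs.continuousAt.preimage_mem_nhds (by rw [hsz]; exact hU.mem_nhds hz)
  filter_upwards [this] with y hy
  exact ⟨s y, hy, hrs y⟩

theorem IsFs.preimage {f : Cantor → Cantor} (hf : Continuous f) {F : Set Cantor} (h : IsFsigma F) :
    IsFsigma (f ⁻¹' F) := by
  obtain ⟨C, hC, rfl⟩ := h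
  exact ⟨fun n => f ⁻¹' C n, fun n => (hC n).preimage hf, preimage_iUnion⟩

theorem Sfl.row {S : Set Cantor} (h : Sfl S) (n : ℕ) : Sfl (row n ⁻¹' S) where
  up := fun x hx y hxy => h.up _ hx _ fun i hi => hxy _ hi
  fm := fun x hx y hxy => h.fm _ hx _ (by
    have := hxy.preimage (f := Nat.pair n) (fun a _ b _ hab => by simpa using hab)
    exact this)
  ms := (continuous_row n).measurable h.ms

theorem Sfl.inter {S T : Set Cantor} (h : Sfl S) (h' : Sfl T) : Sfl (S ∩ T) where
  up := fun x hx y hxy => ⟨h.up _ hx.1 _ hxy, h'.up _ hx.2 _ hxy⟩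
  fm := fun x hx y hxy => ⟨h.fm _ hx.1 _ hxy, h'.fm _ hx.2 _ hxy⟩
  ms := h.ms.inter h'.ms

theorem Sfl.union {S T : Set Cantor} (h : Sfl S) (h' : Sfl T) : Sfl (S ∪ T) where
  up := fun x hx y hxy => hx.imp (fun hx => h.up _ hx _ hxy) (fun hx => h'.up _ hx _ hxy)
  fm := fun x hx y hxy => hx.imp (fun hx => h.fm _ hx _ hxy) (fun hx => h'.fm _ hx _ hxy)
  ms := h.ms.union h'.ms

theorem Sfl.iUnion {ι : Type} [Countable ι] {S : ι → Set Cantor} (h : ∀ n, Sfl (S n)) : Sfl (⋃ n, S n) where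
  up := fun x hx y hxy => by
    obtain ⟨n, hn⟩ := mem_iUnion.1 hx
    exact mem_iUnion.2 ⟨n, (h n).up _ hn _ hxy⟩
  fm := fun x hx y hxy => by
    obtain ⟨n, hn⟩ := mem_iUnion.1 hx
    exact mem_iUnion.2 ⟨n, (h n).fm _ hn _ hxy⟩
  ms := MeasurableSet.iUnion fun n => (h n).ms

/-- the dual -/
def neg (z : Cantor) : Cantor := fun i => !(z i)

@[simp] theorem neg_neg (z : Cantor) : neg (neg z) = z := by ext; simp [neg]

theorem continuous_neg : Continuous neg :=
  continuous_pi fun i => (continuous_of_discreteTopology (f := Bool.not)).comp (continuous_apply i)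

theorem Sfl.dual {S : Set Cantor} (h : Sfl S) : Sfl {z | neg z ∉ S} where
  up := fun x hx y hxy hy => hx (h.up _ hy _ fun n hn => by
    have := hxy n
    simp only [neg] at hn ⊢
    cases hxn : x n <;> simp_all)
  fm := fun x hx y hxy hy => hx (h.fm _ hy _ (by
    refine hxy.subset fun n hn => ?_
    simp only [neg, mem_ofPred_eq] at hn ⊢
    intro he; exact hn (by rw [he])))
  ms := (continuous_neg.measurable h.ms).compl

def negH : Cantor ≃ₜ Cantor where
  toFun := neg
  invFun := neg
  left_inv := neg_neg
  right_inv := neg_neg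
  continuous_toFun := continuous_neg
  continuous_invFun := continuous_neg

def CofN (N : ℕ) : Set Cantor := {z | ∀ n ≥ N, z n = true}
def FinN (N : ℕ) : Set Cantor := {z | ∀ n ≥ N, z n = false}
def Cof : Set Cantor := ⋃ N, CofN N
def Fn : Set Cantor := ⋃ N, FinN N

theorem isClosed_CofN (N : ℕ) : IsClosed (CofN N) := by
  have : CofN N = ⋂ n, ⋂ (_ : n ≥ N), {z | z n = true} := by ext; simp [CofN]
  rw [this]
  exact isClosed_iInter fun n => isClosed_iInter fun _ =>
    isClosed_eq (continuous_apply _) continuous_const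

theorem isClosed_FinN (N : ℕ) : IsClosed (FinN N) := by
  have : FinN N = ⋂ n, ⋂ (_ : n ≥ N), {z | z n = false} := by ext; simp [FinN]
  rw [this]
  exact isClosed_iInter fun n => isClosed_iInter fun _ =>
    isClosed_eq (continuous_apply _) continuous_const

theorem fs_Cof : IsFsigma Cof := ⟨CofN, isClosed_CofN, rfl⟩
theorem fs_Fn : IsFsigma Fn := ⟨FinN, isClosed_FinN, rfl⟩

theorem mem_Cof {z : Cantor} : z ∈ Cof ↔ ∃ N, ∀ n ≥ N, z n = true := by simp [Cof, CofN]
theorem mem_Fn {z : Cantor} : z ∈ Fn ↔ ∃ N, ∀ n ≥ N, z n = false := by simp [Fn, FinN]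

theorem neg_mem_Fn {z : Cantor} : neg z ∈ Fn ↔ z ∈ Cof := by
  simp [mem_Fn, mem_Cof, neg]

theorem fin_bdd {x y : Cantor} (h : {n | x n ≠ y n}.Finite) : ∃ N, ∀ n ≥ N, x n = y n := by
  obtain ⟨M, hM⟩ := h.bddAbove
  refine ⟨M+1, fun n hn => ?_⟩
  by_contra hc
  have : n ≤ M := hM hc
  omega

theorem sfl_Cof : Sfl Cof where
  up := fun x hx y hxy => by
    obtain ⟨N, hN⟩ := mem_Cof.1 hx
    exact mem_Cof.2 ⟨N, fun n hn => hxy _ (hN n hn)⟩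
  fm := fun x hx y hxy => by
    obtain ⟨N, hN⟩ := mem_Cof.1 hx
    obtain ⟨M, hM⟩ := fin_bdd hxy
    refine mem_Cof.2 ⟨max M N, fun n hn => ?_⟩
    rw [← hM n (le_trans (le_max_left _ _) hn)]
    exact hN n (le_trans (le_max_right _ _) hn)
  ms := IsFs.meas fs_Cof

theorem sfl_Inf : Sfl Fnᶜ := by
  have := sfl_Cof.dual
  have h2 : {z : Cantor | neg z ∉ Cof} = Fnᶜ := by
    ext z
    simp only [mem_ofPred_eq, mem_compl_iff]
    rw [← neg_mem_Fn, neg_neg]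
  rwa [h2] at this

theorem meagre_of_closed {F : Set Cantor} (hF : IsClosed F) (h : ∀ x n, ∃ y ∈ Cy x n, y ∉ F) : IsMeagre F := by
  refine IsNowhereDense.isMeagre ?_
  rw [IsNowhereDense, hF.closure_eq, eq_empty_iff_forall_notMem]
  intro x hx
  obtain ⟨n, hn⟩ := exists_Cy_subset (mem_interior_iff_mem_nhds.1 hx)
  obtain ⟨y, hy, hyF⟩ := h x n
  exact hyF (hn hy)

theorem meagre_Cof : IsMeagre Cof := by
  refine isMeagre_iUnion fun N => meagre_of_closed (isClosed_CofN N) fun x n => ?_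
  refine ⟨fun i => if i < n then x i else false, fun i hi => by simp [hi], fun h => ?_⟩
  have := h (max n N) (le_max_right _ _)
  simp at this

theorem IsMeagre.row {S : Set Cantor} (h : IsMeagre S) (n : ℕ) : IsMeagre (row n ⁻¹' S) :=
  h.preimage_of_isOpenMap (continuous_row n) (isOpenMap_row n)

/-- continuous detection of Fσ sets -/
theorem trigger {H : Set Cantor} (hH : IsFsigma H) :
    ∃ u : Cantor → Cantor, Continuous u ∧ ∀ x, (x ∈ H ↔ u x ∈ Cof) := by
  classical
  obtain ⟨F, hF, rfl⟩ := hH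
  have hex : ∀ x n, ∃ k, n ≤ k ∨ (Cy x n ∩ F k).Nonempty := fun x n => ⟨n, Or.inl le_rfl⟩
  let j : Cantor → ℕ → ℕ := fun x n => Nat.find (hex x n)
  have hjle : ∀ x n k, (Cy x n ∩ F k).Nonempty → j x n ≤ k := fun x n k h => Nat.find_min' _ (Or.inr h)
  have hjs : ∀ x n, n ≤ j x n ∨ (Cy x n ∩ F (j x n)).Nonempty := fun x n => Nat.find_spec (hex x n)
  have hloc : ∀ x y n, y ∈ Cy x n → j y n = j x n := by
    intro x y n h
    have : Cy y n = Cy x n := Cy_eq h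
    simp only [j, this]
  have hmono : ∀ x n, j x n ≤ j x (n+1) := by
    intro x n
    refine Nat.find_min' _ ?_
    rcases hjs x (n+1) with h | h
    · left; omega
    · right; exact h.mono (inter_subset_inter_left _ (Cy_anti x (Nat.le_succ n)))
  have hm : ∀ x, Monotone (j x) := fun x => monotone_nat_of_le_succ (hmono x)
  refine ⟨fun x n => decide (j x n = j x (n+1)), ?_, fun x => ?_⟩
  · refine continuous_pi fun n => ?_
    rw [continuous_iff_continuousAt]
    intro x
    refine ContinuousAt.congr (f := fun _ => decide (j x n = j x (n+1))) continuousAt_const ?_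
    filter_upwards [(isOpen_Cy x (n+1)).mem_nhds (mem_Cy_self x _)] with y hy
    rw [hloc x y (n+1) hy, hloc x y n (Cy_anti x (Nat.le_succ n) hy)]
  · simp only [mem_iUnion, mem_Cof, decide_eq_true_eq]
    constructor
    · rintro ⟨k, hk⟩
      have hb : ∀ n, j x n ≤ k := fun n => hjle x n k ⟨x, mem_Cy_self x n, hk⟩
      by_contra hc
      push Not at hc
      have : ∀ m, ∃ n, m ≤ j x n := by
        intro m
        induction m with
        | zero => exact ⟨0, Nat.zero_le _⟩
        | succ m ih =>
          obtain ⟨n, hn⟩ := ih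
          obtain ⟨n', hn', h'⟩ := hc n
          have h1 := hm x hn'
          have h2 := hmono x n'
          exact ⟨n'+1, by omega⟩
      obtain ⟨n, hn⟩ := this (k+1)
      have := hb n
      omega
    · rintro ⟨N, hN⟩
      have hc : ∀ n ≥ N, j x n = j x N := by
        intro n hn
        induction n, hn using Nat.le_induction with
        | base => rfl
        | succ n hn ih => rw [← hN n hn, ih]
      refine ⟨j x N, ?_⟩
      rw [← (hF (j x N)).closure_eq, mem_closure_iff_nhds]
      intro t ht
      obtain ⟨n, hn⟩ := exists_Cy_subset ht
      have h1 := hjs x (max n (max N (j x N + 1)))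
      rw [hc _ ((le_max_left _ _).trans (le_max_right _ _))] at h1
      rcases h1 with h1 | h1
      · have := (le_max_right N (j x N + 1)).trans ((le_max_right n _).trans h1)
        omega
      · exact h1.mono (inter_subset_inter_left _ ((Cy_anti x (le_max_left _ _)).trans hn))

end HS



namespace HS

open Topology Filter

/-! ### Relative Baire category -/

def ND (F K : Set Cantor) : Prop := ∀ V, IsClopen V → (V ∩ K).Nonempty → ((V ∩ K) \ F).Nonempty

def MgrIn (A K : Set Cantor) : Prop :=
  ∃ F : ℕ → Set Cantor, (∀ n, IsClosed (F n)) ∧ (∀ n, ND (F n) K) ∧ A ∩ K ⊆ ⋃ n, F n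

theorem baire_in {K : Set Cantor} (hK : IsGδ K) {F : ℕ → Set Cantor} (hF : ∀ n, IsClosed (F n))
    (hn : ∀ n, ND (F n) K) {V : Set Cantor} (hV : IsClopen V) (hne : (V ∩ K).Nonempty) :
    ((V ∩ K) \ ⋃ n, F n).Nonempty := by
  obtain ⟨O, hO, rfl⟩ := isGδ_iff_eq_iInter_nat.1 hK
  set K := ⋂ n, O n with hKd
  have hcl : IsClosed (closure K) := isClosed_closure
  haveI : CompactSpace (closure K) := isCompact_iff_compactSpace.1 hcl.isCompact
  have hdense : ∀ U : Set Cantor, IsOpen U → (∀ W, IsClopen W → (W ∩ K).Nonempty → ((W ∩ K) ∩ U).Nonempty) →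
      Dense ((Subtype.val : closure K → Cantor) ⁻¹' U) := by
    intro U hU h
    rw [dense_iff_inter_open]
    rintro W hW ⟨⟨x, hx⟩, hxW⟩
    obtain ⟨W', hW', rfl⟩ := isOpen_induced_iff.1 hW
    obtain ⟨n, hn⟩ := exists_Cy_subset (hW'.mem_nhds hxW)
    obtain ⟨y, hy, hyK⟩ := mem_closure_iff_nhds.1 hx _ ((isOpen_Cy x n).mem_nhds (mem_Cy_self x n))
    obtain ⟨z, ⟨hz1, hz2⟩, hz3⟩ := h _ (isClopen_Cy x n) ⟨y, hy, hyK⟩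
    exact ⟨⟨z, subset_closure hz2⟩, hn hz1, hz3⟩
  have h1 : Dense (⋂ n, (Subtype.val : closure K → Cantor) ⁻¹' (O n ∩ (F n)ᶜ)) := by
    refine dense_iInter_of_isOpen_nat (fun n => ((hO n).inter (hF n).isOpen_compl).preimage continuous_subtype_val) fun n => ?_
    refine hdense _ ((hO n).inter (hF n).isOpen_compl) fun W hW hWne => ?_
    obtain ⟨x, hx, hxF⟩ := hn n W hW hWne
    exact ⟨x, hx, mem_iInter.1 hx.2 n, hxF⟩
  obtain ⟨x, hxV, hxK⟩ := hne
  obtain ⟨⟨y, hy⟩, hyV, hyI⟩ := h1.inter_open_nonempty _ (hV.2.preimage continuous_subtype_val)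
    ⟨⟨x, subset_closure hxK⟩, hxV⟩
  rw [mem_iInter] at hyI
  refine ⟨y, ⟨hyV, mem_iInter.2 fun n => (hyI n).1⟩, ?_⟩
  rw [mem_iUnion]
  rintro ⟨n, hn⟩
  exact (hyI n).2 hn

theorem ND.shrink {F K V : Set Cantor} (h : ND F K) (hV : IsClopen V) : ND F (V ∩ K) := by
  intro W hW hne
  rw [← inter_assoc] at hne ⊢
  exact h _ (hW.inter hV) hne

theorem MgrIn.shrink {A K V : Set Cantor} (h : MgrIn A K) (hV : IsClopen V) : MgrIn A (V ∩ K) := by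
  obtain ⟨F, hF, hn, hc⟩ := h
  exact ⟨F, hF, fun n => (hn n).shrink hV, fun x hx => hc ⟨hx.1, hx.2.2⟩⟩

theorem MgrIn.not_both {A K : Set Cantor} (hK : IsGδ K) (hne : K.Nonempty) (h : MgrIn A K)
    (h' : MgrIn Aᶜ K) : False := by
  obtain ⟨F, hF, hn, hc⟩ := h
  obtain ⟨F', hF', hn', hc'⟩ := h'
  obtain ⟨x, hx, hxF⟩ := baire_in hK (F := fun k => if Even k then F (k/2) else F' (k/2))
    (fun k => by beta_reduce; split_ifs <;> simp [*]) (fun k => by beta_reduce; split_ifs <;> simp [*])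
    isClopen_univ (by simpa using hne)
  apply hxF
  rw [mem_iUnion]
  by_cases hA : x ∈ A
  · obtain ⟨n, hn⟩ := mem_iUnion.1 (hc ⟨hA, hx.2⟩)
    exact ⟨2*n, by simpa using hn⟩
  · obtain ⟨n, hn⟩ := mem_iUnion.1 (hc' ⟨hA, hx.2⟩)
    refine ⟨2*n+1, ?_⟩
    rw [if_neg (by simp)]
    rwa [show (2*n+1)/2 = n by omega]

theorem mgr_of_meagre {A K : Set Cantor} (h : IsMeagre ((Subtype.val : closure K → Cantor) ⁻¹' A)) :
    MgrIn A K := by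
  obtain ⟨S, hS, hc, hsub⟩ := isMeagre_iff_countable_union_isNowhereDense.1 h
  have hex : ∃ G : ℕ → Set (closure K), (∀ n, IsNowhereDense (G n)) ∧ ⋃₀ S ⊆ ⋃ n, G n := by
    rcases S.eq_empty_or_nonempty with rfl | hne
    · exact ⟨fun _ => ∅, fun _ => isNowhereDense_empty, by simp⟩
    · obtain ⟨f, rfl⟩ := hc.exists_eq_range hne
      exact ⟨f, fun n => hS _ ⟨n, rfl⟩, by rw [sUnion_range]⟩
  obtain ⟨G, hG, hGS⟩ := hex
  refine ⟨fun n => Subtype.val '' closure (G n), fun n =>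
    isClosed_closure.isClosedEmbedding_subtypeVal.isClosedMap _ isClosed_closure, ?_, ?_⟩
  · rintro n V hV ⟨x, hxV, hxK⟩
    have h1 : ∃ y : closure K, y.1 ∈ V ∧ y ∉ closure (G n) := by
      by_contra hcon
      push Not at hcon
      have := hG n
      rw [IsNowhereDense, eq_empty_iff_forall_notMem] at this
      apply this ⟨x, subset_closure hxK⟩
      rw [mem_interior]
      exact ⟨Subtype.val ⁻¹' V, fun y hy => hcon y hy, hV.2.preimage continuous_subtype_val, hxV⟩
    obtain ⟨y, hyV, hyG⟩ := h1
    have h2 : IsOpen ((Subtype.val : closure K → Cantor) ⁻¹' V ∩ (closure (G n))ᶜ) :=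
      (hV.2.preimage continuous_subtype_val).inter isClosed_closure.isOpen_compl
    obtain ⟨W, hW, hWe⟩ := isOpen_induced_iff.1 h2
    have hyW : y.1 ∈ W := by
      have : y ∈ Subtype.val ⁻¹' W := by rw [hWe]; exact ⟨hyV, hyG⟩
      exact this
    obtain ⟨z, hzW, hzK⟩ := mem_closure_iff.1 y.2 W hW hyW
    have hz : (⟨z, subset_closure hzK⟩ : closure K) ∈ (Subtype.val : closure K → Cantor) ⁻¹' V ∩ (closure (G n))ᶜ := by
      rw [← hWe]; exact hzW
    refine ⟨z, ⟨hz.1, hzK⟩, ?_⟩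
    rintro ⟨w, hw, rfl⟩
    exact hz.2 hw
  · rintro x ⟨hxA, hxK⟩
    obtain ⟨n, hn⟩ := mem_iUnion.1 (hGS (hsub (show (⟨x, subset_closure hxK⟩ : closure K) ∈ _ from hxA)))
    exact mem_iUnion.2 ⟨n, _, subset_closure hn, rfl⟩

theorem mgr_or {X K : Set Cantor} (hX : MeasurableSet X) (hne : K.Nonempty) :
    ∃ V, IsClopen V ∧ (V ∩ K).Nonempty ∧ (MgrIn X (V ∩ K) ∨ MgrIn Xᶜ (V ∩ K)) := by
  have hX' : MeasurableSet ((Subtype.val : closure K → Cantor) ⁻¹' X) := measurable_subtype_coe hX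
  obtain ⟨u, hu, hue⟩ := MeasurableSet.residualEq_isOpen hX'
  rcases u.eq_empty_or_nonempty with rfl | ⟨⟨x, hx⟩, hxu⟩
  · refine ⟨univ, isClopen_univ, by simpa using hne, Or.inl ?_⟩
    rw [univ_inter]
    refine mgr_of_meagre ?_
    rw [IsMeagre]
    filter_upwards [hue] with y hy
    intro hyX
    have : y ∈ (∅ : Set (closure K)) := by rw [← show _ = (y ∈ (∅ : Set (closure K))) from hy]; exact hyX
    exact this
  · obtain ⟨W, hW, rfl⟩ := isOpen_induced_iff.1 hu
    obtain ⟨n, hn⟩ := exists_Cy_subset (hW.mem_nhds hxu)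
    refine ⟨Cy x n, isClopen_Cy x n, mem_closure_iff.1 hx _ (isOpen_Cy x n) (mem_Cy_self x n), Or.inr ?_⟩
    have h1 : MgrIn (Xᶜ ∩ Cy x n) K := by
      refine mgr_of_meagre ?_
      rw [IsMeagre]
      filter_upwards [hue] with y hy
      rintro ⟨hyX, hyC⟩
      apply hyX
      rw [show (y.1 ∈ X) = _ from hy]
      exact hn hyC
    obtain ⟨F, hF, hnd, hc⟩ := h1.shrink (isClopen_Cy x n)
    exact ⟨F, hF, hnd, fun y hy => hc ⟨⟨hy.1, hy.2.1⟩, hy.2⟩⟩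

/-! ### Good sets -/

def Good (X K : Set Cantor) : Prop :=
  ∃ S, Sfl S ∧ Red K X univ S ∧ Red univ S K X ∧ (MgrIn X K → IsMeagre S) ∧ (MgrIn Xᶜ K → IsMeagre Sᶜ)

theorem meagre_neg {S : Set Cantor} (h : IsMeagre S) : IsMeagre {z | neg z ∈ S} :=
  IsMeagre.preimage_of_isOpenMap (f := neg) continuous_neg negH.isOpenMap h

theorem Good.compl {X K : Set Cantor} (h : Good X K) : Good Xᶜ K := by
  obtain ⟨S, hS, h1, h2, h3, h4⟩ := h
  refine ⟨{z | neg z ∉ S}, hS.dual, ?_, ?_, ?_, ?_⟩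
  · refine h1.compl.trans ⟨neg, continuous_neg.continuousOn, fun _ _ => mem_univ _, fun x _ => ?_⟩
    simp
  · refine Red.trans ⟨neg, continuous_neg.continuousOn, fun _ _ => mem_univ _, fun x _ => ?_⟩ h2.compl
    simp
  · intro h; exact meagre_neg (h4 h)
  · intro h
    rw [compl_compl] at h
    have := meagre_neg (h3 h)
    convert this using 1
    ext; simp

theorem Good.of_shrink {X K V : Set Cantor} (hV : IsClopen V) (hr : Red K X (V ∩ K) X)
    (h : Good X (V ∩ K)) : Good X K := by
  obtain ⟨S, hS, h1, h2, h3, h4⟩ := h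
  exact ⟨S, hS, hr.trans h1, h2.trans (Red.sub _ inter_subset_right), fun h => h3 (h.shrink hV),
    fun h => h4 (h.shrink hV)⟩

/-! ### Case 1 -/

def code (x : Cantor) (n : ℕ) : ℕ := ∑ i ∈ Finset.range n, if x i then 2^i else 0

theorem code_succ (x : Cantor) (n : ℕ) : code x (n+1) = code x n + if x n then 2^n else 0 :=
  Finset.sum_range_succ _ _

theorem code_lt (x : Cantor) (n : ℕ) : code x n < 2^n := by
  induction n with
  | zero => simp [code]
  | succ n ih => rw [code_succ, pow_succ]; split_ifs <;> omega

theorem code_inj {x y : Cantor} {n : ℕ} (h : code x n = code y n) : y ∈ Cy x n := by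
  induction n with
  | zero => intro i hi; omega
  | succ n ih =>
    rw [code_succ, code_succ] at h
    have h1 := code_lt x n
    have h2 := code_lt y n
    have h3 : code x n = code y n ∧ x n = y n := by
      cases hx : x n <;> cases hy : y n <;> simp [hx, hy] at h ⊢ <;> omega
    intro i hi
    rcases Nat.lt_succ_iff_lt_or_eq.1 hi with hi | rfl
    · exact ih h3.1 i hi
    · exact h3.2.symm

theorem code_congr {x y : Cantor} {n : ℕ} (h : y ∈ Cy x n) : code y n = code x n := by
  refine Finset.sum_congr rfl fun i hi => ?_
  rw [h i (Finset.mem_range.1 hi)]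

def Hit (z : Cantor) (n : ℕ) : Prop := ∃ c < 2^n, z (Nat.pair n c) = true
def Tr (z x : Cantor) (n : ℕ) : Prop := ∀ c < 2^n, (z (Nat.pair n c) = true ↔ c = code x n)

def DN (N : ℕ) : Set Cantor := {z | ∀ n ≥ N, Hit z n}
def EN (N : ℕ) : Set Cantor := {z | ∃ x, ∀ n ≥ N, Tr z x n}

theorem isClosed_DN (N : ℕ) : IsClosed (DN N) := by
  have : DN N = ⋂ n, ⋂ (_ : n ≥ N), ⋃ c ∈ Finset.range (2^n), {z : Cantor | z (Nat.pair n c) = true} := by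
    ext z
    simp [DN, Hit]
  rw [this]
  exact isClosed_iInter fun n => isClosed_iInter fun _ => Set.Finite.isClosed_biUnion (Finset.finite_toSet _)
    fun c _ => isClosed_eq (continuous_apply _) continuous_const

theorem isClosed_EN (N : ℕ) : IsClosed (EN N) := by
  have h1 : IsClosed {p : Cantor × Cantor | ∀ n ≥ N, Tr p.1 p.2 n} := by
    have : {p : Cantor × Cantor | ∀ n ≥ N, Tr p.1 p.2 n} = ⋂ n, ⋂ (_ : n ≥ N), ⋂ c, ⋂ (_ : c < 2^n),
        {p : Cantor × Cantor | p.1 (Nat.pair n c) = decide (c = code p.2 n)} := by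
      ext p
      simp only [mem_ofPred_eq, Tr, mem_iInter]
      refine forall_congr' fun n => forall_congr' fun _ => forall_congr' fun c => forall_congr' fun _ => ?_
      cases p.1 (Nat.pair n c) <;> simp
    rw [this]
    refine isClosed_iInter fun n => isClosed_iInter fun _ => isClosed_iInter fun c => isClosed_iInter fun _ => ?_
    refine isClosed_eq ((continuous_apply _).comp continuous_fst) ?_
    refine Continuous.comp (g := fun x : Cantor => decide (c = code x n)) ?_ continuous_snd
    rw [continuous_iff_continuousAt]
    intro x
    refine ContinuousAt.congr (f := fun _ => decide (c = code x n)) continuousAt_const ?_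
    filter_upwards [(isOpen_Cy x n).mem_nhds (mem_Cy_self x n)] with y hy
    rw [code_congr hy]
  have h2 : EN N = Prod.fst '' {p : Cantor × Cantor | ∀ n ≥ N, Tr p.1 p.2 n} := by
    ext z
    constructor
    · rintro ⟨x, hx⟩; exact ⟨(z, x), hx, rfl⟩
    · rintro ⟨⟨z, x⟩, hx, rfl⟩; exact ⟨x, hx⟩
  rw [h2]
  exact (h1.isCompact.image continuous_fst).isClosed

theorem Tr.unique {z x y : Cantor} {n : ℕ} (h : Tr z x n) (h' : Tr z y n) : y ∈ Cy x n := by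
  apply code_inj
  have := (h _ (code_lt x n)).2 rfl
  exact (h' _ (code_lt x n)).1 this

theorem Tr.unique' {z x y : Cantor} {N M : ℕ} (h : ∀ n ≥ N, Tr z x n) (h' : ∀ n ≥ M, Tr z y n) : x = y := by
  ext i
  have := (h (max N (max M (i+1))) (le_max_left _ _)).unique (h' _ ((le_max_left _ _).trans (le_max_right _ _)))
  exact (this i (by have := (le_max_right M (i+1)).trans (le_max_right N _); omega)).symm

open Classical in
noncomputable def xi (z : Cantor) : Cantor := if h : ∃ N x, ∀ n ≥ N, Tr z x n then h.choose_spec.choose else z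

theorem xi_eq {z x : Cantor} {N : ℕ} (h : ∀ n ≥ N, Tr z x n) : xi z = x := by
  have hex : ∃ N x, ∀ n ≥ N, Tr z x n := ⟨N, x, h⟩
  rw [xi, dif_pos hex]
  exact Tr.unique' hex.choose_spec.choose_spec h

theorem Tr.congr {z z' x : Cantor} {n : ℕ} (h : ∀ c < 2^n, z (Nat.pair n c) = z' (Nat.pair n c)) (ht : Tr z x n) :
    Tr z' x n := fun c hc => by rw [← h c hc]; exact ht c hc

theorem continuousOn_xi (N : ℕ) : ContinuousOn xi (EN N) := by
  rintro z ⟨x, hx⟩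
  rw [continuousWithinAt_pi]
  intro i
  set n := max N (i+1)
  obtain ⟨M, hM⟩ : ∃ M, ∀ c < 2^n, Nat.pair n c < M := by
    obtain ⟨M, hM⟩ := ((Finset.range (2^n)).image (Nat.pair n)).bddAbove
    exact ⟨M+1, fun c hc => Nat.lt_succ_of_le (hM (Finset.mem_coe.2 (Finset.mem_image.2 ⟨c, Finset.mem_range.2 hc, rfl⟩)))⟩
  refine ContinuousWithinAt.congr_of_eventuallyEq (continuousWithinAt_const (b := x i)) ?_ (by rw [xi_eq hx])
  filter_upwards [self_mem_nhdsWithin, mem_nhdsWithin_of_mem_nhds ((isOpen_Cy z M).mem_nhds (mem_Cy_self z M))]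
    with y hyE hyC
  obtain ⟨x', hx'⟩ := hyE
  rw [xi_eq hx']
  have h1 := hx n (le_max_left _ _)
  have h2 := Tr.congr (z' := z) (fun c hc => hyC _ (hM c hc)) (hx' n (le_max_left _ _))
  exact h1.unique h2 i (by have := le_max_right N (i+1); omega)

def S0 (Q : Set Cantor) : Set Cantor := {z | (∃ N, z ∈ DN N) ∧ ((∃ N, z ∈ EN N) → xi z ∈ Q)}

theorem fin_bdd2 {x y : Cantor} (h : {n | x n ≠ y n}.Finite) : ∃ N, ∀ n ≥ N, ∀ c, x (Nat.pair n c) = y (Nat.pair n c) := by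
  obtain ⟨N, hN⟩ := fin_bdd h
  exact ⟨N, fun n hn c => hN _ (hn.trans (Nat.left_le_pair n c))⟩

theorem sfl_S0 {Q : Set Cantor} (hQ : MeasurableSet Q) : Sfl (S0 Q) where
  up := by
    rintro z ⟨⟨N, hN⟩, hz⟩ y hzy
    refine ⟨⟨N, fun n hn => ?_⟩, ?_⟩
    · obtain ⟨c, hc, h⟩ := hN n hn
      exact ⟨c, hc, hzy _ h⟩
    · rintro ⟨M, x, hx⟩
      have h1 : ∀ n ≥ max N M, Tr z x n := by
        intro n hn c hc
        have h2 := hx n ((le_max_right _ _).trans hn)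
        constructor
        · intro h; exact (h2 c hc).1 (hzy _ h)
        · rintro rfl
          obtain ⟨c', hc', h'⟩ := hN n ((le_max_left _ _).trans hn)
          rw [← (h2 c' hc').1 (hzy _ h')]; exact h'
      rw [xi_eq hx, ← xi_eq h1]
      exact hz ⟨_, x, h1⟩
  fm := by
    rintro z ⟨⟨N, hN⟩, hz⟩ y hzy
    obtain ⟨L, hL⟩ := fin_bdd2 hzy
    refine ⟨⟨max N L, fun n hn => ?_⟩, ?_⟩
    · obtain ⟨c, hc, h⟩ := hN n ((le_max_left _ _).trans hn)
      exact ⟨c, hc, by rw [← hL n ((le_max_right _ _).trans hn)]; exact h⟩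
    · rintro ⟨M, x, hx⟩
      have h1 : ∀ n ≥ max M L, Tr z x n := fun n hn =>
        Tr.congr (fun c _ => (hL n ((le_max_right _ _).trans hn) c).symm) (hx n ((le_max_left _ _).trans hn))
      rw [xi_eq hx, ← xi_eq h1]
      exact hz ⟨_, x, h1⟩
  ms := by
    have : S0 Q = (⋃ N, DN N) ∩ ((⋃ N, EN N)ᶜ ∪ ⋃ N, (EN N ∩ xi ⁻¹' Q)) := by
      ext z
      simp only [S0, mem_ofPred_eq, mem_inter_iff, mem_iUnion, mem_union, mem_compl_iff, mem_preimage]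
      by_cases h : ∃ N, z ∈ EN N
      · simp [h]
      · simp [h]
    rw [this]
    refine (MeasurableSet.iUnion fun N => (isClosed_DN N).measurableSet).inter
      ((MeasurableSet.iUnion fun N => (isClosed_EN N).measurableSet).compl.union
        (MeasurableSet.iUnion fun N => ?_))
    have h1 : Measurable ((EN N).restrict xi) := (continuousOn_iff_continuous_restrict.1 (continuousOn_xi N)).measurable
    have h2 := MeasurableSet.subtype_image (isClosed_EN N).measurableSet (h1 hQ)
    convert h2 using 1
    ext z
    simp only [mem_inter_iff, mem_preimage, mem_image, Subtype.exists, exists_and_right, exists_eq_right, restrict_apply]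
    exact ⟨fun h => ⟨h.1, h.2⟩, fun ⟨h, h'⟩ => ⟨h, h'⟩⟩

theorem meagre_S0 (Q : Set Cantor) : IsMeagre (S0 Q) := by
  have : IsMeagre (⋃ N, DN N) := by
    refine isMeagre_iUnion fun N => meagre_of_closed (isClosed_DN N) fun x n => ?_
    refine ⟨fun i => if i < n then x i else false, fun i hi => by simp [hi], fun h => ?_⟩
    obtain ⟨c, hc, h'⟩ := h (max n N) (le_max_right _ _)
    have h2 := Nat.left_le_pair (max n N) c
    have h3 := le_max_left n N
    beta_reduce at h'
    rw [if_neg (by omega)] at h'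
    exact absurd h' (by simp)
  exact this.mono fun z hz => mem_iUnion.2 hz.1

def PU (X K : Set Cantor) : Prop :=
  ∀ Z B, IsGδ Z → MeasurableSet B → ∀ F : ℕ → Set Cantor, (∀ i, IsClosed (F i)) →
    (∀ i, Red (Z ∩ F i) B K X) → Red (Z \ ⋃ i, F i) B K X → Red Z B K X

theorem case1 {X K : Set Cantor} (hX : MeasurableSet X) (hK : Unif X K) (hdd : ∀ n, ¬ DD n K X)
    (hpu : PU X K) : ∃ S, Sfl S ∧ IsMeagre S ∧ Red K X univ S ∧ Red univ S K X := by
  have habs := abs_or_dd hX hK hdd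
  have hKm : MeasurableSet K := hK.gd.measurableSet
  have hQ := hX.inter hKm
  refine ⟨S0 (X ∩ K), sfl_S0 hQ, meagre_S0 _, ?_, ?_⟩
  · let P : Cantor → Cantor := fun x k => decide (k.unpair.2 = code x k.unpair.1)
    have hP : ∀ x n, Tr (P x) x n := by intro x n c hc; simp [P]
    refine ⟨P, Continuous.continuousOn ?_, fun _ _ => mem_univ _, fun x hx => ?_⟩
    · refine continuous_pi fun k => ?_
      rw [continuous_iff_continuousAt]
      intro x
      refine ContinuousAt.congr (f := fun _ => P x k) continuousAt_const ?_
      filter_upwards [(isOpen_Cy x k.unpair.1).mem_nhds (mem_Cy_self x _)] with y hy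
      simp only [P]
      rw [code_congr hy]
    · have hxi : xi (P x) = x := xi_eq (N := 0) fun n _ => hP x n
      constructor
      · intro hxX
        refine ⟨⟨0, fun n _ => ⟨code x n, code_lt x n, ?_⟩⟩, fun _ => ?_⟩
        · exact (hP x n _ (code_lt x n)).2 rfl
        · rw [hxi]; exact ⟨hxX, hx⟩
      · rintro ⟨-, h⟩
        have := h ⟨0, x, fun n _ => hP x n⟩
        rw [hxi] at this
        exact this.1
  · refine hpu _ _ IsGδ.univ (sfl_S0 hQ).ms EN isClosed_EN (fun N => ?_) ?_
    · -- first reduce to X ∩ K, then absorb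
      have h1 : Red univ (X ∩ K) K X := by
        refine habs _ _ IsGδ.univ hQ ⟨Kᶜ, ∅, IsFs.of_isGδ hK.gd, IsFs.empty, fun x _ hx h => hx h.2, by simp, ?_⟩
        refine ⟨id, continuousOn_id, fun x hx => ?_, fun x hx => ?_⟩
        · by_contra hc; exact hx.2 (Or.inl hc)
        · constructor
          · exact fun h => h.1
          · intro h; refine ⟨h, ?_⟩
            by_contra hc; exact hx.2 (Or.inl hc)
      refine Red.trans ⟨xi, (continuousOn_xi N).mono inter_subset_right, fun _ _ => mem_univ _, ?_⟩ h1
      rintro z ⟨-, hz⟩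
      constructor
      · rintro ⟨-, h⟩; exact h ⟨N, hz⟩
      · intro h
        refine ⟨⟨N, fun n hn => ?_⟩, fun _ => h⟩
        obtain ⟨x, hx⟩ := hz
        exact ⟨code x n, code_lt x n, (hx n hn _ (code_lt x n)).2 rfl⟩
    · obtain ⟨k, hkK, hkX⟩ : ∃ k ∈ K, k ∉ X := by
        by_contra hc
        push Not at hc
        exact hdd 0 (Or.inl hc)
      refine habs _ _ (gdiff IsGδ.univ ⟨EN, isClosed_EN, rfl⟩) (sfl_S0 hQ).ms
        ⟨∅, ⋃ N, DN N, IsFs.empty, ⟨DN, isClosed_DN, rfl⟩, by simp, fun z hz hzD => ?_, Red.const hkK fun z hz => ?_⟩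
      · refine ⟨mem_iUnion.1 hzD, fun h => absurd (mem_iUnion.2 h) hz.2⟩
      · simp only [hkX, iff_false]
        rintro ⟨h, -⟩
        exact hz.2 (Or.inr (mem_iUnion.2 h))

end HS



namespace HS

open Topology Filter

/-! ### Decomposition into uniform pieces -/

def Dcp (X Y : Set Cantor) : Prop :=
  ∃ E : ℕ → Set Cantor, (∀ j, IsClosed (E j)) ∧ Y ⊆ ⋃ j, E j ∧ ∀ j, Y ∩ E j = ∅ ∨ Unif X (Y ∩ E j)

theorem dcp {X Y : Set Cantor} (hX : MeasurableSet X) (hY : IsGδ Y) : Dcp X Y := by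
  set 𝒱 : Set (Set Cantor) := {V | IsClopen V ∧ Dcp X (V ∩ Y)} with h𝒱
  obtain ⟨T, hTc, hT, hTU⟩ := TopologicalSpace.isOpen_sUnion_countable 𝒱 fun V hV => hV.1.2
  -- pieces covering the union
  obtain ⟨C, hC, hCO, hCU⟩ : ∃ C : ℕ → Set Cantor, (∀ j, IsClosed (C j)) ∧ (⋃₀ 𝒱 ∩ Y ⊆ ⋃ j, C j) ∧
      (∀ j, Y ∩ C j = ∅ ∨ Unif X (Y ∩ C j)) := by
    rcases T.eq_empty_or_nonempty with rfl | hne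
    · refine ⟨fun _ => ∅, fun _ => isClosed_empty, ?_, fun _ => Or.inl (inter_empty _)⟩
      rw [← hTU]; simp
    · obtain ⟨v, rfl⟩ := hTc.exists_eq_range hne
      have hv : ∀ k, v k ∈ 𝒱 := fun k => hT ⟨k, rfl⟩
      choose E hE hc hu using fun k => (hv k).2
      refine ⟨fun i => v i.unpair.1 ∩ E i.unpair.1 i.unpair.2, fun i => (hv _).1.1.inter (hE _ _), ?_, ?_⟩
      · rintro x ⟨hx, hxY⟩
        rw [← hTU] at hx
        obtain ⟨_, ⟨k, rfl⟩, hxk⟩ := hx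
        obtain ⟨j, hj⟩ := mem_iUnion.1 (hc k ⟨hxk, hxY⟩)
        exact mem_iUnion.2 ⟨Nat.pair k j, by simpa using ⟨hxk, hj⟩⟩
      · intro i
        have := hu i.unpair.1 i.unpair.2
        rw [inter_right_comm, inter_comm _ Y] at this
        exact this
  set O := ⋃₀ 𝒱 with hO
  have hOo : IsOpen O := isOpen_sUnion fun V hV => hV.1.2
  by_cases hemp : (Y \ O).Nonempty
  · exfalso
    obtain ⟨V, hV, hVU⟩ := exists_unif hX (gdiff hY (IsFs.open hOo)) hemp
    have hV' : V ∈ 𝒱 := by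
      refine ⟨hV, fun n => Nat.casesOn n (V \ O) (fun j => C j), fun n => ?_, ?_, fun n => ?_⟩
      · cases n with
        | zero => exact hV.1.sdiff hOo
        | succ j => exact hC j
      · rintro x ⟨hxV, hxY⟩
        by_cases hxO : x ∈ O
        · obtain ⟨j, hj⟩ := mem_iUnion.1 (hCO ⟨hxO, hxY⟩)
          exact mem_iUnion.2 ⟨j+1, hj⟩
        · exact mem_iUnion.2 ⟨0, hxV, hxO⟩
      · cases n with
        | zero =>
          right
          convert hVU using 1
          ext x
          show (x ∈ V ∧ x ∈ Y) ∧ (x ∈ V ∧ x ∉ O) ↔ x ∈ V ∧ x ∈ Y ∧ x ∉ O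
          tauto
        | succ j =>
          show (V ∩ Y) ∩ C j = ∅ ∨ Unif X ((V ∩ Y) ∩ C j)
          rw [inter_assoc]
          rcases hCU j with h | h
          · left; rw [h, inter_empty]
          · rcases (V ∩ (Y ∩ C j)).eq_empty_or_nonempty with h' | h'
            · exact Or.inl h'
            · exact Or.inr (h.shrink hV h')
    obtain ⟨x, hxV, hxY, hxO⟩ := hVU.ne
    exact hxO ⟨V, hV', hxV⟩
  · refine ⟨C, hC, fun x hx => hCO ⟨?_, hx⟩, hCU⟩
    by_contra hc
    exact hemp ⟨x, hx, hc⟩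

/-! ### DD sets are below tail sets -/

theorem dd_sfl (m : ℕ) : ∃ S, Sfl S ∧ (∃ k, DD k univ S) ∧ ∀ Z B, DD m Z B →
    ∃ r : Cantor → Cantor, Continuous r ∧ ∀ x ∈ Z, (x ∈ B ↔ r x ∈ S) := by
  induction m with
  | zero =>
    refine ⟨Cof, sfl_Cof, ⟨1, ∅, Cof, IsFs.empty, fs_Cof, by simp, fun _ _ h => h, Or.inr ?_⟩, ?_⟩
    · intro x hx; exact fun h => hx.2 (Or.inr h)
    · rintro Z B (h | h)
      · exact ⟨fun _ => fun _ => true, continuous_const, fun x hx => by simp [h x hx, mem_Cof]⟩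
      · exact ⟨fun _ => fun _ => false, continuous_const, fun x hx => by
          simp only [h x hx, false_iff, mem_Cof]; push Not; exact fun N => ⟨N, le_rfl, by simp⟩⟩
  | succ m ih =>
    obtain ⟨S, hS, ⟨k, hk⟩, hr⟩ := ih
    refine ⟨row 0 ⁻¹' Cof ∪ (row 1 ⁻¹' Fnᶜ ∩ row 2 ⁻¹' S), (sfl_Cof.row 0).union ((sfl_Inf.row 1).inter (hS.row 2)),
      ⟨k+2, ∅, row 0 ⁻¹' Cof, IsFs.empty, IsFs.preimage (continuous_row 0) fs_Cof, by simp, fun x _ h => Or.inl h,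
        row 1 ⁻¹' Fn, ∅, IsFs.preimage (continuous_row 1) fs_Fn, IsFs.empty, ?_, by simp,
        DD.pull (Z' := univ) (B' := S) ⟨row 2, (continuous_row 2).continuousOn, fun _ _ => mem_univ _, ?_⟩ hk⟩, ?_⟩
    · rintro x hx hx1 (h | h)
      · exact hx.2 (Or.inr h)
      · exact h.1 hx1
    · rintro x ⟨⟨-, hx⟩, hx'⟩
      simp only [empty_union, union_empty, mem_preimage] at hx hx'
      simp [hx, hx']
    · rintro Z B ⟨F0, F1, h0, h1, hF0, hF1, hd⟩
      obtain ⟨r, hr, hrB⟩ := hr _ _ hd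
      obtain ⟨u0, hu0, hu0'⟩ := trigger h0
      obtain ⟨u1, hu1, hu1'⟩ := trigger h1
      let w : ℕ → Cantor → Cantor := fun n x => if n = 0 then u1 x else if n = 1 then neg (u0 x) else r x
      refine ⟨fun x => tup (fun n => w n x), ?_, fun x hx => ?_⟩
      · rw [← continuousOn_univ]
        refine continuousOn_tup fun n => Continuous.continuousOn ?_
        simp only [w]
        split_ifs
        · exact hu1
        · exact continuous_neg.comp hu0
        · exact hr
      · simp only [mem_union, mem_preimage, row_tup, mem_inter_iff, mem_compl_iff, w]
        simp only [if_true, one_ne_zero, if_false, neg_mem_Fn, ← hu0', ← hu1', OfNat.ofNat_ne_zero,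
          OfNat.ofNat_ne_one]
        by_cases hx1 : x ∈ F1
        · simp [hx1, hF1 x hx hx1]
        · by_cases hx0 : x ∈ F0
          · simp [hx1, hx0, hF0 x hx hx0]
          · simp only [hx1, hx0, false_or, not_false_eq_true, true_and]
            exact hrB x ⟨hx, fun h => h.elim hx0 hx1⟩

/-! ### Case 2 -/

def Small (X K Z B : Set Cantor) : Prop := ¬ Red K X Z B ∧ ¬ Red K Xᶜ Z B

theorem Small.compl {X K Z B : Set Cantor} (h : Small X K Z B) : Small X K Z Bᶜ :=
  ⟨fun h' => h.2 (Red.of_compl (by simpa using h')), fun h' => h.1 (Red.of_compl h')⟩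

theorem Small.mono {X K Z Z' B : Set Cantor} (h : Small X K Z B) (hs : Z' ⊆ Z) : Small X K Z' B :=
  ⟨fun h' => h.1 (h'.trans (Red.sub _ hs)), fun h' => h.2 (h'.trans (Red.sub _ hs))⟩

theorem small_of {X K Y : Set Cantor} (hX : MeasurableSet X) (hK : Unif X K) (hY : Y ⊆ K)
    (h : ¬ Red K X Y X) : Small X K Y X :=
  ⟨h, fun h' => hK.not_self_dual hX (h'.trans (Red.sub _ hY))⟩

theorem Small.of_dd {X K Z B : Set Cantor} {n : ℕ} (hdd : ∀ n, ¬ DD n K X) (h : DD n Z B) : Small X K Z B :=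
  ⟨fun h' => hdd n (DD.pull h' h), fun h' => hdd n (by simpa using (DD.pull h' h).compl)⟩

structure Cfg (X K R : Set Cantor) (E : ℕ → Set Cantor) : Prop where
  unif : Unif X K
  ndd : ∀ n, ¬ DD n K X
  cl : ∀ n, IsClosed (E n)
  rest : R = K \ ⋃ n, E n
  ne : R.Nonempty
  small : ∀ n, ¬ Red K X (K ∩ E n) X
  rsmall : ¬ Red K X R X
  min : ∀ V, IsClopen V → ∀ F : ℕ → Set Cantor, (∀ j, IsClosed (F j)) → (∀ j, ¬ Red K X (K ∩ F j) X) →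
    (V ∩ R).Nonempty → Red R X (V ∩ (R \ ⋃ j, F j)) X

theorem nd_of_small {X K F : Set Cantor} (hK : Unif X K) (h : ¬ Red K X (K ∩ F) X) : ND F K := by
  intro V hV hne
  by_contra hc
  apply h
  refine (hK.red V hV hne).trans (Red.sub _ fun x hx => ⟨hx.2, ?_⟩)
  by_contra hxF
  exact hc ⟨x, hx, hxF⟩

def mix (F G : ℕ → Set Cantor) (k : ℕ) : Set Cantor := if Even k then F (k/2) else G (k/2)

theorem mix_all {F G : ℕ → Set Cantor} {P : Set Cantor → Prop} (hF : ∀ n, P (F n)) (hG : ∀ n, P (G n)) (k : ℕ) :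
    P (mix F G k) := by
  unfold mix; split_ifs <;> simp [*]

theorem iUnion_mix (F G : ℕ → Set Cantor) : ⋃ k, mix F G k = (⋃ n, F n) ∪ ⋃ n, G n := by
  ext x
  simp only [mem_iUnion, mem_union]
  constructor
  · rintro ⟨k, hk⟩
    unfold mix at hk
    split_ifs at hk
    · exact Or.inl ⟨_, hk⟩
    · exact Or.inr ⟨_, hk⟩
  · rintro (⟨n, hn⟩ | ⟨n, hn⟩)
    · exact ⟨2*n, by simpa [mix] using hn⟩
    · refine ⟨2*n+1, ?_⟩
      rw [mix, if_neg (by simp), show (2*n+1)/2 = n by omega]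
      exact hn

theorem exists_cfg {X K : Set Cantor} (hX : MeasurableSet X) (hK : Unif X K) (hdd : ∀ n, ¬ DD n K X)
    (hpu : ¬ PU X K) : ∃ V R E, IsClopen V ∧ Cfg X (V ∩ K) R E := by
  unfold PU at hpu
  push Not at hpu
  obtain ⟨Z, B, hZ, hB, F, hF, h1, h2, h3⟩ := hpu
  obtain ⟨f, hf, hfm, hfB⟩ := wadge' hX hK.gd hK.ne hZ hB h3
  choose F' hF' hFF using fun i => pull_closed hf (hF i)
  set 𝒴 : Set (Set Cantor) := {R | R.Nonempty ∧ ∃ V, ∃ E : ℕ → Set Cantor, IsClopen V ∧ (∀ n, IsClosed (E n)) ∧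
    R = (V ∩ K) \ ⋃ n, E n ∧ (∀ n, ¬ Red K X (K ∩ E n) X) ∧ ¬ Red K X R X} with h𝒴
  have hflip : ∀ Y ⊆ K, Red Y Xᶜ K X → ¬ Red K X Y X := fun Y _ h h' => hK.not_self_dual hX (h'.compl.trans h)
  have hsm : ∀ i, ¬ Red K X (K ∩ F' i) X := fun i => by
    refine hflip _ inter_subset_left (Red.trans ?_ (h1 i))
    exact Red.restrict hf hfB inter_subset_left fun x hx => ⟨hfm hx.1, (hFF i x hx.1).1 hx.2⟩
  have h0 : ((univ ∩ K) \ ⋃ n, F' n) ∈ 𝒴 := by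
    refine ⟨baire_in hK.gd hF' (fun n => nd_of_small hK (hsm n)) isClopen_univ (by simpa using hK.ne),
      univ, F', isClopen_univ, hF', rfl, hsm, ?_⟩
    refine hflip _ (sdiff_subset.trans inter_subset_right) (Red.trans ?_ h2)
    refine Red.restrict hf hfB (sdiff_subset.trans inter_subset_right) fun x hx => ⟨hfm hx.1.2, fun h => hx.2 ?_⟩
    obtain ⟨n, hn⟩ := mem_iUnion.1 h
    exact mem_iUnion.2 ⟨n, (hFF n x hx.1.2).2 hn⟩
  obtain ⟨R, hR, hRmin⟩ : ∃ R ∈ 𝒴, ∀ R' ∈ 𝒴, ¬ (Red R' X R X ∧ Red R' Xᶜ R X) := by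
    by_contra hc
    push Not at hc
    refine monk hX (𝒵 := 𝒴) ?_ ?_ ?_ h0
    · rintro R ⟨hne, V, E, hV, hE, rfl, -⟩
      exact ⟨gdiff (clopen_gd hV hK.gd) ⟨E, hE, rfl⟩, hne⟩
    · rintro R ⟨hne, V, E, hV, hE, rfl, hs, hr⟩ W hW hWne
      refine ⟨hWne, W ∩ V, E, hW.inter hV, hE, ?_, hs, fun h => hr (h.trans (Red.sub _ inter_subset_right))⟩
      ext x; simp only [mem_inter_iff, Set.mem_sdiff]; tauto
    · intro R hR
      obtain ⟨R', h⟩ := hc R hR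
      exact ⟨R', h⟩
  obtain ⟨hne, V, E, hV, hE, rfl, hs, hr⟩ := hR
  have hVK : (V ∩ K).Nonempty := hne.mono sdiff_subset
  have hup : Red (V ∩ K) X K X := Red.sub _ inter_subset_right
  have hdn := hK.red V hV hVK
  set R := (V ∩ K) \ ⋃ n, E n with hRd
  have hRg : IsGδ R := gdiff (clopen_gd hV hK.gd) ⟨E, hE, rfl⟩
  have hmin : ∀ W, IsClopen W → ∀ F : ℕ → Set Cantor, (∀ j, IsClosed (F j)) → (∀ j, ¬ Red (V ∩ K) X ((V ∩ K) ∩ F j) X) →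
    (W ∩ R).Nonempty → Red R X (W ∩ (R \ ⋃ j, F j)) X := by
    intro W hW F hF hFs hWne
    have hin : (W ∩ (R \ ⋃ j, F j)) ∈ 𝒴 := by
      have he : W ∩ (R \ ⋃ j, F j) = ((W ∩ V) ∩ K) \ ⋃ j, mix E (fun j => V ∩ F j) j := by
        ext x
        simp only [iUnion_mix, hRd, mem_inter_iff, Set.mem_sdiff, mem_union, mem_iUnion]
        push Not
        constructor
        · rintro ⟨a, ⟨⟨b, c⟩, d⟩, e⟩
          exact ⟨⟨⟨a, b⟩, c⟩, d, fun j _ => e j⟩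
        · rintro ⟨⟨⟨a, b⟩, c⟩, d, e⟩
          exact ⟨a, ⟨⟨b, c⟩, d⟩, fun j => e j b⟩
      have hcl : ∀ j, IsClosed (mix E (fun j => V ∩ F j) j) := mix_all hE fun j => hV.1.inter (hF j)
      have hsm' : ∀ j, ¬ Red K X (K ∩ mix E (fun j => V ∩ F j) j) X :=
        mix_all (P := fun A => ¬ Red K X (K ∩ A) X) hs fun j h => hFs j (hup.trans (by
          rwa [← inter_assoc, inter_comm K V] at h))
      refine ⟨?_, W ∩ V, _, hW.inter hV, hcl, he, hsm', fun h => hr (h.trans (Red.sub _ (inter_subset_right.trans sdiff_subset)))⟩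
      rw [he]
      refine baire_in hK.gd hcl (fun n => nd_of_small hK (hsm' n)) (hW.inter hV) ?_
      exact hWne.mono fun x hx => ⟨⟨hx.1, hx.2.1.1⟩, hx.2.1.2⟩
    have h5 := hRmin _ hin
    have h6 : ¬ Red (W ∩ (R \ ⋃ j, F j)) Xᶜ R X := fun h => h5 ⟨Red.sub _ (inter_subset_right.trans sdiff_subset), h⟩
    exact (wadge' hX hRg hne (clopen_gd hW (gdiff hRg ⟨F, hF, rfl⟩)) hX.compl h6).of_compl
  exact ⟨V, R, E, hV, hK.shrink hV hVK, fun n h => hdd n (DD.pull hdn h), hE, rfl, hne,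
    fun n h => hs n (hdn.trans (h.trans (Red.sub _ (inter_subset_inter_left _ inter_subset_right)))),
    fun h => hr (hdn.trans h), hmin⟩

theorem Cfg.refine {X K R : Set Cantor} {E : ℕ → Set Cantor} (hX : MeasurableSet X) (h : Cfg X K R E) :
    ∃ E', Cfg X K R E' ∧ ∀ n, K ∩ E' n = ∅ ∨ Unif X (K ∩ E' n) := by
  choose D hD hDc hDu using fun n => dcp hX (h.unif.gd.inter (h.cl n).isGδ)
  refine ⟨fun k => E k.unpair.1 ∩ D k.unpair.1 k.unpair.2, ⟨h.unif, h.ndd, fun n => (h.cl _).inter (hD _ _), ?_, h.ne, ?_,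
    h.rsmall, h.min⟩, fun n => ?_⟩
  · rw [h.rest]
    ext x
    simp only [Set.mem_sdiff, mem_iUnion]
    refine and_congr_right fun hxK => not_congr ⟨?_, ?_⟩
    · rintro ⟨n, hn⟩
      obtain ⟨j, hj⟩ := mem_iUnion.1 (hDc n ⟨hxK, hn⟩)
      exact ⟨Nat.pair n j, by simpa using ⟨hn, hj⟩⟩
    · rintro ⟨k, hk⟩
      exact ⟨_, hk.1⟩
  · exact fun n h' => h.small n.unpair.1 (h'.trans (Red.sub _ (inter_subset_inter_right _ inter_subset_left)))
  · rw [← inter_assoc]; exact hDu _ _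

theorem Cfg.runif {X K R : Set Cantor} {E : ℕ → Set Cantor} (h : Cfg X K R E) : Unif X R where
  gd := by rw [h.rest]; exact gdiff h.unif.gd ⟨E, h.cl, rfl⟩
  ne := h.ne
  red := fun V hV hne => by
    have := h.min V hV (fun _ => ∅) (fun _ => isClosed_empty) (fun _ => by
      rw [inter_empty]
      rintro ⟨f, -, hf, -⟩
      obtain ⟨x, hx⟩ := h.unif.ne
      exact hf hx) hne
    simpa using this

/-- structure lemma -/
theorem Cfg.struct {X K R : Set Cantor} {E : ℕ → Set Cantor} (hX : MeasurableSet X) (h : Cfg X K R E)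
    {Z B : Set Cantor} (hZ : IsGδ Z) (hB : MeasurableSet B) {C : ℕ → Set Cantor} (hC : ∀ i, IsClosed (C i))
    (hs : ∀ i, Small X K (Z ∩ C i) B) (hr : Red (Z \ ⋃ i, C i) B R X) : Red Z B K X := by
  by_contra hcon
  obtain ⟨f, hf, hfm, hfB⟩ := wadge' hX h.unif.gd h.unif.ne hZ hB hcon
  choose F' hF' hFF using fun i => pull_closed hf (hC i)
  have h1 : ∀ i, ¬ Red K X (K ∩ F' i) X := fun i h' => by
    refine (hs i).2 (h'.compl.trans ?_)
    exact Red.restrict hf hfB inter_subset_left fun x hx => ⟨hfm hx.1, (hFF i x hx.1).1 hx.2⟩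
  have h2 : Red (R \ ⋃ i, F' i) Xᶜ R X := by
    refine Red.trans ?_ hr
    have hRK : R ⊆ K := by rw [h.rest]; exact sdiff_subset
    refine Red.restrict hf hfB (sdiff_subset.trans hRK) fun x hx => ⟨hfm (hRK hx.1), fun h' => hx.2 ?_⟩
    obtain ⟨n, hn⟩ := mem_iUnion.1 h'
    exact mem_iUnion.2 ⟨n, (hFF n x (hRK hx.1)).2 hn⟩
  have h3 := h.min univ isClopen_univ F' hF' h1 (by simpa using h.ne)
  rw [univ_inter] at h3
  exact h.runif.not_self_dual hX (h3.compl.trans h2)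

/-- Lemma (+) -/
theorem Cfg.plus {X K R : Set Cantor} {E : ℕ → Set Cantor} (h : Cfg X K R E)
    (hR1 : (R ∩ X).Nonempty) (hR2 : (R \ X).Nonempty)
    {Z B : Set Cantor} {C : ℕ → Set Cantor} (hC : ∀ i, IsClosed (C i))
    (hs : ∀ i, Small X K (Z ∩ C i) B)
    (hr : (∀ x ∈ Z, x ∉ ⋃ i, C i → x ∈ B) ∨ (∀ x ∈ Z, x ∉ ⋃ i, C i → x ∉ B)) : Small X K Z B := by
  have key : ∀ B, (∀ i, Small X K (Z ∩ C i) B) →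
      ((∀ x ∈ Z, x ∉ ⋃ i, C i → x ∈ B) ∨ (∀ x ∈ Z, x ∉ ⋃ i, C i → x ∉ B)) → ¬ Red K X Z B := by
    rintro B hs hr ⟨f, hf, hfm, hfB⟩
    choose F' hF' hFF using fun i => pull_closed hf (hC i)
    have h1 : ∀ i, ¬ Red K X (K ∩ F' i) X := fun i h' => by
      refine (hs i).1 (h'.trans ?_)
      exact Red.restrict hf hfB inter_subset_left fun x hx => ⟨hfm hx.1, (hFF i x hx.1).1 hx.2⟩
    have hRK : R ⊆ K := by rw [h.rest]; exact sdiff_subset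
    obtain ⟨g, hg, hgm, hgX⟩ := h.min univ isClopen_univ F' hF' h1 (by simpa using h.ne)
    have h4 : ∀ x ∈ R, f (g x) ∈ Z ∧ f (g x) ∉ ⋃ i, C i ∧ (x ∈ X ↔ f (g x) ∈ B) := by
      intro x hx
      have h5 := (hgm hx).2
      have h6 := hRK h5.1
      refine ⟨hfm h6, fun h' => h5.2 ?_, (hgX x hx).trans (hfB _ h6)⟩
      obtain ⟨n, hn⟩ := mem_iUnion.1 h'
      exact mem_iUnion.2 ⟨n, (hFF n _ h6).2 hn⟩
    obtain ⟨a, ha, haX⟩ := hR1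
    obtain ⟨b, hb, hbX⟩ := hR2
    obtain ⟨a1, a2, a3⟩ := h4 a ha
    obtain ⟨b1, b2, b3⟩ := h4 b hb
    rcases hr with hr | hr
    · exact hbX (b3.2 (hr _ b1 b2))
    · exact hr _ a1 a2 (a3.1 haX)
  refine ⟨key B hs hr, fun h' => key Bᶜ (fun i => (hs i).compl) ?_ (Red.of_compl (by simpa using h'))⟩
  rcases hr with hr | hr
  · exact Or.inr fun x hx hxC => not_not.2 (hr x hx hxC)
  · exact Or.inl hr

theorem Cfg.rndd {X K R : Set Cantor} {E : ℕ → Set Cantor} (hX : MeasurableSet X) (h : Cfg X K R E)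
    (hR1 : (R ∩ X).Nonempty) (hR2 : (R \ X).Nonempty) (n : ℕ) : ¬ DD n R X := by
  have hRK : R ⊆ K := by rw [h.rest]; exact sdiff_subset
  have key : ∀ n, ∀ C : ℕ → Set Cantor, (∀ i, IsClosed (C i)) → (∀ i, ¬ Red K X (K ∩ C i) X) →
      ¬ DD n (R \ ⋃ i, C i) X := by
    intro n
    induction n with
    | zero =>
      intro C hC hs hd
      have h3 := h.min univ isClopen_univ C hC hs (by simpa using h.ne)
      rw [univ_inter] at h3
      obtain ⟨a, ha, haX⟩ := hR1
      obtain ⟨b, hb, hbX⟩ := hR2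
      rcases DD.pull h3 hd with h4 | h4
      · exact hbX (h4 b hb)
      · exact h4 a ha haX
    | succ n ih =>
      rintro C hC hs ⟨F0, F1, ⟨G0, hG0, rfl⟩, ⟨G1, hG1, rfl⟩, hF0, hF1, hd⟩
      have aux : ∀ G, ((∀ x ∈ R \ ⋃ i, C i, x ∈ G → x ∈ X) ∨ (∀ x ∈ R \ ⋃ i, C i, x ∈ G → x ∉ X)) →
          ¬ Red K X (K ∩ G) X := by
        intro G hr
        refine (h.plus hR1 hR2 (Z := K ∩ G) (B := X) (C := mix E C) (mix_all h.cl hC) (fun i => ?_) ?_).1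
        · refine (small_of hX h.unif inter_subset_left (mix_all (P := fun A => ¬ Red K X (K ∩ A) X) h.small hs i)).mono ?_
          exact inter_subset_inter_left _ inter_subset_left
        · have : ∀ x ∈ K ∩ G, x ∉ ⋃ i, mix E C i → x ∈ R \ ⋃ i, C i := by
            intro x hx hxm
            rw [iUnion_mix, mem_union, not_or] at hxm
            rw [h.rest]
            exact ⟨⟨hx.1, hxm.1⟩, hxm.2⟩
          exact hr.imp (fun hr x hx hxm => hr x (this x hx hxm) hx.2) (fun hr x hx hxm => hr x (this x hx hxm) hx.2)
      refine ih (mix C (mix G0 G1)) (mix_all hC (mix_all hG0 hG1))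
        (mix_all (P := fun A => ¬ Red K X (K ∩ A) X) hs (mix_all (P := fun A => ¬ Red K X (K ∩ A) X) ?_ ?_)) ?_
      · exact fun i => aux _ (Or.inr fun x hx hxG => hF0 x hx (mem_iUnion.2 ⟨i, hxG⟩))
      · exact fun i => aux _ (Or.inl fun x hx hxG => hF1 x hx (mem_iUnion.2 ⟨i, hxG⟩))
      · rw [iUnion_mix, iUnion_mix]
        have he : R \ ((⋃ n, C n) ∪ ((⋃ n, G0 n) ∪ ⋃ n, G1 n)) = (R \ ⋃ n, C n) \ ((⋃ n, G0 n) ∪ ⋃ n, G1 n) := by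
          ext x; simp only [Set.mem_sdiff, mem_union]; tauto
        rwa [he]
  have := key n (fun _ => ∅) (fun _ => isClosed_empty) (fun _ => by
      rw [inter_empty]
      rintro ⟨f, -, hf, -⟩
      obtain ⟨x, hx⟩ := h.unif.ne
      exact hf hx)
  simpa using this

def IH (X K : Set Cantor) : Prop :=
  ∀ Z ⊆ K, Unif X Z → (∀ n, ¬ DD n Z X) → ¬ Red K X Z X → Good X Z

theorem dom {X K E : Set Cantor} (hX : MeasurableSet X) (hK : Unif X K) (hdd : ∀ n, ¬ DD n K X) (hih : IH X K)
    (hE : IsClosed E) (hu : K ∩ E = ∅ ∨ Unif X (K ∩ E)) (hs : ¬ Red K X (K ∩ E) X) :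
    ∃ S r, Sfl S ∧ ContinuousOn r K ∧ (∀ x ∈ K, x ∈ E → (x ∈ X ↔ r x ∈ S)) ∧
      ∀ Z B, IsGδ Z → MeasurableSet B → StarDec Z B univ S → Small X K Z B := by
  by_cases hd : ∃ m, DD m (K ∩ E) X
  · obtain ⟨m, hm⟩ := hd
    obtain ⟨S, hS, ⟨k, hk⟩, hr⟩ := dd_sfl m
    obtain ⟨r, hr, hrX⟩ := hr _ _ hm
    exact ⟨S, r, hS, hr.continuousOn, fun x hx hxE => hrX x ⟨hx, hxE⟩, fun Z B _ _ hst =>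
      Small.of_dd hdd (DD.of_starDec hst hk)⟩
  · push Not at hd
    have hu : Unif X (K ∩ E) := by
      rcases hu with hu | hu
      · exact absurd (hd 0) (by rw [hu]; exact not_not.2 (Or.inl (by simp)))
      · exact hu
    obtain ⟨S, hS, h1, h2, -, -⟩ := hih _ inter_subset_left hu hd hs
    have habs := abs_or_dd hX hu hd
    have h3 : Red K (X ∩ E) (K ∩ E) X := by
      refine habs _ _ hK.gd (hX.inter hE.measurableSet) ⟨Eᶜ, ∅, IsFs.open hE.isOpen_compl, IsFs.empty,
        fun x _ hx h => hx h.2, by simp, id, continuousOn_id, fun x hx => ⟨hx.1, ?_⟩, fun x hx => ?_⟩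
      · by_contra hc; exact hx.2 (Or.inl hc)
      · have : x ∈ E := by by_contra hc; exact hx.2 (Or.inl hc)
        simp [this]
    obtain ⟨r, hr, -, hrX⟩ := h3.trans h1
    refine ⟨S, r, hS, hr, fun x hx hxE => ?_, fun Z B hZ hB hst => ?_⟩
    · rw [← hrX x hx]; simp [hxE]
    · have h4 := habs Z B hZ hB (hst.push h2)
      have h5 := small_of hX hK inter_subset_left hs
      exact ⟨fun h' => h5.1 (h'.trans h4), fun h' => h5.2 (h'.trans h4)⟩

end HS



namespace HS

open Topology Filter

def SP (S : ℕ → Set Cantor) : Set Cantor :=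
  (⋃ n, (row (2*n) ⁻¹' Cof ∩ row (2*n+1) ⁻¹' S n)) ∪
    ⋃ p : {p : ℕ × ℕ // p.1 ≠ p.2}, (row (2*p.1.1) ⁻¹' Cof ∩ row (2*p.1.2) ⁻¹' Cof)

theorem mem_SP {S : ℕ → Set Cantor} {z : Cantor} : z ∈ SP S ↔
    (∃ n, row (2*n) z ∈ Cof ∧ row (2*n+1) z ∈ S n) ∨ ∃ m n, m ≠ n ∧ row (2*m) z ∈ Cof ∧ row (2*n) z ∈ Cof := by
  simp only [SP, mem_union, mem_iUnion, mem_inter_iff, mem_preimage, Subtype.exists, Prod.exists, exists_prop]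

theorem sfl_SP {S : ℕ → Set Cantor} (h : ∀ n, Sfl (S n)) : Sfl (SP S) :=
  (Sfl.iUnion fun n => (sfl_Cof.row _).inter ((h n).row _)).union
    (Sfl.iUnion fun _ => (sfl_Cof.row _).inter (sfl_Cof.row _))

def SPp (k : ℕ) : Set Cantor := row (2*k.unpair.1) ⁻¹' CofN k.unpair.2

theorem closed_SPp (k : ℕ) : IsClosed (SPp k) := (isClosed_CofN _).preimage (continuous_row _)

theorem mem_SPp {z : Cantor} : z ∈ ⋃ k, SPp k ↔ ∃ n, row (2*n) z ∈ Cof := by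
  simp only [SPp, mem_iUnion, mem_preimage, Cof]
  constructor
  · rintro ⟨k, hk⟩; exact ⟨_, _, hk⟩
  · rintro ⟨n, j, hk⟩; exact ⟨Nat.pair n j, by simpa using hk⟩

theorem SP_sub (S : ℕ → Set Cantor) : SP S ⊆ ⋃ k, SPp k := by
  intro z hz
  rw [mem_SPp]
  rcases mem_SP.1 hz with ⟨n, h, -⟩ | ⟨m, n, -, h, -⟩
  · exact ⟨n, h⟩
  · exact ⟨m, h⟩

theorem meagre_SP (S : ℕ → Set Cantor) : IsMeagre (SP S) := by
  have h : IsMeagre (⋃ n, row (2*n) ⁻¹' Cof) := isMeagre_iUnion fun n => IsMeagre.row meagre_Cof _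
  refine h.mono ?_
  intro z hz
  rw [mem_iUnion]
  exact mem_SPp.1 (SP_sub S hz)

theorem SP_star {S : ℕ → Set Cantor} {n : ℕ} {Z B : Set Cantor} {g : Cantor → Cantor} (hg : Continuous g)
    (hB : ∀ z ∈ Z, (z ∈ B ↔ g z ∈ SP S)) (hc : ∀ z ∈ Z, row (2*n) (g z) ∈ Cof) : StarDec Z B univ (S n) := by
  refine ⟨∅, ⋃ m, (if m = n then ∅ else (fun z => row (2*m) (g z)) ⁻¹' Cof), IsFs.empty, IsFs.iUnion fun m => ?_, by simp,
    fun z hz hzF => ?_, fun z => row (2*n+1) (g z), ((continuous_row _).comp hg).continuousOn, fun _ _ => mem_univ _,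
    fun z hz => ?_⟩
  · split_ifs
    · exact IsFs.empty
    · exact IsFs.preimage ((continuous_row _).comp hg) fs_Cof
  · obtain ⟨m, hm⟩ := mem_iUnion.1 hzF
    split_ifs at hm with hmn
    · exact absurd hm (by simp)
    · rw [hB z hz, mem_SP]
      exact Or.inr ⟨m, n, hmn, hm, hc z hz⟩
  · have hz2 : ∀ m, m ≠ n → row (2*m) (g z) ∉ Cof := by
      intro m hm h
      refine hz.2 (Or.inr (mem_iUnion.2 ⟨m, ?_⟩))
      rw [if_neg hm]; exact h
    rw [hB z hz.1, mem_SP]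
    constructor
    · rintro (⟨m, h1, h2⟩ | ⟨m, m', hne, h1, h2⟩)
      · by_cases hm : m = n
        · rw [← hm]; exact h2
        · exact absurd h1 (hz2 m hm)
      · by_cases hm : m = n
        · exact absurd h2 (hz2 m' (by omega))
        · exact absurd h1 (hz2 m hm)
    · intro h
      exact Or.inl ⟨n, hc z hz.1, h⟩

theorem SP_code {X K : Set Cantor} {E S : ℕ → Set Cantor} {r : ℕ → Cantor → Cantor} (hE : ∀ n, IsClosed (E n))
    (hr : ∀ n, ContinuousOn (r n) K) (hrX : ∀ n, ∀ x ∈ K, x ∈ E n → (x ∈ X ↔ r n x ∈ S n)) :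
    ∃ w, ContinuousOn w K ∧ ∀ x ∈ K, (x ∈ ⋃ n, E n → (x ∈ X ↔ w x ∈ SP S)) ∧ (x ∉ ⋃ n, E n → w x ∉ SP S) := by
  classical
  choose u hu huH using fun n => trigger (H := E n \ ⋃ m ∈ Finset.range n, E m) (by
    have hcl : IsClosed (⋃ m ∈ Finset.range n, E m) :=
      Set.Finite.isClosed_biUnion (Finset.finite_toSet _) fun m _ => hE m
    exact IsFs.inter (IsFs.closed (hE n)) (IsFs.open hcl.isOpen_compl))
  let W : ℕ → Cantor → Cantor := fun k x => if Even k then u (k/2) x else r (k/2) x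
  have hW0 : ∀ n x, W (2*n) x = u n x := fun n x => by simp [W]
  have hW1 : ∀ n x, W (2*n+1) x = r n x := fun n x => by
    simp only [W]; rw [if_neg (by simp), show (2*n+1)/2 = n by omega]
  refine ⟨fun x => tup fun k => W k x, continuousOn_tup fun k => ?_, fun x hx => ⟨fun hxE => ?_, fun hxE h => ?_⟩⟩
  · simp only [W]
    split_ifs
    · exact (hu _).continuousOn
    · exact hr _
  · have hex := mem_iUnion.1 hxE
    set n := Nat.find hex with hn
    have h1 : x ∈ E n := Nat.find_spec hex
    have h2 : ∀ m, (x ∈ E m \ ⋃ k ∈ Finset.range m, E k) ↔ m = n := by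
      intro m
      constructor
      · rintro ⟨h3, h4⟩
        simp only [mem_iUnion, not_exists, Finset.mem_range] at h4
        have h5 : n ≤ m := Nat.find_min' hex h3
        by_contra hne
        exact h4 n (by omega) h1
      · rintro rfl
        refine ⟨h1, ?_⟩
        simp only [mem_iUnion, not_exists, Finset.mem_range]
        intro k hk
        exact Nat.find_min hex hk
    rw [mem_SP]
    simp only [row_tup, hW0, hW1, ← huH, h2]
    rw [hrX n x hx h1]
    constructor
    · intro h; exact Or.inl ⟨n, rfl, h⟩
    · rintro (⟨m, rfl, h⟩ | ⟨m, m', hne, h1, h2⟩)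
      · exact h
      · omega
  · have : ∀ n, u n x ∉ Cof := fun n h => hxE (mem_iUnion.2 ⟨n, ((huH n x).2 h).1⟩)
    rw [mem_SP] at h
    simp only [row_tup, hW0, this, false_and, and_false, exists_false, or_false] at h

theorem case2a {X K R : Set Cantor} {E S : ℕ → Set Cantor} (hX : MeasurableSet X) (h : Cfg X K R E)
    {w : Cantor → Cantor} (hS : ∀ n, Sfl (S n))
    (hsm : ∀ n Z B, IsGδ Z → MeasurableSet B → StarDec Z B univ (S n) → Small X K Z B)
    (hw : ContinuousOn w K)
    (hwX : ∀ x ∈ K, (x ∈ ⋃ n, E n → (x ∈ X ↔ w x ∈ SP S)) ∧ (x ∉ ⋃ n, E n → w x ∉ SP S))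
    (hR : ∀ x ∈ R, x ∉ X) : ∃ S, Sfl S ∧ IsMeagre S ∧ Red K X univ S ∧ Red univ S K X := by
  refine ⟨SP S, sfl_SP hS, meagre_SP S, ⟨w, hw, fun _ _ => mem_univ _, fun x hx => ?_⟩, ?_⟩
  · by_cases hxE : x ∈ ⋃ n, E n
    · exact (hwX x hx).1 hxE
    · have h1 := (hwX x hx).2 hxE
      have h2 : x ∈ R := by rw [h.rest]; exact ⟨hx, hxE⟩
      simp [h1, hR x h2]
  · refine h.struct hX IsGδ.univ (sfl_SP hS).ms closed_SPp (fun k => ?_) ?_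
    · refine hsm k.unpair.1 _ _ (IsGδ.univ.inter (closed_SPp k).isGδ) (sfl_SP hS).ms
        (SP_star continuous_id (fun z _ => Iff.rfl) fun z hz => ?_)
      exact mem_iUnion.2 ⟨_, hz.2⟩
    · obtain ⟨a, ha⟩ := h.ne
      refine Red.const ha fun z hz => ?_
      simp only [hR a ha, iff_false]
      exact fun h' => hz.2 (SP_sub S h')

def S2 (S : ℕ → Set Cantor) (T : Set Cantor) : Set Cantor :=
  (row 0 ⁻¹' Cof ∩ (row 1 ⁻¹' Fnᶜ ∪ row 2 ⁻¹' SP S)) ∪ (row 1 ⁻¹' Fnᶜ ∩ row 3 ⁻¹' T)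

theorem case2b {X K R : Set Cantor} {E S : ℕ → Set Cantor} (hX : MeasurableSet X) (h : Cfg X K R E)
    {w : Cantor → Cantor} (hS : ∀ n, Sfl (S n))
    (hsm : ∀ n Z B, IsGδ Z → MeasurableSet B → StarDec Z B univ (S n) → Small X K Z B)
    (hw : ContinuousOn w K)
    (hwX : ∀ x ∈ K, (x ∈ ⋃ n, E n → (x ∈ X ↔ w x ∈ SP S)) ∧ (x ∉ ⋃ n, E n → w x ∉ SP S))
    (hR1 : (R ∩ X).Nonempty) (hR2 : (R \ X).Nonempty) {T : Set Cantor} (hT : Sfl T) (hTm : IsMeagre T)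
    (hT1 : Red R X univ T) (hT2 : Red univ T R X) :
    ∃ S, Sfl S ∧ IsMeagre S ∧ Red K X univ S ∧ Red univ S K X := by
  have hEf : IsFsigma (⋃ n, E n) := ⟨E, h.cl, rfl⟩
  have habs := abs_or_dd hX h.runif (h.rndd hX hR1 hR2)
  have hsfl : Sfl (S2 S T) :=
    ((sfl_Cof.row 0).inter ((sfl_Inf.row 1).union ((sfl_SP hS).row 2))).union ((sfl_Inf.row 1).inter (hT.row 3))
  refine ⟨S2 S T, hsfl, ?_, ?_, ?_⟩
  · have h : IsMeagre (row 0 ⁻¹' Cof ∪ row 3 ⁻¹' T) := (IsMeagre.row meagre_Cof 0).union (IsMeagre.row hTm 3)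
    refine h.mono ?_
    rintro z (hz | hz)
    · exact Or.inl hz.1
    · exact Or.inr hz.2
  · obtain ⟨u, hu, huE⟩ := trigger hEf
    have h1 : Red K (X \ ⋃ n, E n) R X := by
      refine habs _ _ h.unif.gd (hX.diff (IsFs.meas hEf)) ⟨⋃ n, E n, ∅, hEf, IsFs.empty, fun x _ hx h' => h'.2 hx, by simp,
        id, continuousOn_id, fun x hx => ?_, fun x hx => ?_⟩
      · rw [h.rest]; simpa using hx
      · have : x ∉ ⋃ n, E n := fun h' => hx.2 (Or.inl h')
        simp only [Set.mem_sdiff, this, not_false_eq_true, and_true, id]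
    obtain ⟨y, hy, -, hyX⟩ := h1.trans hT1
    let W : ℕ → Cantor → Cantor := fun k x => if k = 0 then u x else if k = 1 then neg (u x) else if k = 2 then w x else y x
    refine ⟨fun x => tup fun k => W k x, continuousOn_tup fun k => ?_, fun _ _ => mem_univ _, fun x hx => ?_⟩
    · simp only [W]
      split_ifs
      · exact hu.continuousOn
      · exact (continuous_neg.comp hu).continuousOn
      · exact hw
      · exact hy
    · simp only [S2, mem_union, mem_inter_iff, mem_preimage, row_tup, mem_compl_iff]
      have e0 : W 0 x = u x := rfl
      have e1 : W 1 x = neg (u x) := rfl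
      have e2 : W 2 x = w x := rfl
      have e3 : W 3 x = y x := rfl
      rw [e0, e1, e2, e3, neg_mem_Fn, ← huE, ← hyX x hx]
      by_cases hxE : x ∈ ⋃ n, E n
      · simp only [hxE, true_and, not_true_eq_false, false_or, false_and, or_false]
        exact (hwX x hx).1 hxE
      · simp only [hxE, false_and, not_false_eq_true, true_and, false_or, Set.mem_sdiff, and_true]
  · set B := S2 S T with hB
    have memB : ∀ z, z ∈ B ↔ (row 0 z ∈ Cof ∧ (row 1 z ∉ Fn ∨ row 2 z ∈ SP S)) ∨ (row 1 z ∉ Fn ∧ row 3 z ∈ T) :=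
      fun z => Iff.rfl
    let A : ℕ → Set Cantor := fun j => row 0 ⁻¹' CofN j
    let G : ℕ → Set Cantor := fun j => row 1 ⁻¹' FinN j
    have hA : ∀ j, IsClosed (A j) := fun j => (isClosed_CofN j).preimage (continuous_row 0)
    have hG : ∀ j, IsClosed (G j) := fun j => (isClosed_FinN j).preimage (continuous_row 1)
    have mA : ∀ z, z ∈ ⋃ j, A j ↔ row 0 z ∈ Cof := fun z => by simp [A, Cof]
    have mG : ∀ z, z ∈ ⋃ j, G j ↔ row 1 z ∈ Fn := fun z => by simp [G, Fn]
    have hAG : ∀ i j, Small X K (A i ∩ G j) B := by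
      intro i j
      have hBe : ∀ z ∈ A i ∩ G j, (z ∈ B ↔ row 2 z ∈ SP S) := by
        intro z hz
        have h1 := (mA z).1 (mem_iUnion.2 ⟨i, hz.1⟩)
        have h2 := (mG z).1 (mem_iUnion.2 ⟨j, hz.2⟩)
        rw [memB]; simp [h1, h2]
      refine h.plus hR1 hR2 (C := fun k => row 2 ⁻¹' SPp k) (fun k => (closed_SPp k).preimage (continuous_row 2)) (fun k => ?_) (Or.inr fun z hz hzC => ?_)
      · refine hsm k.unpair.1 _ _ ?_ hsfl.ms (SP_star (continuous_row 2) (fun z hz => hBe z hz.1) fun z hz => ?_)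
        · exact (((hA i).inter (hG j)).inter ((closed_SPp k).preimage (continuous_row 2))).isGδ
        · exact mem_iUnion.2 ⟨_, hz.2⟩
      · rw [hBe z hz]
        intro h'
        rw [← preimage_iUnion] at hzC
        exact hzC (SP_sub S h')
    have hAs : ∀ i, Small X K (A i) B := by
      intro i
      refine h.plus hR1 hR2 hG (hAG i) (Or.inl fun z hz hzG => ?_)
      rw [mG] at hzG
      have h1 := (mA z).1 (mem_iUnion.2 ⟨i, hz⟩)
      exact (memB z).2 (Or.inl ⟨h1, Or.inl hzG⟩)
    have hGs : ∀ i, Small X K (G i) B := by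
      intro i
      refine h.plus hR1 hR2 hA (fun j => by rw [inter_comm]; exact hAG j i) (Or.inr fun z hz hzA => ?_)
      rw [mA] at hzA
      have h1 := (mG z).1 (mem_iUnion.2 ⟨i, hz⟩)
      rw [memB]; simp [h1, hzA]
    refine h.struct hX IsGδ.univ hsfl.ms (C := mix A G) (mix_all hA hG) (fun k => ?_) ?_
    · rw [univ_inter]
      exact mix_all (P := fun C => Small X K C B) hAs hGs k
    · refine Red.trans ⟨row 3, (continuous_row 3).continuousOn, fun _ _ => mem_univ _, fun z hz => ?_⟩ hT2
      have h1 := hz.2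
      rw [iUnion_mix, mem_union, mA, mG, not_or] at h1
      rw [memB]; simp [h1.1, h1.2]

theorem main_lemma {X K : Set Cantor} (hX : MeasurableSet X) (hK : Unif X K) (hdd : ∀ n, ¬ DD n K X)
    (hih : IH X K) (hm : MgrIn X K) : Good X K := by
  by_cases hpu : PU X K
  · obtain ⟨S, hS, hSm, h1, h2⟩ := case1 hX hK hdd hpu
    exact ⟨S, hS, h1, h2, fun _ => hSm, fun h => (hm.not_both hK.gd hK.ne h).elim⟩
  · obtain ⟨V, R, E0, hV, hcfg0⟩ := exists_cfg hX hK hdd hpu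
    have hdn : Red K X (V ∩ K) X := hK.red V hV hcfg0.unif.ne
    refine Good.of_shrink hV hdn ?_
    have hm' : MgrIn X (V ∩ K) := hm.shrink hV
    have hih' : IH X (V ∩ K) := fun Z hZ hu hd hr => hih Z (hZ.trans inter_subset_right) hu hd
      fun h => hr ((Red.sub _ inter_subset_right).trans h)
    obtain ⟨E, hcfg, hE⟩ := hcfg0.refine hX
    generalize V ∩ K = K at *
    choose S r hS hr hrX hsm using fun n => dom hX hcfg.unif hcfg.ndd hih' (hcfg.cl n) (hE n) (hcfg.small n)
    obtain ⟨w, hw, hwX⟩ := SP_code hcfg.cl hr hrX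
    have hfin : ∃ S, Sfl S ∧ IsMeagre S ∧ Red K X univ S ∧ Red univ S K X := by
      by_cases hR1 : (R ∩ X).Nonempty
      · obtain ⟨F, hF, hFn, hFc⟩ := hm'
        have hnd : ∀ n, ND (E n) K := fun n => nd_of_small hcfg.unif (hcfg.small n)
        have hR2 : (R \ X).Nonempty := by
          obtain ⟨x, hx, hxF⟩ := baire_in hcfg.unif.gd (F := mix E F) (mix_all hcfg.cl hF)
            (mix_all (P := fun A => ND A K) hnd hFn) isClopen_univ (by simpa using hcfg.unif.ne)
          rw [iUnion_mix, mem_union, not_or] at hxF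
          refine ⟨x, by rw [hcfg.rest]; exact ⟨hx.2, hxF.1⟩, fun h => hxF.2 (hFc ⟨h, hx.2⟩)⟩
        have hmR : MgrIn X R := by
          refine ⟨F, hF, fun n V hV hne => ?_, fun x hx => hFc ⟨hx.1, ?_⟩⟩
          · obtain ⟨x, hx, hxF⟩ := baire_in hcfg.unif.gd (F := mix E F) (mix_all hcfg.cl hF)
              (mix_all (P := fun A => ND A K) hnd hFn) hV (by
                rw [hcfg.rest] at hne
                exact hne.mono fun x hx => ⟨hx.1, hx.2.1⟩)
            rw [iUnion_mix, mem_union, not_or] at hxF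
            refine ⟨x, ⟨hx.1, by rw [hcfg.rest]; exact ⟨hx.2, hxF.1⟩⟩, fun h => hxF.2 (mem_iUnion.2 ⟨n, h⟩)⟩
          · have := hx.2
            rw [hcfg.rest] at this
            exact this.1
        have hRK : R ⊆ K := by rw [hcfg.rest]; exact sdiff_subset
        obtain ⟨T, hT, hT1, hT2, hT3, -⟩ := hih' R hRK hcfg.runif (hcfg.rndd hX hR1 hR2) hcfg.rsmall
        exact case2b hX hcfg hS hsm hw hwX hR1 hR2 hT (hT3 hmR) hT1 hT2
      · exact case2a hX hcfg hS hsm hw hwX fun x hx hxX => hR1 ⟨x, hx, hxX⟩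
    obtain ⟨S, hS, hSm, h1, h2⟩ := hfin
    exact ⟨S, hS, h1, h2, fun _ => hSm, fun h => (hm'.not_both hcfg.unif.gd hcfg.unif.ne h).elim⟩

theorem good {X K : Set Cantor} (hX : MeasurableSet X) (hK : Unif X K) (hdd : ∀ n, ¬ DD n K X) : Good X K := by
  by_contra hbad
  obtain ⟨K, ⟨hK, hdd, hbad⟩, hmin⟩ : ∃ K ∈ {K | Unif X K ∧ (∀ n, ¬ DD n K X) ∧ ¬ Good X K},
      ∀ K' ∈ {K | Unif X K ∧ (∀ n, ¬ DD n K X) ∧ ¬ Good X K}, ¬ (Red K' X K X ∧ Red K' Xᶜ K X) := by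
    by_contra hc
    push Not at hc
    refine monk hX (𝒵 := {K | Unif X K ∧ (∀ n, ¬ DD n K X) ∧ ¬ Good X K}) ?_ ?_ ?_ (Z0 := K) ⟨hK, hdd, hbad⟩
    · rintro Z ⟨h, -⟩; exact ⟨h.gd, h.ne⟩
    · rintro Z ⟨h, h1, h2⟩ V hV hne
      exact ⟨h.shrink hV hne, fun n h3 => h1 n (DD.pull (h.red V hV hne) h3),
        fun h3 => h2 (h3.of_shrink hV (h.red V hV hne))⟩
    · intro Z hZ
      obtain ⟨Z', h⟩ := hc Z hZ
      exact ⟨Z', h⟩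
  have hih : IH X K := by
    intro Z hZ hu hd hr
    by_contra hb
    have h5 := hmin Z ⟨hu, hd, hb⟩
    have h6 : ¬ Red Z Xᶜ K X := fun h => h5 ⟨Red.sub _ hZ, h⟩
    exact hr (wadge' hX hK.gd hK.ne hu.gd hX.compl h6).of_compl
  obtain ⟨V, hV, hne, hmg⟩ := mgr_or hX hK.ne
  have hdn := hK.red V hV hne
  have hu := hK.shrink hV hne
  have hd : ∀ n, ¬ DD n (V ∩ K) X := fun n h => hdd n (DD.pull hdn h)
  have hih' : IH X (V ∩ K) := fun Z hZ hu hd hr => hih Z (hZ.trans inter_subset_right) hu hd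
      fun h => hr ((Red.sub _ inter_subset_right).trans h)
  apply hbad
  refine Good.of_shrink hV hdn ?_
  rcases hmg with hmg | hmg
  · exact main_lemma hX hu hd hih' hmg
  · have : Good Xᶜ (V ∩ K) := by
      refine main_lemma hX.compl hu.compl (fun n h => hd n (by simpa using h.compl)) ?_ hmg
      intro Z hZ hu hd hr
      exact (hih' Z hZ (by simpa using hu.compl) (fun n h => hd n h.compl) fun h => hr h.compl).compl
    simpa using this.compl

end HS



namespace HS

open Topology Filter

/-- `DD n` sets are in the class `Δ`. -/
theorem DD.seq {n : ℕ} {Z B : Set Cantor} (h : DD n Z B) :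
    ∃ A : ℕ → Set Cantor, (∀ k, IsFsigma (A k)) ∧ Monotone A ∧
      ∀ x ∈ Z, ∃ k, x ∈ A k ∧ (∀ m < k, x ∉ A m) ∧ (x ∈ B ↔ Odd k) := by
  induction n generalizing Z with
  | zero =>
    rcases h with h | h
    · refine ⟨fun k => if k = 0 then ∅ else univ, fun k => ?_, ?_, fun x hx => ⟨1, by simp, ?_, ?_⟩⟩
      · dsimp only
        split_ifs
        · exact IsFs.empty
        · exact IsFs.closed isClosed_univ
      · intro a b hab x hx
        by_cases ha : a = 0
        · simp [ha] at hx
        · have : b ≠ 0 := by omega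
          simp [this]
      · intro m hm
        have : m = 0 := by omega
        simp [this]
      · simp [h x hx]
    · exact ⟨fun k => univ, fun k => IsFs.closed isClosed_univ, fun _ _ _ => le_rfl,
        fun x hx => ⟨0, trivial, by simp, by simp [h x hx]⟩⟩
  | succ n ih =>
    obtain ⟨F0, F1, h0, h1, hF0, hF1, hR⟩ := h
    obtain ⟨A, hA, hAm, hAx⟩ := ih hR
    refine ⟨fun k => if k = 0 then F0 else if k = 1 then F0 ∪ F1 else (F0 ∪ F1) ∪ A (k-2), fun k => ?_, ?_, fun x hx => ?_⟩
    · dsimp only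
      split_ifs
      · exact h0
      · exact IsFs.union h0 h1
      · exact IsFs.union (IsFs.union h0 h1) (hA _)
    · intro a b hab x hx
      have hA' : a - 2 ≤ b - 2 := by omega
      have := @hAm _ _ hA' x
      dsimp only at hx ⊢
      split_ifs at hx ⊢ <;> (try simp only [mem_union] at hx ⊢) <;> first | omega | tauto
    · by_cases hx0 : x ∈ F0
      · exact ⟨0, by simpa using hx0, by simp, by simp [hF0 x hx hx0]⟩
      by_cases hx1 : x ∈ F1
      · refine ⟨1, by simp [hx1], ?_, by simp [hF1 x hx hx1]⟩
        intro m hm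
        have : m = 0 := by omega
        simpa [this] using hx0
      obtain ⟨k, hk, hkm, hkB⟩ := hAx x ⟨hx, by simp [hx0, hx1]⟩
      refine ⟨k+2, by simp [hk], fun m hm => ?_, ?_⟩
      · dsimp only
        split_ifs
        · exact hx0
        · simp [hx0, hx1]
        · have := hkm (m-2) (by omega)
          simp [hx0, hx1, this]
      · rw [hkB]; simp [parity_simps]

theorem DD.inD {n : ℕ} {X : Set Cantor} (h : DD n univ X) : DOmegaSigmaTwo X := by
  obtain ⟨A, hA, hAm, hAx⟩ := h.seq
  refine ⟨A, hA, hAm, ?_⟩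
  ext x
  obtain ⟨k, hk, hkm, hkB⟩ := hAx x trivial
  simp only [mem_iUnion, mem_ofPred_eq, Set.mem_sdiff, exists_prop, not_exists, not_and]
  constructor
  · exact fun hx => ⟨k, hkB.1 hx, hk, hkm⟩
  · rintro ⟨j, hj, hjA, hjm⟩
    have : j = k := by
      rcases lt_trichotomy j k with h | h | h
      · exact absurd hjA (hkm j h)
      · exact h
      · exact absurd hk (hjm k h)
    rw [hkB, ← this]; exact hj

theorem DD.inDelta {n : ℕ} {X : Set Cantor} (h : DD n univ X) : InDelta X :=
  ⟨h.inD, (DD.compl h).inD⟩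

theorem nth_agree {p q : ℕ → Prop} (hp : (setOf p).Infinite) (hq : (setOf q).Infinite) {k : ℕ}
    (h : ∀ m ≤ Nat.nth p k, (p m ↔ q m)) : Nat.nth q k = Nat.nth p k := by
  classical
  have h1 : Nat.count q (Nat.nth p k) = k := by
    conv_rhs => rw [← Nat.count_nth_of_infinite hp k]
    rw [Nat.count_eq_card_filter_range, Nat.count_eq_card_filter_range]
    congr 1
    ext m
    simp only [Finset.mem_filter, Finset.mem_range]
    constructor
    · rintro ⟨a, b⟩; exact ⟨a, (h m a.le).2 b⟩
    · rintro ⟨a, b⟩; exact ⟨a, (h m a.le).1 b⟩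
  have h2 : q (Nat.nth p k) := (h _ le_rfl).1 (Nat.nth_mem_of_infinite hp k)
  have h3 := Nat.nth_count h2
  rwa [h1] at h3

/-- branching levels -/
def Br (P : Set Cantor) (x : Cantor) (n : ℕ) : Prop := ∃ y ∈ P, y ∈ Cy x n ∧ y n ≠ x n

theorem Br_agree {P : Set Cantor} {x x' : Cantor} (hx : x ∈ P) (hx' : x' ∈ P) {n m : ℕ} (h : x' ∈ Cy x n) (hm : m ≤ n) :
    Br P x m ↔ Br P x' m := by
  have key : ∀ {x x' : Cantor}, x ∈ P → x' ∈ P → x' ∈ Cy x n → Br P x m → Br P x' m := by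
    intro x x' hx hx' h ⟨y, hy, hyx, hyn⟩
    have h' := Cy_anti x hm h
    by_cases he : x' m = x m
    · exact ⟨y, hy, by rw [Cy_eq h']; exact hyx, by rw [he]; exact hyn⟩
    · exact ⟨x, hx, Cy_symm h', fun e => he e.symm⟩
  exact ⟨key hx hx' h, key hx' hx (Cy_symm h)⟩

theorem brouwer {P : Set Cantor} (hc : IsClosed P) (hne : P.Nonempty)
    (hp : ∀ x ∈ P, ∀ n, ∃ y ∈ P, y ∈ Cy x n ∧ y ≠ x) : Nonempty (P ≃ₜ Cantor) := by
  classical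
  have hinf : ∀ x ∈ P, (setOf (Br P x)).Infinite := by
    intro x hx
    rw [Set.infinite_iff_exists_gt]
    intro n
    obtain ⟨y, hy, hyx, hne⟩ := hp x hx (n+1)
    have hex : ∃ m, y m ≠ x m := by
      by_contra h; push Not at h; exact hne (funext h)
    refine ⟨Nat.find hex, ⟨y, hy, fun i hi => ?_, Nat.find_spec hex⟩, ?_⟩
    · have := Nat.find_min hex hi; push Not at this; exact this
    · by_contra h
      exact Nat.find_spec hex (hyx _ (by omega))
  have hag : ∀ {x x' : Cantor}, x ∈ P → x' ∈ P → ∀ k, x' ∈ Cy x (Nat.nth (Br P x) k) →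
      Nat.nth (Br P x') k = Nat.nth (Br P x) k := fun {x x'} hx hx' k h =>
    nth_agree (hinf x hx) (hinf x' hx') fun m hm => Br_agree hx hx' h hm
  let F : P → Cantor := fun x k => x.1 (Nat.nth (Br P x.1) k)
  have hF : Continuous F := by
    refine continuous_pi fun k => ?_
    rw [continuous_iff_continuousAt]
    intro x
    have : ∀ᶠ y : P in 𝓝 x, F y k = F x k := by
      have h1 : Subtype.val ⁻¹' (Cy x.1 (Nat.nth (Br P x.1) k + 1)) ∈ 𝓝 x :=
        continuous_subtype_val.continuousAt.preimage_mem_nhds ((isOpen_Cy _ _).mem_nhds (mem_Cy_self _ _))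
      filter_upwards [h1] with y hy
      have h2 := hag x.2 y.2 k (Cy_anti _ (Nat.le_succ _) hy)
      simp only [F]
      rw [h2]
      exact hy _ (Nat.lt_succ_self _)
    exact (continuousAt_const (y := F x k)).congr (this.mono fun y h => h.symm)
  have hinj : Function.Injective F := by
    intro x y hxy
    by_contra hne
    have hex : ∃ m, x.1 m ≠ y.1 m := by
      by_contra h; push Not at h; exact hne (Subtype.ext (funext h))
    set n := Nat.find hex with hn
    have hag' : y.1 ∈ Cy x.1 n := fun i hi => by
      have := Nat.find_min hex hi; push Not at this; exact this.symm
    have hb : Br P x.1 n := ⟨y.1, y.2, hag', fun h => Nat.find_spec hex h.symm⟩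
    have hk := Nat.nth_count hb
    set k := Nat.count (Br P x.1) n
    have h1 := hag x.2 y.2 k (by rw [hk]; exact hag')
    have h2 := congrFun hxy k
    simp only [F] at h2
    rw [h1, hk] at h2
    exact Nat.find_spec hex h2
  have hdense : ∀ (z : Cantor) k, ∃ x : P, F x ∈ Cy z k := by
    intro z k
    induction k with
    | zero => obtain ⟨x, hx⟩ := hne; exact ⟨⟨x, hx⟩, fun i hi => absurd hi (by omega)⟩
    | succ k ih =>
      obtain ⟨x, hx⟩ := ih
      by_cases he : F x k = z k
      · refine ⟨x, fun i hi => ?_⟩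
        rcases Nat.lt_succ_iff_lt_or_eq.1 hi with h | h
        · exact hx i h
        · rw [h, he]
      obtain ⟨y, hy, hyx, hyn⟩ := Nat.nth_mem_of_infinite (hinf x.1 x.2) k
      have hle : ∀ i ≤ k, Nat.nth (Br P y) i = Nat.nth (Br P x.1) i := fun i hi =>
        hag x.2 hy i (Cy_anti _ (Nat.nth_monotone (hinf _ x.2) hi) hyx)
      refine ⟨⟨y, hy⟩, fun i hi => ?_⟩
      simp only [F]
      rw [hle i (by omega)]
      rcases Nat.lt_succ_iff_lt_or_eq.1 hi with h | h
      · rw [hyx _ (Nat.nth_strictMono (hinf _ x.2) h)]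
        exact hx i h
      · subst h
        have : F x i = x.1 (Nat.nth (Br P x.1) i) := rfl
        rw [this] at he
        revert hyn he
        cases y (Nat.nth (Br P x.1) i) <;> cases x.1 (Nat.nth (Br P x.1) i) <;> cases z i <;> simp
  haveI : CompactSpace P := isCompact_iff_compactSpace.1 hc.isCompact
  have hsurj : Function.Surjective F := by
    have hcl : IsClosed (range F) := (isCompact_range hF).isClosed
    intro z
    have : z ∈ closure (range F) := by
      rw [mem_closure_iff_nhds_basis (nhds_Cy z)]
      intro n _
      obtain ⟨x, hx⟩ := hdense z n
      exact ⟨F x, ⟨x, rfl⟩, hx⟩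
    rwa [hcl.closure_eq] at this
  exact ⟨hF.homeoOfEquivCompactToT2 (f := Equiv.ofBijective F ⟨hinj, hsurj⟩)⟩

end HS



namespace HS

open Topology Filter

theorem cpt_unif {P : Set Cantor} (hP : IsClosed P) {R : Cantor → Cantor → Prop}
    (h : ∀ x ∈ P, ∃ m, ∀ y ∈ P, y ∈ Cy x m → ∀ z ∈ P, z ∈ Cy x m → R y z) :
    ∃ m, ∀ y ∈ P, ∀ z ∈ P, z ∈ Cy y m → R y z := by
  refine hP.isCompact.induction_on (p := fun s => ∃ m, ∀ y ∈ s, y ∈ P → ∀ z ∈ P, z ∈ Cy y m → R y z)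
    ⟨0, by simp⟩ ?_ ?_ ?_ |>.imp fun m hm y hy => hm y hy hy
  · rintro s t hst ⟨m, hm⟩
    exact ⟨m, fun y hy => hm y (hst hy)⟩
  · rintro s t ⟨m, hm⟩ ⟨m', hm'⟩
    refine ⟨max m m', ?_⟩
    rintro y (hy | hy) hyP z hz hzy
    · exact hm y hy hyP z hz (Cy_anti _ (le_max_left _ _) hzy)
    · exact hm' y hy hyP z hz (Cy_anti _ (le_max_right _ _) hzy)
  · intro x hx
    obtain ⟨m, hm⟩ := h x hx
    refine ⟨Cy x m, mem_nhdsWithin_of_mem_nhds ((isOpen_Cy x m).mem_nhds (mem_Cy_self x m)), m, fun y hy hyP z hz hzy => ?_⟩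
    exact hm y hyP hy z hz (by rwa [Cy_eq hy] at hzy)

theorem cont_unif {P : Set Cantor} (hP : IsClosed P) {f : Cantor → Cantor} (hf : ContinuousOn f P) (n : ℕ) :
    ∃ m, ∀ y ∈ P, ∀ z ∈ P, z ∈ Cy y m → f z ∈ Cy (f y) n := by
  refine cpt_unif hP fun x hx => ?_
  have h1 := (hf x hx).preimage_mem_nhdsWithin ((isOpen_Cy (f x) n).mem_nhds (mem_Cy_self _ _))
  obtain ⟨m, -, hm⟩ := ((nhdsWithin_hasBasis (nhds_Cy x) P).mem_iff).1 h1
  refine ⟨m, fun y hy hyx z hz hzx => ?_⟩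
  rw [Cy_eq (hm ⟨hyx, hy⟩)]
  exact hm ⟨hzx, hz⟩

theorem clopen_unif {A : Set Cantor} (hA : IsClopen A) : ∃ n, ∀ x ∈ A, Cy x n ⊆ A := by
  obtain ⟨n, hn⟩ := cpt_unif (P := univ) isClosed_univ (R := fun y z => y ∈ A → z ∈ A) (by
    intro x _
    by_cases hx : x ∈ A
    · obtain ⟨m, hm⟩ := exists_Cy_subset (hA.2.mem_nhds hx)
      exact ⟨m, fun y _ _ z _ hz _ => hm hz⟩
    · obtain ⟨m, hm⟩ := exists_Cy_subset (hA.1.isOpen_compl.mem_nhds hx)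
      exact ⟨m, fun y _ hy z _ _ h => absurd h (hm hy)⟩)
  exact ⟨n, fun x hx y hy => hn x trivial y trivial hy hx⟩

theorem clopen_bij {A B : Set Cantor} (hA : IsClopen A) (hB : IsClopen B) (hAn : A.Nonempty) (hBn : B.Nonempty) :
    ∃ e : Cantor → Cantor, ContinuousOn e A ∧ BijOn e A B := by
  classical
  have key : ∀ {A : Set Cantor}, IsClopen A → A.Nonempty → Nonempty (A ≃ₜ Cantor) := by
    intro A hA hAn
    refine brouwer hA.1 hAn fun x hx n => ?_
    obtain ⟨m, hm⟩ := clopen_unif hA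
    have h1 : Function.update x (max m n) (!x (max m n)) ∈ Cy x (max m n) := fun i hi =>
      Function.update_of_ne (by omega) _ _
    refine ⟨_, hm x hx (Cy_anti _ (le_max_left _ _) h1), Cy_anti _ (le_max_right _ _) h1, fun h => ?_⟩
    have := congrFun h (max m n)
    simp at this
  obtain ⟨a⟩ := key hA hAn
  obtain ⟨b⟩ := key hB hBn
  let c := a.trans b.symm
  refine ⟨fun x => if h : x ∈ A then (c ⟨x, h⟩).1 else x, ?_, ?_, ?_, ?_⟩
  · rw [continuousOn_iff_continuous_restrict]
    refine (continuous_subtype_val.comp c.continuous).congr fun x => ?_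
    simp [Set.restrict]
  · intro x hx
    simp only [hx, dif_pos]
    exact (c _).2
  · intro x hx y hy hxy
    simp only [hx, hy, dif_pos] at hxy
    have := c.injective (Subtype.ext hxy)
    exact congrArg Subtype.val this
  · intro y hy
    refine ⟨(c.symm ⟨y, hy⟩).1, (c.symm ⟨y, hy⟩).2, ?_⟩
    simp

structure Part (A P : Set Cantor) (N : ℕ) (D : ℕ → Set Cantor) (p : ℕ → Cantor) : Prop where
  op : ∀ k, IsClopen (D k)
  ne : ∀ k, (D k).Nonempty
  disj : ∀ j k x, x ∈ D j → x ∈ D k → j = k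
  un : ⋃ k, D k = A \ P
  pm : ∀ k, p k ∈ P
  lim : ∀ n, ∀ᶠ k in atTop, D k ⊆ Cy (p k) n
  small : ∀ k, ∀ x ∈ D k, D k ⊆ Cy x N
  freq : ∀ q ∈ P, ∀ n, ∃ᶠ k in atTop, p k ∈ Cy q n

theorem exists_part {A P : Set Cantor} (hA : IsClopen A) (hP : IsClosed P) (hPA : P ⊆ A) (hPn : P.Nonempty)
    (hPint : interior P = ∅) (N : ℕ) : ∃ D p, Part A P N D p := by
  classical
  obtain ⟨N', hN'⟩ := clopen_unif hA
  obtain ⟨p0, hp0⟩ := hPn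
  set N0 := max N N' with hN0
  let T : Cantor → Set ℕ := fun x => {n | N0 ≤ n ∧ Disjoint (Cy x n) P}
  let lev : Cantor → ℕ := fun x => sInf (T x)
  have hT : ∀ x ∉ P, (T x).Nonempty := by
    intro x hx
    obtain ⟨m, hm⟩ := exists_Cy_subset (hP.isOpen_compl.mem_nhds hx)
    exact ⟨max N0 m, le_max_left _ _, Set.disjoint_left.2 fun y hy => hm (Cy_anti _ (le_max_right _ _) hy)⟩
  have hlev : ∀ x ∉ P, lev x ∈ T x := fun x hx => Nat.sInf_mem (hT x hx)
  have hlow : ∀ x n, N0 ≤ n → n < lev x → (Cy x n ∩ P).Nonempty := by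
    intro x n hn hnl
    by_contra h
    exact absurd (Nat.sInf_le (s := T x) (m := n) ⟨hn, Set.disjoint_iff_inter_eq_empty.2 (Set.not_nonempty_iff_eq_empty.1 h)⟩)
      (not_le.2 hnl)
  have hlt : ∀ x ∉ P, ∀ q ∈ P, ∀ M, q ∈ Cy x M → M < lev x := by
    intro x hx q hq M hqM
    by_contra h
    exact Set.disjoint_left.1 (hlev x hx).2 (Cy_anti _ (not_lt.1 h) hqM) hq
  have hsame : ∀ x ∉ P, ∀ y ∈ Cy x (lev x), lev y = lev x := by
    intro x hx y hy
    have h1 : lev x ∈ T y := ⟨(hlev x hx).1, by rw [Cy_eq hy]; exact (hlev x hx).2⟩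
    have hyP : y ∉ P := fun h => Set.disjoint_left.1 (hlev x hx).2 hy h
    have h2 : lev y ≤ lev x := Nat.sInf_le h1
    refine le_antisymm h2 (Nat.sInf_le ⟨(hlev y hyP).1, ?_⟩)
    rw [← Cy_eq (Cy_anti _ h2 hy)]
    exact (hlev y hyP).2
  let code : Cantor → ℕ × Finset ℕ := fun x => (lev x, (Finset.range (lev x)).filter fun i => x i = true)
  have hcode : ∀ x y, code x = code y → lev x = lev y ∧ y ∈ Cy x (lev x) := by
    intro x y h
    have h1 : lev x = lev y := congrArg Prod.fst h
    refine ⟨h1, fun i hi => ?_⟩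
    have h2 := congrArg Prod.snd h
    have h3 := Finset.ext_iff.1 h2 i
    simp only [code, Finset.mem_filter, Finset.mem_range, ← h1, hi, true_and] at h3
    exact (Bool.eq_iff_iff.2 h3).symm
  have hcode' : ∀ x ∉ P, ∀ y ∈ Cy x (lev x), code y = code x := by
    intro x hx y hy
    have h1 := hsame x hx y hy
    simp only [code, h1, Prod.mk.injEq, true_and]
    ext i
    simp only [Finset.mem_filter, Finset.mem_range, and_congr_right_iff]
    intro hi
    rw [hy i hi]
  have hbig : ∀ q ∈ P, ∀ M, ∃ x ∈ A \ P, x ∈ Cy q M ∧ M < lev x := by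
    intro q hq M
    have hop : IsOpen (A ∩ Cy q M) := hA.2.inter (isOpen_Cy _ _)
    have : ¬ (A ∩ Cy q M ⊆ P) := fun h => by
      have h1 := interior_maximal h hop ⟨hPA hq, mem_Cy_self _ _⟩
      rw [hPint] at h1; exact h1
    obtain ⟨x, hx, hxP⟩ := Set.not_subset.1 this
    exact ⟨x, ⟨hx.1, hxP⟩, hx.2, hlt x hxP q hq M (Cy_symm hx.2)⟩
  have hinf : (code '' (A \ P)).Infinite := by
    refine Set.Infinite.of_image Prod.fst ?_
    rw [Set.infinite_iff_exists_gt]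
    intro M
    obtain ⟨x, hx, -, hM⟩ := hbig p0 hp0 M
    exact ⟨lev x, ⟨code x, ⟨x, hx, rfl⟩, rfl⟩, hM⟩
  haveI := hinf.to_subtype
  obtain ⟨e⟩ := nonempty_equiv_of_countable (α := ℕ) (β := (code '' (A \ P) : Set _))
  choose xr hxr hxe using fun k => (e k).2
  have hxinj : Function.Injective (fun k => code (xr k)) := fun j k h => by
    simp only [hxe] at h
    exact e.injective (Subtype.ext h)
  have hxs : ∀ x ∈ A \ P, ∃ k, code (xr k) = code x := fun x hx =>
    ⟨e.symm ⟨code x, x, hx, rfl⟩, by rw [hxe]; simp⟩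
  have hfin : ∀ M, ∀ᶠ k in atTop, M < lev (xr k) := by
    intro M
    have h1 : {k | lev (xr k) ≤ M}.Finite := by
      refine Set.Finite.of_finite_image (f := fun k => code (xr k)) (Set.Finite.subset
        ((Finset.range (M+1)) ×ˢ (Finset.range M).powerset).finite_toSet ?_) hxinj.injOn
      rintro _ ⟨k, hk, rfl⟩
      have hk' : lev (xr k) ≤ M := hk
      simp only [code, Finset.coe_product, Set.mem_prod, Finset.mem_coe, Finset.mem_range, Finset.mem_powerset]
      refine ⟨by omega, fun i hi => ?_⟩
      simp only [Finset.mem_filter, Finset.mem_range] at hi ⊢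
      omega
    rw [← Nat.cofinite_eq_atTop]
    have h2 := h1.eventually_cofinite_notMem
    filter_upwards [h2] with k hk
    exact not_le.1 hk
  let p : ℕ → Cantor := fun k => if h : (Cy (xr k) (lev (xr k) - 1) ∩ P).Nonempty then h.some else p0
  have hpP : ∀ k, p k ∈ P := by
    intro k
    by_cases h : (Cy (xr k) (lev (xr k) - 1) ∩ P).Nonempty
    · simp only [p, h, dif_pos]; exact h.some_mem.2
    · simp only [p, h, dif_neg, not_false_eq_true]; exact hp0
  have hpC : ∀ k, N0 < lev (xr k) → p k ∈ Cy (xr k) (lev (xr k) - 1) := by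
    intro k hk
    have h := hlow (xr k) (lev (xr k) - 1) (by omega) (by omega)
    simp only [p, h, dif_pos]; exact h.some_mem.1
  refine ⟨fun k => Cy (xr k) (lev (xr k)), p, fun k => isClopen_Cy _ _, fun k => ⟨_, mem_Cy_self _ _⟩, ?_, ?_, hpP, ?_, ?_, ?_⟩
  · intro j k x hj hk
    refine hxinj ?_
    change code (xr j) = code (xr k)
    rw [← hcode' _ (hxr j).2 x hj, ← hcode' _ (hxr k).2 x hk]
  · ext x
    rw [mem_iUnion]
    constructor
    · rintro ⟨k, hk⟩
      refine ⟨hN' _ (hxr k).1 (Cy_anti _ ((le_max_right N N').trans (hlev _ (hxr k).2).1) hk), fun h =>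
        Set.disjoint_left.1 (hlev _ (hxr k).2).2 hk h⟩
    · intro hx
      obtain ⟨k, hk⟩ := hxs x hx
      exact ⟨k, (hcode _ _ hk).2⟩
  · intro n
    filter_upwards [hfin (max n N0)] with k hk
    have h1 := hpC k (lt_of_le_of_lt (le_max_right _ _) hk)
    have h2 : n ≤ lev (xr k) - 1 := by have := le_max_left n N0; omega
    refine fun y hy => Cy_anti _ h2 ?_
    rw [Cy_eq h1]
    exact Cy_anti _ (by omega) hy
  · intro k x hx y hy
    have : N ≤ lev (xr k) := (le_max_left N N').trans (hlev _ (hxr k).2).1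
    rw [Cy_eq (Cy_anti _ this hx)]
    exact Cy_anti _ this hy
  · intro q hq n
    rw [frequently_atTop]
    intro K
    set M := max (max n N0) ((Finset.range K).sup fun j => lev (xr j)) with hM
    obtain ⟨x, hx, hxq, hMx⟩ := hbig q hq M
    obtain ⟨k, hk⟩ := hxs x hx
    obtain ⟨h1, h2⟩ := hcode _ _ hk
    have hnM : n ≤ M := (le_max_left _ _).trans (le_max_left _ _)
    have hNM : N0 ≤ M := (le_max_right _ _).trans (le_max_left _ _)
    refine ⟨k, ?_, ?_⟩
    · by_contra h
      have := Finset.le_sup (f := fun j => lev (xr j)) (Finset.mem_range.2 (not_le.1 h))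
      have h3 := this.trans (le_max_right (max n N0) _)
      rw [← hM] at h3
      omega
    · have h3 := hpC k (by omega)
      have h4 : p k ∈ Cy (xr k) n := Cy_anti _ (by omega) h3
      have h5 : x ∈ Cy (xr k) n := Cy_anti _ (by omega) h2
      rw [← Cy_eq (Cy_anti _ hnM hxq), Cy_eq h5]
      exact h4

end HS



namespace HS

open Topology Filter

theorem glue {A B P Q : Set Cantor} {N : ℕ} {D E : ℕ → Set Cantor} {p : ℕ → Cantor} {h : Cantor → Cantor}
    {e : ℕ → Cantor → Cantor} (hpt : Part A P N D p) (hPA : P ⊆ A) (hQB : Q ⊆ B)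
    (hh : ContinuousOn h P) (hb : BijOn h P Q) (he : ∀ k, ContinuousOn (e k) (D k)) (heb : ∀ k, BijOn (e k) (D k) (E k))
    (hEd : ∀ j k x, x ∈ E j → x ∈ E k → j = k) (hEu : ⋃ k, E k = B \ Q)
    (hE : ∀ n, ∀ᶠ k in atTop, E k ⊆ Cy (h (p k)) n) :
    ∃ H : Cantor → Cantor, ContinuousOn H A ∧ BijOn H A B ∧ EqOn H h P ∧ ∀ k, EqOn H (e k) (D k) := by
  classical
  let H : Cantor → Cantor := fun y => if hy : ∃ k, y ∈ D k then e hy.choose y else h y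
  have hDP : ∀ k x, x ∈ D k → x ∈ A ∧ x ∉ P := fun k x hx => by
    have : x ∈ A \ P := by rw [← hpt.un]; exact mem_iUnion.2 ⟨k, hx⟩
    exact this
  have hEQ : ∀ k x, x ∈ E k → x ∈ B ∧ x ∉ Q := fun k x hx => by
    have : x ∈ B \ Q := by rw [← hEu]; exact mem_iUnion.2 ⟨k, hx⟩
    exact this
  have hHP : EqOn H h P := by
    intro x hx
    have : ¬ ∃ k, x ∈ D k := fun ⟨k, hk⟩ => (hDP k x hk).2 hx
    simp only [H, this, dif_neg, not_false_eq_true]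
  have hHD : ∀ k, EqOn H (e k) (D k) := by
    intro k x hx
    have hex : ∃ k, x ∈ D k := ⟨k, hx⟩
    simp only [H, hex, dif_pos]
    rw [hpt.disj _ _ x hex.choose_spec hx]
  have hcase : ∀ x ∈ A, x ∈ P ∨ ∃ k, x ∈ D k := by
    intro x hx
    by_cases hxP : x ∈ P
    · exact Or.inl hxP
    · have : x ∈ ⋃ k, D k := by rw [hpt.un]; exact ⟨hx, hxP⟩
      exact Or.inr (mem_iUnion.1 this)
  have hHE : ∀ k x, x ∈ D k → H x ∈ E k := fun k x hx => by rw [hHD k hx]; exact (heb k).mapsTo hx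
  have hHQ : ∀ x ∈ P, H x ∈ Q := fun x hx => by rw [hHP hx]; exact hb.mapsTo hx
  refine ⟨H, ?_, ⟨?_, ?_, ?_⟩, hHP, hHD⟩
  · intro x hx
    rcases hcase x hx with hxP | ⟨k, hk⟩
    · rw [ContinuousWithinAt, (nhdsWithin_hasBasis (nhds_Cy x) A).tendsto_iff (nhds_Cy (H x))]
      intro n _
      have h1 := (hh x hxP).preimage_mem_nhdsWithin ((isOpen_Cy (h x) n).mem_nhds (mem_Cy_self _ _))
      obtain ⟨m0, -, hm0⟩ := ((nhdsWithin_hasBasis (nhds_Cy x) P).mem_iff).1 h1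
      obtain ⟨K, hK⟩ := eventually_atTop.1 ((hpt.lim m0).and (hE n))
      have h2 : ∃ m1, Cy x m1 ⊆ (⋃ k ∈ Finset.range K, D k)ᶜ := by
        refine exists_Cy_subset (IsOpen.mem_nhds ?_ ?_)
        · have hcl : IsClosed (⋃ k ∈ Finset.range K, D k) :=
            Set.Finite.isClosed_biUnion (Finset.finite_toSet _) fun k _ => (hpt.op k).1
          exact hcl.isOpen_compl
        · intro hx'
          simp only [mem_iUnion] at hx'
          obtain ⟨k, -, hk⟩ := hx'
          exact (hDP k x hk).2 hxP
      obtain ⟨m1, hm1⟩ := h2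
      refine ⟨max m0 m1, trivial, ?_⟩
      rintro y ⟨hyx, hyA⟩
      rw [hHP hxP]
      have hy0 : y ∈ Cy x m0 := Cy_anti _ (le_max_left _ _) hyx
      rcases hcase y hyA with hyP | ⟨k, hk⟩
      · rw [hHP hyP]
        exact hm0 ⟨hy0, hyP⟩
      · have hkK : K ≤ k := by
          by_contra hlt
          refine hm1 (Cy_anti _ (le_max_right _ _) hyx) ?_
          simp only [mem_iUnion]
          exact ⟨k, Finset.mem_range.2 (not_le.1 hlt), hk⟩
        have h3 := (hK k hkK).1 hk
        have h4 := (hK k hkK).2 (hHE k y hk)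
        have h5 : p k ∈ Cy x m0 := by rw [← Cy_eq hy0]; exact Cy_symm h3
        have h6 : h (p k) ∈ Cy (h x) n := hm0 ⟨h5, hpt.pm k⟩
        rwa [Cy_eq h6] at h4
    · have h1 : ContinuousAt (e k) x := (he k).continuousAt ((hpt.op k).2.mem_nhds hk)
      refine ContinuousAt.continuousWithinAt (h1.congr ?_)
      filter_upwards [(hpt.op k).2.mem_nhds hk] with y hy
      exact (hHD k hy).symm
  · intro x hx
    rcases hcase x hx with hxP | ⟨k, hk⟩
    · exact hQB (hHQ x hxP)
    · exact (hEQ k _ (hHE k x hk)).1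
  · intro x hx y hy hxy
    rcases hcase x hx with hxP | ⟨k, hk⟩ <;> rcases hcase y hy with hyP | ⟨j, hj⟩
    · rw [hHP hxP, hHP hyP] at hxy
      exact hb.injOn hxP hyP hxy
    · exact absurd (hxy ▸ hHQ x hxP) (hEQ j _ (hHE j y hj)).2
    · exact absurd (hxy ▸ hHQ y hyP) (hEQ k _ (hHE k x hk)).2
    · have : k = j := hEd k j (H x) (hHE k x hk) (by rw [hxy]; exact hHE j y hj)
      subst this
      rw [hHD k hk, hHD k hj] at hxy
      exact (heb k).injOn hk hj hxy
  · intro y hy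
    by_cases hyQ : y ∈ Q
    · obtain ⟨x, hx, rfl⟩ := hb.surjOn hyQ
      exact ⟨x, hPA hx, hHP hx⟩
    · have : y ∈ ⋃ k, E k := by rw [hEu]; exact ⟨hy, hyQ⟩
      obtain ⟨k, hk⟩ := mem_iUnion.1 this
      obtain ⟨x, hx, rfl⟩ := (heb k).surjOn hk
      exact ⟨x, (hDP k x hx).1, hHD k hx⟩

theorem kr {A B P Q : Set Cantor} {h : Cantor → Cantor} (hA : IsClopen A) (hB : IsClopen B) (hAn : A.Nonempty)
    (hBn : B.Nonempty) (hP : IsClosed P) (hPA : P ⊆ A) (hPi : interior P = ∅) (hQB : Q ⊆ B) (hQi : interior Q = ∅)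
    (hh : ContinuousOn h P) (hb : BijOn h P Q) :
    ∃ H : Cantor → Cantor, ContinuousOn H A ∧ BijOn H A B ∧ EqOn H h P := by
  classical
  rcases P.eq_empty_or_nonempty with rfl | hPn
  · obtain ⟨e, he, heb⟩ := clopen_bij hA hB hAn hBn
    exact ⟨e, he, heb, fun x hx => hx.elim⟩
  have hQ : IsClosed Q := by
    rw [← hb.image_eq]
    exact (hP.isCompact.image_of_continuousOn hh).isClosed
  have hQn : Q.Nonempty := by rw [← hb.image_eq]; exact hPn.image h
  obtain ⟨D, p, hD⟩ := exists_part hA hP hPA hPn hPi 0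
  obtain ⟨E, q, hE⟩ := exists_part hB hQ hQB hQn hQi 0
  have hinv : ∀ y ∈ Q, ∃ x ∈ P, h x = y := fun y hy => hb.surjOn hy
  choose r hr hrq using fun j => hinv (q j) (hE.pm j)
  obtain ⟨φ, hφ, hφ'⟩ := extraction_forall_of_frequently fun k => hE.freq (h (p k)) (hb.mapsTo (hD.pm k)) k
  obtain ⟨ψ, hψ, hψ'⟩ := extraction_forall_of_frequently fun j => hD.freq (r j) (hr j) j
  obtain ⟨β, hβ, hβR⟩ := Function.Embedding.schroeder_bernstein_of_rel hφ.injective hψ.injective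
    (fun k j => q j ∈ Cy (h (p k)) k ∨ p k ∈ Cy (r j) j) (fun k => Or.inl (hφ' k)) (fun j => Or.inr (hψ' j))
  have hβt : Tendsto β atTop atTop := by
    have := hβ.injective.tendsto_cofinite
    rwa [Nat.cofinite_eq_atTop] at this
  have hlim : ∀ n, ∀ᶠ k in atTop, E (β k) ⊆ Cy (h (p k)) n := by
    intro n
    obtain ⟨m, hm⟩ := cont_unif hP hh n
    filter_upwards [hβt.eventually (hE.lim n), hβt.eventually_ge_atTop m, eventually_ge_atTop n] with k h1 h2 h3
    have h4 : q (β k) ∈ Cy (h (p k)) n := by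
      rcases hβR k with h | h
      · exact Cy_anti _ h3 h
      · have := hm _ (hr (β k)) _ (hD.pm k) (Cy_anti _ h2 h)
        rw [hrq] at this
        exact Cy_symm this
    rw [← Cy_eq h4]; exact h1
  choose e he heb using fun k => clopen_bij (hD.op k) (hE.op (β k)) (hD.ne k) (hE.ne (β k))
  obtain ⟨H, h1, h2, h3, -⟩ := glue hD hPA hQB hh hb he heb (fun j k x hj hk => hβ.injective (hE.disj _ _ x hj hk)) (by
    rw [← hE.un]
    exact hβ.surjective.iUnion_comp E) hlim
  exact ⟨H, h1, h2, h3⟩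

theorem homeo_of_bijOn {H : Cantor → Cantor} (hH : ContinuousOn H univ) (hb : BijOn H univ univ) :
    ∃ e : Cantor ≃ₜ Cantor, ∀ x, e x = H x := by
  have hc : Continuous H := continuousOn_univ.1 hH
  exact ⟨hc.homeoOfEquivCompactToT2 (f := Equiv.ofBijective H (bijOn_univ.1 hb)), fun x => rfl⟩

/-- `X` reduces injectively to `S` inside every nonempty clopen set -/
def InjRed (X S : Set Cantor) : Prop := ∀ W, IsClopen W → W.Nonempty →
  ∃ g : Cantor → Cantor, Continuous g ∧ Function.Injective g ∧ (∀ x, g x ∈ W) ∧ ∀ x, (x ∈ X ↔ g x ∈ S)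

theorem nwd_image {g : Cantor → Cantor} (hg : Continuous g) (hi : Function.Injective g) {F : Set Cantor}
    (hF : interior F = ∅) : interior (g '' F) = ∅ := by
  have h : g ⁻¹' interior (g '' F) ⊆ interior F := by
    refine interior_maximal ?_ (isOpen_interior.preimage hg)
    intro x hx
    obtain ⟨y, hy, hyx⟩ := interior_subset hx
    exact hi hyx ▸ hy
  rw [hF] at h
  by_contra hne
  obtain ⟨y, hy⟩ := Set.nonempty_iff_ne_empty.2 hne
  obtain ⟨x, hx, rfl⟩ := interior_subset hy
  exact h hy

theorem step {X S F P : Set Cantor} (hred : InjRed X S) (hF : IsClosed F) (hFi : interior F = ∅) (h : Cantor ≃ₜ Cantor)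
    (hP : IsClosed P) (hPi : interior P = ∅) (hPn : P.Nonempty) (hPX : ∀ x ∈ P, (x ∈ X ↔ h x ∈ S)) (n : ℕ) :
    ∃ h' : Cantor ≃ₜ Cantor, (∀ x ∈ P, h' x = h x) ∧ (∀ x ∈ P ∪ F, (x ∈ X ↔ h' x ∈ S)) ∧
      (∀ x, h' x ∈ Cy (h x) n) ∧ ∀ y, h'.symm y ∈ Cy (h.symm y) n := by
  obtain ⟨m, hm⟩ := cont_unif isClosed_univ h.continuous.continuousOn n
  obtain ⟨D, p, hD⟩ := exists_part isClopen_univ hP (subset_univ _) hPn hPi (max m n)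
  have hEc : ∀ k, IsClopen (h '' D k) := fun k => ⟨h.isClosedMap _ (hD.op k).1, h.isOpenMap _ (hD.op k).2⟩
  have hFk : ∀ k, interior (F ∩ D k) = ∅ := fun k => subset_empty_iff.1 (hFi ▸ interior_mono inter_subset_left)
  have hk : ∀ k, ∃ e : Cantor → Cantor, ContinuousOn e (D k) ∧ BijOn e (D k) (h '' D k) ∧
      ∀ x ∈ F ∩ D k, (x ∈ X ↔ e x ∈ S) := by
    intro k
    obtain ⟨g, hg, hgi, hgW, hgX⟩ := hred _ (hEc k) ((hD.ne k).image h)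
    obtain ⟨H, h1, h2, h3⟩ := kr (hD.op k) (hEc k) (hD.ne k) ((hD.ne k).image h) (hF.inter (hD.op k).1)
      inter_subset_right (hFk k) (Q := g '' (F ∩ D k)) (by rintro _ ⟨x, -, rfl⟩; exact hgW x)
      (nwd_image hg hgi (hFk k)) hg.continuousOn (hgi.injOn.bijOn_image)
    exact ⟨H, h1, h2, fun x hx => by rw [h3 hx]; exact hgX x⟩
  choose e he heb heX using hk
  have hlim : ∀ n, ∀ᶠ k in atTop, h '' D k ⊆ Cy (h (p k)) n := by
    intro n
    obtain ⟨m, hm⟩ := cont_unif isClosed_univ h.continuous.continuousOn n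
    filter_upwards [hD.lim m] with k hk
    rintro _ ⟨x, hx, rfl⟩
    exact hm _ trivial _ trivial (hk hx)
  obtain ⟨H, h1, h2, h3, h4⟩ := glue (B := univ) (Q := h '' P) hD (subset_univ _) (subset_univ _) h.continuous.continuousOn
    (h.injective.injOn.bijOn_image) he heb (by
      rintro j k _ ⟨x, hx, rfl⟩ ⟨y, hy, hxy⟩
      rw [h.injective hxy] at hy
      exact hD.disj _ _ x hx hy) (by
      rw [← image_iUnion, hD.un, image_sdiff h.injective, image_univ, h.surjective.range_eq]) hlim
  obtain ⟨h', hh'⟩ := homeo_of_bijOn h1 h2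
  have hcase : ∀ x, x ∉ P → ∃ k, x ∈ D k := fun x hx => by
    have : x ∈ ⋃ k, D k := by rw [hD.un]; exact ⟨trivial, hx⟩
    exact mem_iUnion.1 this
  have hD' : ∀ k x, x ∈ D k → ∃ y ∈ D k, h y = h' x := fun k x hx => by
    rw [hh', h4 k hx]
    exact (heb k).mapsTo hx
  refine ⟨h', fun x hx => by rw [hh', h3 hx], ?_, ?_, ?_⟩
  · intro x hx
    rw [hh']
    by_cases hxP : x ∈ P
    · rw [h3 hxP]; exact hPX x hxP
    · obtain ⟨k, hk⟩ := hcase x hxP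
      rw [h4 k hk]
      exact heX k x ⟨hx.resolve_left hxP, hk⟩
  · intro x
    by_cases hxP : x ∈ P
    · rw [hh', h3 hxP]; exact mem_Cy_self _ _
    · obtain ⟨k, hk⟩ := hcase x hxP
      obtain ⟨y, hy, hyx⟩ := hD' k x hk
      rw [← hyx]
      exact hm x trivial y trivial (Cy_anti _ (le_max_left _ _) (hD.small k x hk hy))
  · intro y
    obtain ⟨x, rfl⟩ := h'.surjective y
    rw [h'.symm_apply_apply]
    by_cases hxP : x ∈ P
    · rw [hh', h3 hxP, h.symm_apply_apply]; exact mem_Cy_self _ _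
    · obtain ⟨k, hk⟩ := hcase x hxP
      obtain ⟨y, hy, hyx⟩ := hD' k x hk
      rw [← hyx, h.symm_apply_apply]
      exact Cy_anti _ (le_max_right _ _) (hD.small k y hy hk)

theorem nwd_preimage (h : Cantor ≃ₜ Cantor) {F : Set Cantor} (hF : interior F = ∅) : interior (h ⁻¹' F) = ∅ := by
  rw [← h.preimage_interior, hF, preimage_empty]

theorem step2 {X S F G P : Set Cantor} (hred : InjRed X S) (hred' : InjRed S X) (hF : IsClosed F) (hFi : interior F = ∅)
    (hG : IsClosed G) (hGi : interior G = ∅) (h : Cantor ≃ₜ Cantor)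
    (hP : IsClosed P) (hPi : interior P = ∅) (hPn : P.Nonempty) (hPX : ∀ x ∈ P, (x ∈ X ↔ h x ∈ S)) (n : ℕ) :
    ∃ (h' : Cantor ≃ₜ Cantor) (P' : Set Cantor), IsClosed P' ∧ interior P' = ∅ ∧ P'.Nonempty ∧ P ⊆ P' ∧ F ⊆ P' ∧
      h' ⁻¹' G ⊆ P' ∧ (∀ x ∈ P, h' x = h x) ∧ (∀ x ∈ P', (x ∈ X ↔ h' x ∈ S)) ∧
      (∀ x, h' x ∈ Cy (h x) n) ∧ ∀ y, h'.symm y ∈ Cy (h.symm y) n := by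
  obtain ⟨h1, a1, a2, a3, a4⟩ := step hred hF hFi h hP hPi hPn hPX n
  have hPF : interior (P ∪ F) = ∅ := by
    rw [interior_union_isClosed_of_interior_empty hP hFi, hPi]
  obtain ⟨k, b1, b2, b3, b4⟩ := step hred' hG hGi h1.symm (P := h1.symm ⁻¹' (P ∪ F)) ((hP.union hF).preimage h1.symm.continuous)
    (nwd_preimage _ hPF) (by obtain ⟨x, hx⟩ := hPn; exact ⟨h1 x, by simp [hx]⟩)
    (by intro y hy
        have := a2 _ hy
        rw [h1.apply_symm_apply] at this
        exact this.symm) n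
  have hk : ∀ x ∈ P ∪ F, k.symm x = h1 x := by
    intro x hx
    rw [k.symm_apply_eq, b1 _ (by simpa using hx), h1.symm_apply_apply]
  have hsub : P ∪ F ⊆ k.symm ⁻¹' (h1.symm ⁻¹' (P ∪ F) ∪ G) := by
    intro x hx
    left
    rw [mem_preimage, hk x hx, h1.symm_apply_apply]; exact hx
  refine ⟨k.symm, k.symm ⁻¹' (h1.symm ⁻¹' (P ∪ F) ∪ G), ?_, ?_, ?_, ?_, ?_, ?_, ?_, ?_, ?_, ?_⟩
  · exact (((hP.union hF).preimage h1.symm.continuous).union hG).preimage k.symm.continuous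
  · refine nwd_preimage _ ?_
    rw [interior_union_isClosed_of_interior_empty ((hP.union hF).preimage h1.symm.continuous) hGi]
    exact nwd_preimage _ hPF
  · obtain ⟨x, hx⟩ := hPn; exact ⟨x, hsub (Or.inl hx)⟩
  · exact fun x hx => hsub (Or.inl hx)
  · exact fun x hx => hsub (Or.inr hx)
  · exact fun x hx => Or.inr hx
  · intro x hx
    rw [hk x (Or.inl hx), a1 x hx]
  · intro x hx
    have := b2 _ hx
    rw [k.apply_symm_apply] at this
    exact this.symm
  · intro x
    have h2 := b4 x
    rw [h1.symm_symm] at h2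
    rw [← Cy_eq (a3 x)]; exact h2
  · intro y
    rw [k.symm_symm, ← Cy_eq (a4 y)]
    exact b3 y

end HS



namespace HS

open Topology Filter

/-- states of the back and forth construction -/
structure BF (X S : Set Cantor) where
  h : Cantor ≃ₜ Cantor
  P : Set Cantor
  cl : IsClosed P
  nw : interior P = ∅
  ne : P.Nonempty
  ok : ∀ x ∈ P, (x ∈ X ↔ h x ∈ S)

theorem BF.next {X S F G : Set Cantor} (hred : InjRed X S) (hred' : InjRed S X) (hF : IsClosed F) (hFi : interior F = ∅)
    (hG : IsClosed G) (hGi : interior G = ∅) (n : ℕ) (s : BF X S) :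
    ∃ t : BF X S, s.P ⊆ t.P ∧ F ⊆ t.P ∧ t.h ⁻¹' G ⊆ t.P ∧ (∀ x ∈ s.P, t.h x = s.h x) ∧
      (∀ x, t.h x ∈ Cy (s.h x) n) ∧ ∀ y, t.h.symm y ∈ Cy (s.h.symm y) n := by
  obtain ⟨h', P', a1, a2, a3, a4, a5, a6, a7, a8, a9, a10⟩ :=
    step2 hred hred' hF hFi hG hGi s.h s.cl s.nw s.ne s.ok n
  exact ⟨⟨h', P', a1, a2, a3, a8⟩, a4, a5, a6, a7, a9, a10⟩

theorem BF.start {X S : Set Cantor} (hred : InjRed X S) : Nonempty (BF X S) := by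
  obtain ⟨g, hg, hgi, -, hgX⟩ := hred univ isClopen_univ ⟨fun _ => false, trivial⟩
  have hs : ∀ x : Cantor, interior ({x} : Set Cantor) = ∅ := by
    intro x
    by_contra hne
    obtain ⟨y, hy⟩ := Set.nonempty_iff_ne_empty.2 hne
    obtain ⟨n, hn⟩ := exists_Cy_subset (isOpen_interior.mem_nhds hy)
    have h1 : Function.update y n (!y n) ∈ Cy y n := fun i hi => Function.update_of_ne (by omega) _ _
    have h2 : Function.update y n (!y n) = x := mem_singleton_iff.1 (interior_subset (hn h1))
    have h3 : y = x := mem_singleton_iff.1 (interior_subset hy)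
    have := congrFun (h2.trans h3.symm) n
    simp at this
  set x0 : Cantor := fun _ => false
  obtain ⟨H, h1, h2, h3⟩ := kr (A := univ) (B := univ) (P := {x0}) (Q := {g x0}) isClopen_univ isClopen_univ ⟨x0, trivial⟩
    ⟨x0, trivial⟩ isClosed_singleton (subset_univ _) (hs _) (subset_univ _) (hs _) hg.continuousOn (by simp)
  obtain ⟨h, hh⟩ := homeo_of_bijOn h1 h2
  refine ⟨⟨h, {x0}, isClosed_singleton, hs _, ⟨x0, rfl⟩, ?_⟩⟩
  rintro x rfl
  rw [hh, h3 rfl]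
  exact hgX _

theorem meagre_closed {X : Set Cantor} (h : IsMeagre X) :
    ∃ F : ℕ → Set Cantor, (∀ n, IsClosed (F n)) ∧ (∀ n, interior (F n) = ∅) ∧ X ⊆ ⋃ n, F n := by
  obtain ⟨T, hT, hc, hsub⟩ := isMeagre_iff_countable_union_isNowhereDense.1 h
  rcases T.eq_empty_or_nonempty with rfl | hne
  · exact ⟨fun _ => ∅, fun _ => isClosed_empty, fun _ => interior_empty, by simpa using hsub⟩
  · obtain ⟨f, rfl⟩ := hc.exists_eq_range hne
    refine ⟨fun n => closure (f n), fun n => isClosed_closure, fun n => hT _ ⟨n, rfl⟩, fun x hx => ?_⟩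
    obtain ⟨_, ⟨n, rfl⟩, hxn⟩ := hsub hx
    exact mem_iUnion.2 ⟨n, subset_closure hxn⟩

theorem steel {X S : Set Cantor} (hX : IsMeagre X) (hS : IsMeagre S) (hred : InjRed X S) (hred' : InjRed S X) :
    ∃ h : Cantor ≃ₜ Cantor, ∀ x, (x ∈ X ↔ h x ∈ S) := by
  obtain ⟨F, hF, hFi, hFX⟩ := meagre_closed hX
  obtain ⟨G, hG, hGi, hGS⟩ := meagre_closed hS
  obtain ⟨s0⟩ := BF.start hred
  choose nx n1 n2 n3 n4 n5 n6 using fun (n : ℕ) (s : BF X S) => BF.next hred hred' (hF n) (hFi n) (hG n) (hGi n) n s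
  let s : ℕ → BF X S := fun n => Nat.rec s0 nx n
  have hs : ∀ n, s (n+1) = nx n (s n) := fun n => rfl
  have hPm : ∀ n m, n ≤ m → (s n).P ⊆ (s m).P := by
    intro n m hnm
    induction m, hnm using Nat.le_induction with
    | base => exact le_rfl
    | succ m _ ih => rw [hs]; exact ih.trans (n1 m (s m))
  have hPh : ∀ n m, n ≤ m → ∀ x ∈ (s n).P, (s m).h x = (s n).h x := by
    intro n m hnm
    induction m, hnm using Nat.le_induction with
    | base => exact fun _ _ => rfl
    | succ m hm ih =>
      intro x hx
      rw [hs, n4 m (s m) x (hPm n m hm hx), ih x hx]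
  have hcl : ∀ n m, n ≤ m → ∀ x, (s m).h x ∈ Cy ((s n).h x) n := by
    intro n m hnm
    induction m, hnm using Nat.le_induction with
    | base => exact fun x => mem_Cy_self _ _
    | succ m hm ih =>
      intro x
      have := Cy_anti _ hm (n5 m (s m) x)
      rw [Cy_eq (ih x), ← hs] at this
      exact this
  have hcl' : ∀ n m, n ≤ m → ∀ x, (s m).h.symm x ∈ Cy ((s n).h.symm x) n := by
    intro n m hnm
    induction m, hnm using Nat.le_induction with
    | base => exact fun x => mem_Cy_self _ _
    | succ m hm ih =>
      intro x
      have := Cy_anti _ hm (n6 m (s m) x)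
      rw [Cy_eq (ih x), ← hs] at this
      exact this
  let H : Cantor → Cantor := fun x i => (s (i+1)).h x i
  let H' : Cantor → Cantor := fun x i => (s (i+1)).h.symm x i
  have hHc : Continuous H := continuous_pi fun i => (continuous_apply (A := fun _ : ℕ => Bool) i).comp (s (i+1)).h.continuous
  have hHc' : Continuous H' :=
    continuous_pi fun i => (continuous_apply (A := fun _ : ℕ => Bool) i).comp (s (i+1)).h.symm.continuous
  have hH : ∀ n x, H x ∈ Cy ((s n).h x) n := fun n x i hi =>
    (hcl (i+1) n (by omega) x i (by omega)).symm
  have hH' : ∀ n x, H' x ∈ Cy ((s n).h.symm x) n := fun n x i hi =>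
    (hcl' (i+1) n (by omega) x i (by omega)).symm
  have inv : ∀ x, H' (H x) = x := by
    intro x
    funext i
    obtain ⟨m, hm⟩ := exists_Cy_subset (hHc'.continuousAt.preimage_mem_nhds
      ((isOpen_Cy (H' (H x)) (i+1)).mem_nhds (mem_Cy_self _ _)))
    set n := max m (i+1)
    have h1 : (s n).h x ∈ Cy (H x) m := Cy_anti _ (le_max_left _ _) (Cy_symm (hH n x))
    have h2 := hm h1 i (Nat.lt_succ_self i)
    have h3 := hH' n ((s n).h x) i (lt_of_lt_of_le (Nat.lt_succ_self i) (le_max_right _ _))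
    rw [(s n).h.symm_apply_apply] at h3
    rw [← h2, h3]
  have inv' : ∀ x, H (H' x) = x := by
    intro x
    funext i
    obtain ⟨m, hm⟩ := exists_Cy_subset (hHc.continuousAt.preimage_mem_nhds
      ((isOpen_Cy (H (H' x)) (i+1)).mem_nhds (mem_Cy_self _ _)))
    set n := max m (i+1)
    have h1 : (s n).h.symm x ∈ Cy (H' x) m := Cy_anti _ (le_max_left _ _) (Cy_symm (hH' n x))
    have h2 := hm h1 i (Nat.lt_succ_self i)
    have h3 := hH n ((s n).h.symm x) i (lt_of_lt_of_le (Nat.lt_succ_self i) (le_max_right _ _))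
    rw [(s n).h.apply_symm_apply] at h3
    rw [← h2, h3]
  have hHP : ∀ n, ∀ x ∈ (s n).P, H x = (s n).h x := by
    intro n x hx
    funext i
    have h1 := hH (max n (i+1)) x i (lt_of_lt_of_le (Nat.lt_succ_self i) (le_max_right _ _))
    rw [h1, hPh n _ (le_max_left _ _) x hx]
  refine ⟨⟨⟨H, H', inv, inv'⟩, hHc, hHc'⟩, fun x => ?_⟩
  change x ∈ X ↔ H x ∈ S
  constructor
  · intro hx
    obtain ⟨n, hn⟩ := mem_iUnion.1 (hFX hx)
    have h1 : x ∈ (s (n+1)).P := n2 n (s n) hn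
    rw [hHP (n+1) x h1]
    exact ((s (n+1)).ok x h1).1 hx
  · intro hx
    obtain ⟨n, hn⟩ := mem_iUnion.1 (hGS hx)
    set x' := (s (n+1)).h.symm (H x) with hx'
    have h0 : (s (n+1)).h x' = H x := (s (n+1)).h.apply_symm_apply _
    have h1 : x' ∈ (s (n+1)).P := n3 n (s n) (by
      change (s (n+1)).h x' ∈ G n
      rw [h0]; exact hn)
    have h2 := hHP (n+1) x' h1
    rw [h0] at h2
    have h3 : x' = x := by rw [← inv x', h2, inv]
    rw [h3] at h1 h0
    exact ((s (n+1)).ok x h1).2 (h0 ▸ hx)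

end HS



namespace HS

open Topology Filter

def Mk (y : Cantor) (n : ℕ) : Prop := y (2*n) = true

def Lst (b : Bool) : Set Cantor := {y | ∃ n, Mk y n ∧ y (2*n+1) = b ∧ ∀ m > n, ¬ Mk y m}

noncomputable def dec (y : Cantor) (k : ℕ) : Bool := y (2 * Nat.nth (Mk y) k + 1)

def MInf : Set Cantor := {y | (setOf (Mk y)).Infinite}

def Star (B : Set Cantor) : Set Cantor := Lst true ∪ (MInf ∩ {y | dec y ∈ B})

theorem clopen_coord (i : ℕ) (b : Bool) : IsClopen {y : Cantor | y i = b} :=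
  (isClopen_discrete {b}).preimage (continuous_apply (A := fun _ : ℕ => Bool) i)

theorem fs_Lst (b : Bool) : IsFsigma (Lst b) := by
  have : Lst b = ⋃ n, ({y : Cantor | y (2*n) = true} ∩ {y | y (2*n+1) = b} ∩ ⋂ m > n, {y : Cantor | y (2*m) = true}ᶜ) := by
    ext y
    simp only [Lst, Mk, mem_ofPred_eq, mem_iUnion, mem_inter_iff, mem_iInter, mem_compl_iff, and_assoc]
  rw [this]
  refine IsFs.iUnion fun n => IsFs.closed (((clopen_coord _ _).1.inter (clopen_coord _ _).1).inter ?_)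
  exact isClosed_iInter fun m => isClosed_iInter fun _ => (clopen_coord _ _).2.isClosed_compl

theorem Lst_not_inf {b : Bool} {y : Cantor} (h : y ∈ Lst b) : y ∉ MInf := by
  obtain ⟨n, -, -, h⟩ := h
  intro hi
  obtain ⟨m, hm, hnm⟩ := (Set.infinite_iff_exists_gt.1 hi) n
  exact h m hnm hm

theorem Lst_uniq {b c : Bool} {y : Cantor} (h : y ∈ Lst b) (h' : y ∈ Lst c) : b = c := by
  obtain ⟨n, h1, h2, h3⟩ := h
  obtain ⟨m, h1', h2', h3'⟩ := h'
  have : n = m := by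
    rcases lt_trichotomy n m with h | h | h
    · exact absurd h1' (h3 m h)
    · exact h
    · exact absurd h1 (h3' n h)
  subst this
  rw [← h2, h2']

theorem Lst_cases (y : Cantor) : (∀ m, ¬ Mk y m) ∨ y ∈ Lst false ∨ y ∈ Lst true ∨ y ∈ MInf := by
  by_cases h : y ∈ MInf
  · tauto
  by_cases h0 : ∀ m, ¬ Mk y m
  · exact Or.inl h0
  right
  push Not at h0
  have hf : (setOf (Mk y)).Finite := Set.not_infinite.1 h
  obtain ⟨n, hn, hmax⟩ := hf.exists_maximal h0
  have h2 : ∀ m > n, ¬ Mk y m := fun m hm h => absurd (hmax h (le_of_lt hm)) (not_le.2 hm)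
  cases hb : y (2*n+1)
  · exact Or.inl ⟨n, hn, hb, h2⟩
  · exact Or.inr (Or.inl ⟨n, hn, hb, h2⟩)

theorem contOn_dec : ContinuousOn dec MInf := by
  refine continuousOn_pi.2 fun k => ?_
  intro y hy
  have : ∀ᶠ z in 𝓝[MInf] y, dec y k = dec z k := by
    have h1 : Cy y (2 * Nat.nth (Mk y) k + 2) ∈ 𝓝[MInf] y :=
      mem_nhdsWithin_of_mem_nhds ((isOpen_Cy _ _).mem_nhds (mem_Cy_self _ _))
    filter_upwards [h1, self_mem_nhdsWithin] with z hz hzi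
    have h2 : Nat.nth (Mk z) k = Nat.nth (Mk y) k := by
      refine nth_agree hy hzi fun m hm => ?_
      simp only [Mk]
      rw [hz (2*m) (by omega)]
    simp only [dec]
    rw [h2, hz _ (by omega)]
  exact (continuousWithinAt_const (b := dec y k)).congr_of_eventuallyEq (this.mono fun z h => h.symm) rfl

theorem starDec_Star (B : Set Cantor) : StarDec univ (Star B) univ B := by
  have h0 : IsFsigma ({y : Cantor | ∀ m, ¬ Mk y m} ∪ Lst false) := by
    refine IsFs.union (IsFs.closed ?_) (fs_Lst _)
    have : {y : Cantor | ∀ m, ¬ Mk y m} = ⋂ m, {y : Cantor | y (2*m) = true}ᶜ := by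
      ext y; simp [Mk]
    rw [this]
    exact isClosed_iInter fun m => (clopen_coord _ _).2.isClosed_compl
  refine ⟨_, Lst true, h0, fs_Lst _, ?_, fun x _ hx => Or.inl hx, dec, ?_, fun _ _ => trivial, ?_⟩
  · rintro y - (hy | hy) (h | h)
    · obtain ⟨n, h1, -⟩ := h; exact hy n h1
    · obtain ⟨n, h1⟩ := h.1.nonempty; exact hy n h1
    · exact absurd (Lst_uniq hy h) (by simp)
    · exact Lst_not_inf hy h.1
  · refine contOn_dec.mono ?_
    rintro y ⟨-, hy⟩
    rcases Lst_cases y with h | h | h | h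
    · exact absurd (Or.inl (Or.inl h)) hy
    · exact absurd (Or.inl (Or.inr h)) hy
    · exact absurd (Or.inr h) hy
    · exact h
  · rintro y ⟨-, hy⟩
    have h1 : y ∉ Lst true := fun h => hy (Or.inr h)
    have h2 : y ∈ MInf := by
      rcases Lst_cases y with h | h | h | h
      · exact absurd (Or.inl (Or.inl h)) hy
      · exact absurd (Or.inl (Or.inr h)) hy
      · exact absurd (Or.inr h) hy
      · exact h
    simp only [Star, mem_union, h1, false_or, mem_inter_iff, h2, true_and, mem_ofPred_eq]

theorem meas_MInf : MeasurableSet MInf := by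
  have : MInf = ⋂ n : ℕ, ⋃ m > n, {y : Cantor | y (2*m) = true} := by
    ext y
    simp only [MInf, mem_ofPred_eq, Set.infinite_iff_exists_gt, mem_iInter, mem_iUnion, Mk]
    exact forall_congr' fun n => exists_congr fun m => by
      simp only [gt_iff_lt, exists_prop]
      rw [and_comm]
      rfl
  rw [this]
  exact MeasurableSet.iInter fun n => MeasurableSet.iUnion fun m => MeasurableSet.iUnion fun _ =>
    (clopen_coord _ _).2.measurableSet

theorem meas_Star {B : Set Cantor} (hB : MeasurableSet B) : MeasurableSet (Star B) := by
  refine (IsFs.meas (fs_Lst _)).union ?_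
  have h1 : Measurable (MInf.restrict dec) := (continuousOn_iff_continuous_restrict.1 contOn_dec).measurable
  have h2 : MInf ∩ {y | dec y ∈ B} = Subtype.val '' ((MInf.restrict dec) ⁻¹' B) := by
    ext y
    constructor
    · rintro ⟨a, b⟩; exact ⟨⟨y, a⟩, b, rfl⟩
    · rintro ⟨⟨z, a⟩, b, rfl⟩; exact ⟨a, b⟩
  rw [h2]
  exact meas_MInf.subtype_image (h1 hB)

def extb (z : Cantor) (n : ℕ) (b : Bool) : Cantor := fun i => if i = 2*n then true else if i = 2*n+1 then b else z i

theorem extb_mem {z : Cantor} {n : ℕ} {b : Bool} : extb z n b ∈ Cy z (2*n) := by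
  intro i hi
  simp only [extb]
  rw [if_neg (by omega), if_neg (by omega)]

theorem extb_Lst {z : Cantor} {n : ℕ} {b : Bool} (hz : ∀ i ≥ 2*n, z i = false) : extb z n b ∈ Lst b := by
  refine ⟨n, by simp [Mk, extb], by simp [extb], fun m hm => ?_⟩
  simp only [Mk, extb]
  rw [if_neg (by omega), if_neg (by omega), hz _ (by omega)]
  simp

def hst (M : Cantor → ℕ → ℕ) (x : Cantor) : ℕ → Cantor × ℕ
  | 0 => (fun _ => false, 0)
  | k+1 => (extb (hst M x k).1 (hst M x k).2 (x k), M (hst M x k).1 (hst M x k).2)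

theorem hst_congr (M : Cantor → ℕ → ℕ) {x x' : Cantor} {k : ℕ} (h : x' ∈ Cy x k) : hst M x' k = hst M x k := by
  induction k with
  | zero => rfl
  | succ k ih =>
    simp only [hst]
    rw [ih (Cy_anti _ (Nat.le_succ k) h), h k (Nat.lt_succ_self k)]

theorem harrington {B W B' : Set Cantor} (h : Red univ (Star B) W B') :
    ∃ g : Cantor → Cantor, Continuous g ∧ Function.Injective g ∧ (∀ x, g x ∈ W) ∧ ∀ x, (x ∈ B ↔ g x ∈ B') := by
  classical
  obtain ⟨f, hf, hfW, hfB⟩ := h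
  have hfc : Continuous f := continuousOn_univ.1 hf
  have hM : ∀ (z : Cantor) (n : ℕ), ∃ M, n < M ∧ ((∀ i ≥ 2*n, z i = false) →
      ∀ y0 ∈ Cy (extb z n false) (2*M), ∀ y1 ∈ Cy (extb z n true) (2*M), f y0 ≠ f y1) := by
    intro z n
    by_cases hz : ∀ i ≥ 2*n, z i = false
    · have h1 : f (extb z n true) ∈ B' := (hfB _ trivial).1 (Or.inl (extb_Lst hz))
      have h0 : f (extb z n false) ∉ B' := by
        intro h
        rcases (hfB _ trivial).2 h with h | h
        · exact absurd (Lst_uniq (extb_Lst hz) h) (by simp)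
        · exact Lst_not_inf (extb_Lst hz) h.1
      have hne : f (extb z n false) ≠ f (extb z n true) := fun h => h0 (h ▸ h1)
      obtain ⟨i, hi⟩ := Function.ne_iff.1 hne
      obtain ⟨m0, hm0⟩ := exists_Cy_subset (hfc.continuousAt.preimage_mem_nhds
        ((isOpen_Cy (f (extb z n false)) (i+1)).mem_nhds (mem_Cy_self _ _)))
      obtain ⟨m1, hm1⟩ := exists_Cy_subset (hfc.continuousAt.preimage_mem_nhds
        ((isOpen_Cy (f (extb z n true)) (i+1)).mem_nhds (mem_Cy_self _ _)))
      refine ⟨m0 + m1 + n + 1, by omega, fun _ y0 hy0 y1 hy1 he => hi ?_⟩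
      have e0 := hm0 (Cy_anti _ (by omega) hy0) i (Nat.lt_succ_self i)
      have e1 := hm1 (Cy_anti _ (by omega) hy1) i (Nat.lt_succ_self i)
      rw [← e0, ← e1, he]
    · exact ⟨n+1, by omega, fun h => absurd h hz⟩
  choose M hMn hMf using hM
  let Z : Cantor → ℕ → Cantor := fun x k => (hst M x k).1
  let N : Cantor → ℕ → ℕ := fun x k => (hst M x k).2
  have hZs : ∀ x k, Z x (k+1) = extb (Z x k) (N x k) (x k) := fun x k => rfl
  have hNs : ∀ x k, N x (k+1) = M (Z x k) (N x k) := fun x k => rfl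
  have hNlt : ∀ x k, N x k < N x (k+1) := fun x k => by rw [hNs]; exact hMn _ _
  have hNm : ∀ x, StrictMono (N x) := fun x => strictMono_nat_of_lt_succ (hNlt x)
  have hzf : ∀ x k, ∀ i ≥ 2 * N x k, Z x k i = false := by
    intro x k
    induction k with
    | zero => exact fun i _ => rfl
    | succ k ih =>
      intro i hi
      have := hNlt x k
      rw [hZs]
      simp only [extb]
      rw [if_neg (by omega), if_neg (by omega)]
      exact ih i (by omega)
  have hZm : ∀ x k m, k ≤ m → Z x m ∈ Cy (Z x k) (2 * N x k) := by
    intro x k m hkm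
    induction m, hkm using Nat.le_induction with
    | base => exact mem_Cy_self _ _
    | succ m hm ih =>
      have h1 : N x k ≤ N x m := (hNm x).monotone hm
      rw [← Cy_eq ih, hZs]
      exact Cy_anti _ (by omega) extb_mem
  let y : Cantor → Cantor := fun x i => Z x (i+1) i
  have hyZ : ∀ x k, y x ∈ Cy (Z x k) (2 * N x k) := by
    intro x k i hi
    have hle : i + 1 ≤ N x (i+1) := (hNm x).id_le (i+1)
    rcases le_total k (i+1) with h | h
    · exact hZm x k (i+1) h i hi
    · exact (hZm x (i+1) k h i (by omega)).symm
  have hmk1 : ∀ x k, Mk (y x) (N x k) ∧ y x (2 * N x k + 1) = x k := by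
    intro x k
    have h1 := hNlt x k
    have h2 := hyZ x (k+1) (2 * N x k) (by omega)
    have h3 := hyZ x (k+1) (2 * N x k + 1) (by omega)
    rw [hZs] at h2 h3
    simp only [extb] at h2 h3
    rw [if_neg (by omega)] at h3
    exact ⟨by simpa [Mk] using h2, by simpa using h3⟩
  have hmk2 : ∀ x k n, Z x k (2*n) = true → ∃ j, N x j = n := by
    intro x k n
    induction k with
    | zero => intro h; exact absurd h (by simp [Z, hst])
    | succ k ih =>
      intro h
      rw [hZs] at h
      simp only [extb] at h
      by_cases he : 2 * n = 2 * N x k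
      · exact ⟨k, by omega⟩
      · rw [if_neg he, if_neg (by omega)] at h
        exact ih h
  have hrange : ∀ x, range (N x) = setOf (Mk (y x)) := by
    intro x
    ext n
    constructor
    · rintro ⟨k, rfl⟩; exact (hmk1 x k).1
    · intro h
      exact hmk2 x (2*n+1) n h
  have hinf : ∀ x, y x ∈ MInf := by
    intro x
    change (setOf (Mk (y x))).Infinite
    rw [← hrange]
    exact Set.infinite_range_of_injective (hNm x).injective
  have hdec : ∀ x, dec (y x) = x := by
    intro x
    have h1 : Nat.nth (Mk (y x)) = N x := by
      refine ((Nat.nth_strictMono (hinf x)).range_inj (hNm x)).1 ?_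
      rw [Nat.range_nth_of_infinite (hinf x), hrange]
      rfl
    funext k
    simp only [dec]
    rw [h1]
    exact (hmk1 x k).2
  have hyc : Continuous y := by
    refine continuous_pi fun i => continuous_iff_continuousAt.2 fun x => ?_
    have : ∀ᶠ x' in 𝓝 x, y x i = y x' i := by
      filter_upwards [(isOpen_Cy x (i+1)).mem_nhds (mem_Cy_self _ _)] with x' hx'
      simp only [y, Z]
      rw [hst_congr M hx']
    exact (continuousAt_const (y := y x i)).congr this
  refine ⟨fun x => f (y x), hfc.comp hyc, ?_, fun x => hfW trivial, fun x => ?_⟩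
  · intro x x' he
    by_contra hne
    have hex : ∃ k, x k ≠ x' k := Function.ne_iff.1 hne
    set k := Nat.find hex
    have hk : x k ≠ x' k := Nat.find_spec hex
    have hC : x' ∈ Cy x k := fun i hi => by
      have := Nat.find_min hex hi; push Not at this; exact this.symm
    have hZZ : Z x' k = Z x k := congrArg Prod.fst (hst_congr M hC)
    have hNN : N x' k = N x k := congrArg Prod.snd (hst_congr M hC)
    have h1 := hyZ x (k+1)
    have h2 := hyZ x' (k+1)
    rw [hZs, hNs] at h1 h2
    rw [hZZ, hNN] at h2
    have h3 := hMf (Z x k) (N x k) (hzf x k)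
    cases hb : x k <;> cases hb' : x' k
    · exact hk (hb.trans hb'.symm)
    · rw [hb] at h1; rw [hb'] at h2
      exact h3 _ h1 _ h2 he
    · rw [hb] at h1; rw [hb'] at h2
      exact h3 _ h2 _ h1 he.symm
    · exact hk (hb.trans hb'.symm)
  · rw [← hfB _ trivial]
    have h1 : y x ∉ Lst true := fun h => Lst_not_inf h (hinf x)
    simp only [Star, mem_union, h1, false_or, mem_inter_iff, hinf x, true_and, mem_ofPred_eq, hdec]

end HS



namespace HS

open Topology Filter

/-- bitwise extension of a continuous map to a `Gδ` set -/
theorem ext_cont {X : Set Cantor} (f : X → Cantor) (hf : Continuous f) :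
    ∃ (G : Set Cantor) (f0 : Cantor → Cantor), IsGδ G ∧ X ⊆ G ∧ ContinuousOn f0 G ∧ ∀ x : X, f0 x = f x := by
  classical
  have hU : ∀ (b : Bool) (i : ℕ), ∃ U : Set Cantor, IsOpen U ∧ ∀ x : X, ((x : Cantor) ∈ U ↔ f x i = b) := by
    intro b i
    have h1 : IsOpen {x : X | f x i = b} := by
      have : Continuous fun x : X => f x i := (continuous_apply i).comp hf
      exact (isOpen_discrete ({b} : Set Bool)).preimage this
    obtain ⟨U, hU, hU'⟩ := isOpen_induced_iff.1 h1
    refine ⟨U, hU, fun x => ?_⟩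
    have := congrArg (fun s => x ∈ s) hU'
    simpa using this
  choose U hUo hU using hU
  let f0 : Cantor → Cantor := fun z i => decide (z ∈ U true i)
  refine ⟨⋂ i, ((U true i ∪ U false i) ∩ (U true i ∩ U false i)ᶜ), f0, ?_, ?_, ?_, ?_⟩
  · exact IsGδ.iInter fun i => (((hUo _ i).union (hUo _ i)).isGδ).inter
      (((hUo _ i).inter (hUo _ i)).isClosed_compl.isGδ)
  · intro x hx
    refine mem_iInter.2 fun i => ?_
    have h1 := hU true i ⟨x, hx⟩
    have h2 := hU false i ⟨x, hx⟩
    simp only at h1 h2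
    simp only [mem_inter_iff, mem_union, mem_compl_iff, h1, h2]
    cases f ⟨x, hx⟩ i <;> simp
  · refine continuousOn_pi.2 fun i z hz => ?_
    have hzi := mem_iInter.1 hz i
    by_cases hzt : z ∈ U true i
    · have hev : ∀ᶠ y in 𝓝[⋂ i, ((U true i ∪ U false i) ∩ (U true i ∩ U false i)ᶜ)] z, f0 y i = true := by
        filter_upwards [mem_nhdsWithin_of_mem_nhds ((hUo true i).mem_nhds hzt)] with y hy
        simpa [f0] using hy
      exact (continuousWithinAt_const (b := true)).congr_of_eventuallyEq hev (by simpa [f0] using hzt)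
    · have hzf : z ∈ U false i := hzi.1.resolve_left hzt
      have hev : ∀ᶠ y in 𝓝[⋂ i, ((U true i ∪ U false i) ∩ (U true i ∩ U false i)ᶜ)] z, f0 y i = false := by
        filter_upwards [mem_nhdsWithin_of_mem_nhds ((hUo false i).mem_nhds hzf), self_mem_nhdsWithin] with y hy hy'
        have := (mem_iInter.1 hy' i).2
        simp only [f0, decide_eq_false_iff_not]
        exact fun h => this ⟨h, hy⟩
      exact (continuousWithinAt_const (b := false)).congr_of_eventuallyEq hev (by simpa [f0] using hzt)
  · intro x
    funext i
    simp only [f0]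
    have := hU true i x
    cases h : f x i
    · rw [h] at this; simpa using this
    · rw [h] at this; simpa using this

theorem local_hom {X W : Set Cantor} (hhom : IsHomogeneous X) {x : Cantor} (hx : x ∈ X)
    (hW : IsClopen W) (hne : (X ∩ W).Nonempty) :
    ∃ (n : ℕ) (G : Set Cantor), IsGδ G ∧ (X ∩ Cy x n ⊆ G) ∧ Red G X W X := by
  obtain ⟨w, hwX, hwW⟩ := hne
  obtain ⟨h, hh⟩ := hhom ⟨x, hx⟩ ⟨w, hwX⟩
  obtain ⟨Ga, f0, hGa, hXa, hf0, hf0e⟩ := ext_cont (fun z : X => (h z : Cantor))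
    (continuous_subtype_val.comp h.continuous)
  obtain ⟨Gb, g0, hGb, hXb, hg0, hg0e⟩ := ext_cont (fun z : X => (h.symm z : Cantor))
    (continuous_subtype_val.comp h.symm.continuous)
  obtain ⟨F, hF, hFe⟩ := pull_fs hf0 (IsFs.of_isGδ hGb)
  have hG1 : IsGδ (Ga \ F) := gdiff hGa hF
  have hf1 : ContinuousOn f0 (Ga \ F) := hf0.mono diff_subset
  have hm1 : MapsTo f0 (Ga \ F) Gb := by
    intro z hz
    by_contra hc
    exact hz.2 ((hFe z hz.1).2 hc)
  have hc1 : ContinuousOn (fun z => g0 (f0 z)) (Ga \ F) := hg0.comp hf1 hm1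
  have hcl : IsClosed {z : (Ga \ F : Set Cantor) | g0 (f0 z) = z} :=
    isClosed_eq (continuousOn_iff_continuous_restrict.1 hc1) continuous_subtype_val
  obtain ⟨C, hC, hCe⟩ := isClosed_induced_iff.1 hcl
  have hCe' : ∀ z ∈ Ga \ F, (z ∈ C ↔ g0 (f0 z) = z) := by
    intro z hz
    have := congrArg (fun s => (⟨z, hz⟩ : (Ga \ F : Set Cantor)) ∈ s) hCe
    simpa using this
  have hW' : ∃ n, ∀ z ∈ Ga, z ∈ Cy x n → f0 z ∈ W := by
    have h1 : f0 x ∈ W := by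
      have := hf0e ⟨x, hx⟩
      simp only [hh] at this
      rw [this]; exact hwW
    have h2 := (hf0 x (hXa hx)) (hW.2.mem_nhds h1)
    obtain ⟨u, hu, hxu, huW⟩ := mem_nhdsWithin.1 h2
    obtain ⟨n, hn⟩ := exists_Cy_subset (hu.mem_nhds hxu)
    exact ⟨n, fun z hz hzn => huW ⟨hn hzn, hz⟩⟩
  obtain ⟨n, hn⟩ := hW'
  have hXG : ∀ z (hz : z ∈ X), z ∈ Ga \ F ∧ g0 (f0 z) = z := by
    intro z hz
    have h1 := hf0e ⟨z, hz⟩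
    have h2 : f0 z ∈ X := by
      rw [show f0 z = _ from h1]; exact (h ⟨z, hz⟩).2
    refine ⟨⟨hXa hz, fun hzF => (hFe z (hXa hz)).1 hzF (hXb h2)⟩, ?_⟩
    have h3 := hg0e (h ⟨z, hz⟩)
    rw [show f0 z = _ from h1]
    simp only [Homeomorph.symm_apply_apply] at h3
    exact h3
  refine ⟨n, (Cy x n ∩ (Ga \ F)) ∩ C, (clopen_gd (isClopen_Cy x n) hG1).inter hC.isGδ, ?_, f0, ?_, ?_, ?_⟩
  · rintro z ⟨hzX, hzn⟩
    obtain ⟨h1, h2⟩ := hXG z hzX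
    exact ⟨⟨hzn, h1⟩, (hCe' z h1).2 h2⟩
  · exact hf1.mono fun z hz => hz.1.2
  · rintro z ⟨⟨hzn, hz⟩, -⟩
    exact hn z hz.1 hzn
  · rintro z ⟨⟨hzn, hz⟩, hzC⟩
    constructor
    · intro hzX
      rw [show f0 z = _ from hf0e ⟨z, hzX⟩]; exact (h ⟨z, hzX⟩).2
    · intro hfX
      have h1 := hg0e ⟨f0 z, hfX⟩
      rw [← (hCe' z hz).1 hzC, show g0 (f0 z) = _ from h1]
      exact (h.symm ⟨f0 z, hfX⟩).2

theorem starDec_hom {X W : Set Cantor} (hhom : IsHomogeneous X)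
    (hW : IsClopen W) (hne : (X ∩ W).Nonempty) : StarDec univ X W X := by
  classical
  have hloc := fun x : X => local_hom hhom x.2 hW hne
  choose N G hG hXG f hf hfm hfX using hloc
  obtain ⟨T, hT, hTe⟩ := TopologicalSpace.isOpen_iUnion_countable (fun x : X => Cy (x : Cantor) (N x))
    (fun x => isOpen_Cy _ _)
  have hTX : ∀ z ∈ X, ∃ t ∈ T, z ∈ Cy (t : Cantor) (N t) := by
    intro z hz
    have : z ∈ ⋃ x : X, Cy (x : Cantor) (N x) := mem_iUnion.2 ⟨⟨z, hz⟩, mem_Cy_self _ _⟩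
    rw [← hTe] at this
    simpa using this
  obtain ⟨x0, hx0, -⟩ := hne
  have hTne : T.Nonempty := by
    obtain ⟨t, ht, -⟩ := hTX x0 hx0; exact ⟨t, ht⟩
  obtain ⟨e, he⟩ := hT.exists_eq_range hTne
  let V : ℕ → Set Cantor := fun n => Cy (e n : Cantor) (N (e n))
  have hVc : ∀ n, IsClopen (V n) := fun n => isClopen_Cy _ _
  have hXV : ∀ z ∈ X, ∃ n, z ∈ V n := by
    intro z hz
    obtain ⟨t, ht, htz⟩ := hTX z hz
    rw [he] at ht
    obtain ⟨n, rfl⟩ := ht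
    exact ⟨n, htz⟩
  let V' : ℕ → Set Cantor := fun n => V n \ ⋃ m ∈ Finset.range n, V m
  have hV'c : ∀ n, IsClopen (V' n) := fun n => (hVc n).diff
    (Set.Finite.isClopen_biUnion (Finset.finite_toSet _) fun m _ => hVc m)
  have hV'u : ∀ z n m, z ∈ V' n → z ∈ V' m → n = m := by
    intro z n m hn hm
    rcases lt_trichotomy n m with h | h | h
    · exact absurd (mem_iUnion₂.2 ⟨n, Finset.mem_range.2 h, hn.1⟩) hm.2
    · exact h
    · exact absurd (mem_iUnion₂.2 ⟨m, Finset.mem_range.2 h, hm.1⟩) hn.2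
  have hV'e : ∀ z n, z ∈ V n → ∃ n, z ∈ V' n := by
    intro z n hn
    have hex : ∃ n, z ∈ V n := ⟨n, hn⟩
    refine ⟨Nat.find hex, Nat.find_spec hex, ?_⟩
    intro hc
    obtain ⟨m, hm, hzm⟩ := mem_iUnion₂.1 hc
    exact Nat.find_min hex (Finset.mem_range.1 hm) hzm
  let F0 : Set Cantor := (⋃ n, V n)ᶜ ∪ ⋃ n, (V' n ∩ (G (e n))ᶜ)
  have hF0 : IsFsigma F0 := IsFs.union (IsFs.closed (isOpen_iUnion fun n => (hVc n).2).isClosed_compl)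
    (IsFs.iUnion fun n => IsFs.inter (IsFs.closed (hV'c n).1) (IsFs.of_isGδ (hG _)))
  have hZ : ∀ z, z ∉ F0 → ∃ n, z ∈ V' n ∧ z ∈ G (e n) := by
    intro z hz
    have h1 : z ∈ ⋃ n, V n := by
      by_contra hc; exact hz (Or.inl hc)
    obtain ⟨n, hn⟩ := mem_iUnion.1 h1
    obtain ⟨m, hm⟩ := hV'e z n hn
    refine ⟨m, hm, ?_⟩
    by_contra hc
    exact hz (Or.inr (mem_iUnion.2 ⟨m, hm, hc⟩))
  let g : Cantor → Cantor := fun z => if h : ∃ n, z ∈ V' n then f (e h.choose) z else z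
  have hg : ∀ z n, z ∈ V' n → g z = f (e n) z := by
    intro z n hn
    have h : ∃ n, z ∈ V' n := ⟨n, hn⟩
    simp only [g, dif_pos h]
    rw [hV'u z _ n h.choose_spec hn]
  refine ⟨F0, ∅, hF0, IsFs.empty, ?_, by simp, g, ?_, ?_, ?_⟩
  · rintro z - (hz | hz) hzX
    · obtain ⟨n, hn⟩ := hXV z hzX
      exact hz (mem_iUnion.2 ⟨n, hn⟩)
    · obtain ⟨n, hn, hn'⟩ := mem_iUnion.1 hz
      exact hn' (hXG (e n) ⟨hzX, hn.1⟩)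
  · rintro z ⟨-, hz⟩
    rw [union_empty] at hz ⊢
    obtain ⟨n, hn, hnG⟩ := hZ z hz
    have h1 : ContinuousWithinAt (f (e n)) (V' n ∩ (univ \ F0)) z := by
      refine (hf (e n) z hnG).mono ?_
      rintro y ⟨hy, -, hyF⟩
      obtain ⟨m, hm, hmG⟩ := hZ y hyF
      rw [hV'u y n m hy hm]; exact hmG
    have h2 : ContinuousWithinAt g (V' n ∩ (univ \ F0)) z :=
      h1.congr (fun y hy => hg y n hy.1) (hg z n hn)
    exact (continuousWithinAt_inter' (mem_nhdsWithin_of_mem_nhds ((hV'c n).2.mem_nhds hn))).1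
      (by rw [inter_comm]; exact h2)
  · rintro z ⟨-, hz⟩
    rw [union_empty] at hz
    obtain ⟨n, hn, hnG⟩ := hZ z hz
    rw [hg z n hn]
    exact hfm _ hnG
  · rintro z ⟨-, hz⟩
    rw [union_empty] at hz
    obtain ⟨n, hn, hnG⟩ := hZ z hz
    rw [hg z n hn]
    exact hfX _ z hnG

end HS



namespace HS

open Topology Filter

theorem hom_meagre {X O : Set Cantor} (hd : Dense X) (hhom : IsHomogeneous X) (hO : IsOpen O) (hne : O.Nonempty)
    (hm : IsMeagre (X ∩ O)) : IsMeagre X := by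
  obtain ⟨F, hF, hFi, hsub⟩ := meagre_closed hm
  obtain ⟨w, hwO, hwX⟩ := hd.inter_open_nonempty O hO hne
  have hA : IsMeagre ((Subtype.val : X → Cantor) ⁻¹' O) := by
    have h1 : ∀ n, IsMeagre ((Subtype.val : X → Cantor) ⁻¹' (F n)) := by
      intro n
      refine IsNowhereDense.isMeagre ?_
      rw [((hF n).preimage continuous_subtype_val).isNowhereDense_iff]
      by_contra hc
      obtain ⟨z, hz⟩ := nonempty_iff_ne_empty.2 hc
      obtain ⟨U, hUF, hU, hzU⟩ := mem_interior.1 hz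
      obtain ⟨O', hO', rfl⟩ := isOpen_induced_iff.1 hU
      have h2 : O' ⊆ F n := by
        refine (hd.open_subset_closure_inter hO').trans (closure_minimal ?_ (hF n))
        rintro y ⟨hyO, hyX⟩
        exact hUF (show (⟨y, hyX⟩ : X) ∈ _ from hyO)
      have h3 := interior_maximal h2 hO'
      rw [hFi n] at h3
      exact h3 hzU
    have h2 := isMeagre_iUnion h1
    refine h2.mono ?_
    intro y hy
    obtain ⟨n, hn⟩ := mem_iUnion.1 (hsub ⟨y.2, hy⟩)
    exact mem_iUnion.2 ⟨n, hn⟩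
  have hloc : ∀ x : X, ∃ V : Set X, IsOpen V ∧ x ∈ V ∧ IsMeagre V := by
    intro x
    obtain ⟨h, hh⟩ := hhom x ⟨w, hwX⟩
    refine ⟨h ⁻¹' ((Subtype.val : X → Cantor) ⁻¹' O), (hO.preimage continuous_subtype_val).preimage h.continuous,
      ?_, IsMeagre.preimage_of_isOpenMap h.continuous h.isOpenMap hA⟩
    simp only [mem_preimage, hh]
    exact hwO
  choose V hVo hxV hVm using hloc
  obtain ⟨T, hT, hTe⟩ := TopologicalSpace.isOpen_iUnion_countable V hVo
  have : Countable T := hT.to_subtype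
  have h3 : IsMeagre (⋃ t : T, V t) := isMeagre_iUnion fun t => hVm _
  have h4 : IsMeagre (univ : Set X) := by
    refine h3.mono ?_
    intro x _
    have : x ∈ ⋃ i, V i := mem_iUnion.2 ⟨x, hxV x⟩
    rw [← hTe] at this
    obtain ⟨t, ht, hxt⟩ := mem_iUnion₂.1 this
    exact mem_iUnion.2 ⟨⟨t, ht⟩, hxt⟩
  have h5 := h4.image_val
  rwa [image_univ, Subtype.range_val] at h5

theorem MgrIn.meagre {A V : Set Cantor} (hV : IsClopen V) (h : MgrIn A V) : IsMeagre (A ∩ V) := by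
  obtain ⟨F, hF, hnd, hsub⟩ := h
  have h1 : ∀ n, IsMeagre (F n ∩ V) := by
    intro n
    refine IsNowhereDense.isMeagre ?_
    rw [((hF n).inter hV.1).isNowhereDense_iff]
    by_contra hc
    obtain ⟨z, hz⟩ := nonempty_iff_ne_empty.2 hc
    obtain ⟨m, hm⟩ := exists_Cy_subset (mem_interior_iff_mem_nhds.1 hz)
    obtain ⟨y, hy, hyF⟩ := hnd n (Cy z m) (isClopen_Cy _ _) ⟨z, mem_Cy_self _ _, (hm (mem_Cy_self _ _)).2⟩
    exact hyF (hm hy.1).1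
  have h2 := isMeagre_iUnion h1
  refine h2.mono ?_
  intro y hy
  obtain ⟨n, hn⟩ := mem_iUnion.1 (hsub hy)
  exact mem_iUnion.2 ⟨n, hn, hy.2⟩

theorem hom_comeagre {X V : Set Cantor} (hX : MeasurableSet X) (hd : Dense X) (hhom : IsHomogeneous X)
    (hV : IsOpen V) (hne : V.Nonempty) (hm : IsMeagre (Xᶜ ∩ V)) : IsMeagre Xᶜ := by
  obtain ⟨u, hu, hue⟩ := MeasurableSet.residualEq_isOpen hX.compl
  rcases u.eq_empty_or_nonempty with rfl | hune
  · rw [IsMeagre]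
    filter_upwards [hue] with y hy
    intro hyX
    have : y ∈ (∅ : Set Cantor) := by rw [← show _ = (y ∈ (∅ : Set Cantor)) from hy]; exact hyX
    exact this
  · exfalso
    have h1 : IsMeagre (X ∩ u) := by
      rw [IsMeagre]
      filter_upwards [hue] with y hy
      rintro ⟨hyX, hyu⟩
      have : y ∈ Xᶜ := by rw [show (y ∈ Xᶜ) = _ from hy]; exact hyu
      exact this hyX
    have h2 := hom_meagre hd hhom hu hune h1
    refine not_isMeagre_of_isOpen hV hne ((h2.union hm).mono ?_)
    intro y hy
    by_cases hyX : y ∈ X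
    · exact Or.inl hyX
    · exact Or.inr ⟨hyX, hy⟩

theorem Sfl.red_clopen {S W : Set Cantor} (hS : Sfl S) (hW : IsClopen W) (hne : W.Nonempty) :
    Red univ S W S := by
  obtain ⟨w, hw⟩ := hne
  obtain ⟨n, hn⟩ := exists_Cy_subset (hW.2.mem_nhds hw)
  have hfin : ∀ z : Cantor, {i | (if i < n then w i else z i) ≠ z i}.Finite := by
    intro z
    refine (Set.finite_lt_nat n).subset ?_
    intro i hi
    by_contra hc
    exact hi (if_neg hc)
  refine ⟨fun z i => if i < n then w i else z i, ?_, ?_, ?_⟩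
  · refine Continuous.continuousOn (continuous_pi fun i => ?_)
    by_cases h : i < n
    · simp only [if_pos h]; exact continuous_const
    · simp only [if_neg h]; exact continuous_apply i
  · intro z _
    refine hn ?_
    intro i hi
    simp [hi]
  · intro z _
    constructor
    · intro hz
      refine hS.fm z hz _ ?_
      simpa only [ne_comm] using hfin z
    · intro hz
      exact hS.fm _ hz z (hfin z)

theorem InjRed.compl {X S : Set Cantor} (h : InjRed X S) : InjRed Xᶜ Sᶜ := by
  intro W hW hne
  obtain ⟨g, h1, h2, h3, h4⟩ := h W hW hne
  exact ⟨g, h1, h2, h3, fun x => not_congr (h4 x)⟩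

theorem dense_case {X : Set Cantor} (hX : MeasurableSet X) (hd : Dense X) (hhom : IsHomogeneous X)
    (hdd : ∀ n, ¬ DD n univ X) : ∃ S, Sfl S ∧ ∃ h : Cantor ≃ₜ Cantor, ∀ x, (x ∈ X ↔ h x ∈ S) := by
  have hsd : ∀ W : Set Cantor, IsClopen W → W.Nonempty → StarDec univ X W X := fun W hW hne =>
    starDec_hom hhom hW (by rw [inter_comm]; exact hd.inter_open_nonempty W hW.2 hne)
  obtain ⟨V1, hV1, hU1⟩ := exists_unif hX (K := univ) IsGδ.univ univ_nonempty
  rw [inter_univ] at hU1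
  obtain ⟨V2, hV2, hne2, hmgr⟩ := mgr_or hX hU1.ne
  have hU := hU1.shrink hV2 hne2
  have hV : IsClopen (V2 ∩ V1) := hV2.inter hV1
  generalize V2 ∩ V1 = V at hmgr hU hV hne2
  have hddV : ∀ n, ¬ DD n V X := fun n h => hdd (n+1) (DD.of_starDec (hsd V hV hne2) h)
  have habs : Abs X V := abs_or_dd hX hU hddV
  have hred : Red univ X V X := habs univ X IsGδ.univ hX (hsd V hV hne2)
  have hredW : ∀ W : Set Cantor, IsClopen W → W.Nonempty → Red V X W X := by
    intro W hW hne
    rcases wadge hV.2.isGδ hne2 hW.2.isGδ hne hX hX with h | h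
    · exact h
    · exfalso
      have h1 : StarDec univ Xᶜ V X := (hsd W hW hne).compl.push h
      have h2 := habs univ Xᶜ IsGδ.univ hX.compl h1
      exact hU.not_self_dual hX ((Red.sub _ (subset_univ V)).trans h2)
  obtain ⟨S, hS, hXS, hSX, hmS, hmSc⟩ := good hX hU hddV
  have hi1 : InjRed S X := by
    intro W hW hne
    have h1 : StarDec univ (Star S) V X := (starDec_Star S).push hSX
    exact harrington ((habs univ (Star S) IsGδ.univ (meas_Star hS.ms) h1).trans (hredW W hW hne))
  have hi2 : InjRed X S := by
    intro W hW hne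
    have h1 : StarDec univ (Star X) V X := (starDec_Star X).push hred
    exact harrington (((habs univ (Star X) IsGδ.univ (meas_Star hX) h1).trans hXS).trans (hS.red_clopen hW hne))
  refine ⟨S, hS, ?_⟩
  rcases hmgr with h | h
  · exact steel (hom_meagre hd hhom hV.2 hne2 (h.meagre hV)) (hmS h) hi2 hi1
  · obtain ⟨g, hg⟩ := steel (hom_comeagre hX hd hhom hV.2 hne2 (h.meagre hV)) (hmSc h) hi2.compl hi1.compl
    exact ⟨g, fun x => not_iff_not.1 (hg x)⟩

end HS



namespace HS

open Topology Filter

theorem countable_fs {X : Set Cantor} (h : X.Countable) : IsFsigma X := by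
  rcases X.eq_empty_or_nonempty with rfl | hne
  · exact IsFs.empty
  · obtain ⟨e, rfl⟩ := h.exists_eq_range hne
    exact ⟨fun n => {e n}, fun n => isClosed_singleton, by ext x; simp [eq_comm]⟩

theorem no_isolated {X : Set Cantor} (hhom : IsHomogeneous X) (hdd : ∀ n, ¬ DD n univ X) :
    ∀ x ∈ X, ∀ n, ∃ y ∈ X, y ∈ Cy x n ∧ y ≠ x := by
  by_contra hc
  push Not at hc
  obtain ⟨x, hx, n, hn⟩ := hc
  have h1 : IsOpen ({⟨x, hx⟩} : Set X) := by
    have : ({⟨x, hx⟩} : Set X) = Subtype.val ⁻¹' (Cy x n) := by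
      ext y
      constructor
      · intro hy
        rw [mem_singleton_iff.1 hy]
        exact mem_Cy_self x n
      · intro hy
        exact mem_singleton_iff.2 (Subtype.ext (hn y y.2 hy))
    rw [this]
    exact (isOpen_Cy x n).preimage continuous_subtype_val
  have h2 : DiscreteTopology X := by
    refine discreteTopology_iff_isOpen_singleton.2 fun y => ?_
    obtain ⟨h, hh⟩ := hhom ⟨x, hx⟩ y
    have := h.isOpenMap _ h1
    rwa [image_singleton, hh] at this
  have h3 : Countable X := TopologicalSpace.separableSpace_iff_countable.1 inferInstance
  have h4 : IsFsigma X := countable_fs (Set.countable_coe_iff.1 h3)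
  exact hdd 1 ⟨∅, X, IsFs.empty, h4, by simp, fun x _ h => h, Or.inr fun x hx hxX => hx.2 (Or.inr hxX)⟩

theorem hom_transfer {A B : Type*} [TopologicalSpace A] [TopologicalSpace B] (e : A ≃ₜ B) (h : IsHomogeneous A) :
    IsHomogeneous B := by
  intro x y
  obtain ⟨g, hg⟩ := h (e.symm x) (e.symm y)
  exact ⟨(e.symm.trans g).trans e, by simp [hg]⟩

theorem main {X : Set Cantor} (hX : MeasurableSet X) (hhom : IsHomogeneous X)
    (hdel : ¬ InDelta X) : ∃ S : Set Cantor, IsSemifilter S ∧ Nonempty (X ≃ₜ S) := by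
  classical
  have hdd : ∀ n, ¬ DD n univ X := fun n h => hdel (DD.inDelta h)
  have hni := no_isolated hhom hdd
  have hne : X.Nonempty := by
    rw [nonempty_iff_ne_empty]
    rintro rfl
    exact hdd 0 (Or.inr fun x _ h => h)
  obtain ⟨e⟩ := brouwer (P := closure X) isClosed_closure hne.closure (by
    intro x hx n
    obtain ⟨z, hzC, hzX⟩ := mem_closure_iff.1 hx _ (isOpen_Cy x n) (mem_Cy_self x n)
    by_cases hzx : z = x
    · subst hzx
      obtain ⟨y, hy, hyC, hyz⟩ := hni z hzX n
      exact ⟨y, subset_closure hy, hyC, hyz⟩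
    · exact ⟨z, subset_closure hzX, hzC, hzx⟩)
  let b : Cantor → Cantor := fun z => (e.symm z : Cantor)
  have hb : Continuous b := continuous_subtype_val.comp e.symm.continuous
  let Y : Set Cantor := b ⁻¹' X
  have hY : MeasurableSet Y := hb.measurable hX
  have hbe : ∀ (x : Cantor) (hx : x ∈ closure X), b (e ⟨x, hx⟩) = x := by
    intro x hx; simp [b]
  have heb : ∀ (z : Cantor) (hz : b z ∈ closure X), e ⟨b z, hz⟩ = z := by
    intro z hz; simp [b]
  have heY : ∀ x : X, e ⟨x, subset_closure x.2⟩ ∈ Y := by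
    intro x
    change b _ ∈ X
    rw [hbe]; exact x.2
  let H : Y ≃ₜ X :=
    { toFun := fun z => ⟨b z, z.2⟩
      invFun := fun x => ⟨e ⟨x, subset_closure x.2⟩, heY x⟩
      left_inv := fun z => Subtype.ext (heb z.1 _)
      right_inv := fun x => Subtype.ext (hbe x.1 _)
      continuous_toFun := (hb.comp continuous_subtype_val).subtype_mk _
      continuous_invFun := (e.continuous.comp (continuous_subtype_val.subtype_mk _)).subtype_mk heY }
  have hYh : IsHomogeneous Y := hom_transfer H.symm hhom
  have hYd : Dense Y := by
    refine dense_iff_inter_open.2 fun O hO ⟨z, hz⟩ => ?_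
    have h1 : IsOpen (e ⁻¹' O) := hO.preimage e.continuous
    obtain ⟨O', hO', hOe⟩ := isOpen_induced_iff.1 h1
    have h2 : e.symm z ∈ e ⁻¹' O := by simpa using hz
    rw [← hOe] at h2
    obtain ⟨x, hxO, hxX⟩ := mem_closure_iff.1 (e.symm z).2 O' hO' h2
    have h3 : (⟨x, subset_closure hxX⟩ : closure X) ∈ e ⁻¹' O := by rw [← hOe]; exact hxO
    refine ⟨e ⟨x, subset_closure hxX⟩, h3, ?_⟩
    change b _ ∈ X
    rw [hbe]; exact hxX
  have hYdd : ∀ n, ¬ DD n univ Y := by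
    intro n hn
    have hr : Red (closure X) X univ Y := by
      refine ⟨fun z => if h : z ∈ closure X then e ⟨z, h⟩ else z, ?_, fun _ _ => trivial, ?_⟩
      · refine continuousOn_iff_continuous_restrict.2 (e.continuous.congr fun z => ?_)
        simp [Set.restrict_apply]
      · intro x hx
        simp only [dif_pos hx]
        change _ ↔ b _ ∈ X
        rw [hbe]
    have h1 := DD.pull hr hn
    refine hdd (n+1) ⟨(closure X)ᶜ, ∅, IsFs.open isClosed_closure.isOpen_compl, IsFs.empty,
      fun x _ h hx => h (subset_closure hx), by simp, ?_⟩
    have h2 : univ \ ((closure X)ᶜ ∪ ∅) = closure X := by ext; simp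
    rw [h2]; exact h1
  obtain ⟨S, hS, g, hg⟩ := dense_case hY hYd hYh hYdd
  refine ⟨S, ⟨?_, ?_, hS.up, hS.fm⟩, ⟨H.symm.trans (g.subtype hg)⟩⟩
  · intro hf
    refine hYdd 0 (Or.inl fun x _ => (hg x).2 (hS.up _ hf _ fun n hn => ?_))
    exact absurd hn (by simp)
  · obtain ⟨x, hx⟩ := hYd.nonempty
    exact hS.up _ ((hg x).1 hx) _ fun _ _ => rfl

end HS

/-- A homogeneous Borel subspace of Cantor space outside Δ is homeomorphic
to a semifilter. -/
theorem notInDelta_homeomorphic_semifilter (X : Set Cantor)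
    (hB : @MeasurableSet Cantor (borel Cantor) X)
    (hhom : IsHomogeneous X) (hdel : ¬ InDelta X) :
    ∃ S : Set Cantor, IsSemifilter S ∧ Nonempty (X ≃ₜ S) := by
  have hX : MeasurableSet X := by
    have h : borel Cantor = (inferInstance : MeasurableSpace Cantor) :=
      (BorelSpace.measurable_eq (α := Cantor)).symm
    rw [h] at hB
    exact hB
  exact HS.main hX hhom hdel
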